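/- arXiv:1611.05498 — 3 statements merged into one kernel-verified Lean document; each statement's English description precedes it below -/
import Mathlib

section
/- Let f : 𝕋² → 𝕋² be a homeomorphism homotopic to the identity which is an extension of an irrational rotation, and let F : ℝ² → ℝ² be a lift of f. Then the rotation set ρ(F) consists of a single point. -/
/- STATEMENT 0: A toral homeomorphism homotopic to the identity which is an
extension of an irrational rotation has a rotation set (of any lift) consisting
of a single point. -/

noncomputable section
open Set Metric Filter Topology Function

/-- The circle `ℝ/ℤ`. -/
abbrev 𝕊 : Type := AddCircle (1:ℝ)
/-- The torus `𝕋² = ℝ²/ℤ²`. -/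
abbrev 𝕋2 : Type := 𝕊 × 𝕊

/-- The universal covering projection `π : ℝ² → 𝕋²`. -/
def π2 : ℝ × ℝ → 𝕋2 := fun p => ((p.1 : 𝕊), (p.2 : 𝕊))

/-- The rotation set of a lift `F : ℝ² → ℝ²`. -/
def rotSet (F : ℝ × ℝ → ℝ × ℝ) : Set (ℝ × ℝ) :=
  {v | ∃ (n : ℕ → ℕ) (x : ℕ → ℝ × ℝ),
    Tendsto n atTop atTop ∧
    Tendsto (fun i => (n i : ℝ)⁻¹ • (F^[n i] (x i) - x i)) atTop (𝓝 v)}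

/-- Continuous circle-valued maps on the plane lift to the line. -/
theorem exists_continuous_lift_addCircle {g : ℝ × ℝ → 𝕊} (hg : Continuous g) :
    ∃ θ : ℝ × ℝ → ℝ, Continuous θ ∧ ∀ p, (θ p : 𝕊) = g p := by
  obtain ⟨e, he⟩ := QuotientAddGroup.mk_surjective (g 0)
  obtain ⟨θ, ⟨-, h⟩, -⟩ := (AddCircle.isCoveringMap_coe (1 : ℝ)).existsUnique_continuousMap_lifts
    ⟨g, hg⟩ 0 e he
  exact ⟨θ, θ.continuous, fun p => congrFun h p⟩

/-- A nonvanishing planar vector field on the plane has a continuous angle. -/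
theorem exists_continuous_angle {Φ : ℝ × ℝ → ℝ × ℝ} (hΦ : Continuous Φ) (h0 : ∀ p, Φ p ≠ 0) :
    ∃ θ : ℝ × ℝ → ℝ, Continuous θ ∧ ∀ p, ∃ r > 0, Φ p = (r * Real.cos (θ p), r * Real.sin (θ p)) := by
  let z : ℝ × ℝ → ℂ := fun p => ⟨(Φ p).1, (Φ p).2⟩
  have hz : Continuous z := by
    have : z = fun p => ((Φ p).1 : ℂ) + ((Φ p).2 : ℂ) * Complex.I := by
      funext p; apply Complex.ext <;> simp [z]
    rw [this]; fun_prop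
  have hz0 : ∀ p, z p ≠ 0 := fun p hp => h0 p (by
    have := Complex.ext_iff.1 hp
    exact Prod.ext this.1 this.2)
  have hn : ∀ p, ‖z p / (‖z p‖ : ℂ)‖ = 1 := fun p => by
    have := norm_ne_zero_iff.2 (hz0 p)
    simp [this]
  let g : C(ℝ × ℝ, Circle) := ⟨fun p => ⟨z p / (‖z p‖ : ℂ), mem_sphere_zero_iff_norm.2 (hn p)⟩, by
    refine Continuous.subtype_mk (hz.div (by fun_prop) fun p => ?_) _
    simpa using hz0 p⟩
  obtain ⟨e, he⟩ : ∃ e : ℝ, Circle.exp e = g 0 := ⟨_, Circle.exp_arg (g 0)⟩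
  obtain ⟨θ, ⟨-, h⟩, -⟩ := Circle.isCoveringMap_exp.existsUnique_continuousMap_lifts g 0 e he
  refine ⟨θ, θ.continuous, fun p => ⟨‖z p‖, norm_pos_iff.2 (hz0 p), ?_⟩⟩
  have h1 : Complex.exp (θ p * Complex.I) = z p / (‖z p‖ : ℂ) := by
    rw [← Circle.coe_exp]
    exact congrArg (fun c : Circle => (c : ℂ)) (congrFun h p)
  have h2 : (‖z p‖ : ℂ) * Complex.exp (θ p * Complex.I) = z p := by
    rw [h1, mul_div_cancel₀]
    simpa using hz0 p
  rw [Complex.exp_mul_I] at h2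
  have hre := congrArg Complex.re h2
  have him := congrArg Complex.im h2
  simp [← Complex.ofReal_cos, ← Complex.ofReal_sin] at hre him
  exact Prod.ext hre.symm him.symm

/-- If `sin ∘ φ` is positive, then `φ` stays in a single interval of positivity of `sin`. -/
theorem exists_int_forall_mem_of_sin_pos {φ : ℝ → ℝ} (hφ : Continuous φ)
    (h : ∀ t, 0 < Real.sin (φ t)) :
    ∃ m : ℤ, ∀ t, 2 * Real.pi * m < φ t ∧ φ t < 2 * Real.pi * m + Real.pi := by
  have hpi := Real.pi_pos
  refine ⟨⌊φ 0 / (2 * Real.pi)⌋, fun t => ?_⟩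
  set m := ⌊φ 0 / (2 * Real.pi)⌋
  have h1 : (m : ℝ) * (2 * Real.pi) ≤ φ 0 := (le_div_iff₀ (by positivity)).1 (Int.floor_le _)
  have h2 : φ 0 < ((m : ℝ) + 1) * (2 * Real.pi) :=
    (div_lt_iff₀ (by positivity)).1 (Int.lt_floor_add_one _)
  have key : ∀ x, 0 < Real.sin x → x ≠ 2 * Real.pi * m ∧ x ≠ 2 * Real.pi * m + Real.pi := by
    intro x hx
    constructor
    · rintro rfl
      rw [show 2 * Real.pi * m = (m : ℝ) * (2 * Real.pi) by ring] at hx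
      have := Real.sin_int_mul_pi (2 * m)
      push_cast at this
      rw [show (2 * (m : ℝ)) * Real.pi = m * (2 * Real.pi) by ring] at this
      linarith
    · rintro rfl
      have := Real.sin_int_mul_pi (2 * m + 1)
      push_cast at this
      rw [show (2 * (m : ℝ) + 1) * Real.pi = 2 * Real.pi * m + Real.pi by ring] at this
      linarith
  have h0 : 2 * Real.pi * m < φ 0 ∧ φ 0 < 2 * Real.pi * m + Real.pi := by
    refine ⟨lt_of_le_of_ne (by linarith) (key _ (h 0)).1.symm, ?_⟩
    by_contra! hc
    have := Real.sin_nonpos_of_nonpos_of_neg_pi_le (x := φ 0 - ((m + 1 : ℤ) : ℝ) * (2 * Real.pi))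
      (by push_cast; linarith) (by push_cast; linarith)
    rw [Real.sin_sub_int_mul_two_pi] at this
    linarith [h 0]
  constructor
  · by_contra! hc
    obtain ⟨s, hs⟩ := mem_range_of_exists_le_of_exists_ge hφ ⟨t, hc⟩ ⟨0, h0.1.le⟩
    exact (key _ (h s)).1 hs
  · by_contra! hc
    obtain ⟨s, hs⟩ := mem_range_of_exists_le_of_exists_ge hφ ⟨0, h0.2.le⟩ ⟨t, hc⟩
    exact (key _ (h s)).2 hs

/-- A curve joining the bottom to the top of a rectangle meets a curve joining the left side to the
right side. -/
theorem exists_crossing {κ l : ℝ → ℝ × ℝ} (hκ : Continuous κ) (hl : Continuous l)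
    (h1 : ∀ u, (l 0).1 < (κ u).1 ∧ (κ u).1 < (l 1).1)
    (h2 : ∀ v, (κ 0).2 < (l v).2 ∧ (l v).2 < (κ 1).2) : ∃ u v, κ u = l v := by
  by_contra! hne
  obtain ⟨θ, hθ, hr⟩ := exists_continuous_angle (Φ := fun p => κ p.1 - l p.2) (by fun_prop)
    (fun p => sub_ne_zero.2 (hne _ _))
  obtain ⟨a, ha⟩ := exists_int_forall_mem_of_sin_pos (φ := fun u => θ (u, 0) + Real.pi / 2)
    (by fun_prop) fun u => by
      obtain ⟨r, hr0, h⟩ := hr (u, 0)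
      have := congrArg Prod.fst h
      simp only [Prod.fst_sub] at this
      rw [Real.sin_add_pi_div_two]
      exact pos_of_mul_pos_right (this ▸ sub_pos.2 (h1 u).1) hr0.le
  obtain ⟨b, hb⟩ := exists_int_forall_mem_of_sin_pos (φ := fun v => θ (1, v))
    (by fun_prop) fun v => by
      obtain ⟨r, hr0, h⟩ := hr (1, v)
      have := congrArg Prod.snd h
      simp only [Prod.snd_sub] at this
      exact pos_of_mul_pos_right (this ▸ sub_pos.2 (h2 v).2) hr0.le
  obtain ⟨c, hc⟩ := exists_int_forall_mem_of_sin_pos (φ := fun u => θ (u, 1) - Real.pi / 2)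
    (by fun_prop) fun u => by
      obtain ⟨r, hr0, h⟩ := hr (u, 1)
      have := congrArg Prod.fst h
      simp only [Prod.fst_sub] at this
      rw [Real.sin_sub_pi_div_two]
      have h3 := sub_neg.2 (h1 u).2
      rw [this] at h3
      linarith [neg_of_mul_neg_right h3 hr0.le]
  obtain ⟨d, hd⟩ := exists_int_forall_mem_of_sin_pos (φ := fun v => θ (0, v) + Real.pi)
    (by fun_prop) fun v => by
      obtain ⟨r, hr0, h⟩ := hr (0, v)
      have := congrArg Prod.snd h
      simp only [Prod.snd_sub] at this
      rw [Real.sin_add_pi]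
      have h3 := sub_neg.2 (h2 v).1
      rw [this] at h3
      linarith [neg_of_mul_neg_right h3 hr0.le]
  have hpi := Real.pi_pos
  have ha0 := ha 0
  have ha1 := ha 1
  have hb0 := hb 0
  have hb1 := hb 1
  have hc0 := hc 0
  have hc1 := hc 1
  have hd0 := hd 0
  have hd1 := hd 1
  have cmp : ∀ m n : ℤ, 2 * Real.pi * m < 2 * Real.pi * (n + 1) → m ≤ n := fun m n h => by
    have : (m : ℝ) < n + 1 := lt_of_mul_lt_mul_left h (by positivity)
    exact Int.lt_add_one_iff.1 (by exact_mod_cast this)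
  have e1 := cmp a b (by linarith)
  have e2 := cmp b c (by linarith)
  have e3 := cmp c (d - 1) (by push_cast; linarith)
  have e4 := cmp d a (by linarith)
  linarith

theorem IsPreconnected.exists_int_of_coe_eq_zero {X : Type*} [TopologicalSpace X] {S : Set X}
    (hS : IsPreconnected S) {φ : X → ℝ} (hφ : ContinuousOn φ S)
    (h : ∀ p ∈ S, (φ p : 𝕊) = 0) : ∃ m : ℤ, ∀ p ∈ S, φ p = m := by
  rcases S.eq_empty_or_nonempty with rfl | ⟨x, hx⟩
  · exact ⟨0, by simp⟩
  have key : ∀ p ∈ S, φ p ∈ range ((↑) : ℤ → ℝ) := fun p hp => by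
    obtain ⟨n, hn⟩ := (AddCircle.coe_eq_zero_iff 1).1 (h p hp)
    exact ⟨n, by simpa using hn⟩
  obtain ⟨m, hm⟩ := key x hx
  have : DiscreteTopology (range ((↑) : ℤ → ℝ)) :=
    Int.isClosedEmbedding_coe_real.toIsEmbedding.toHomeomorph.symm.isEmbedding.discreteTopology
  exact ⟨m, fun p hp => by rw [hm]; exact hS.constant_of_mapsTo ⟨this⟩ hφ key hp hx⟩

/-- If two half-planes cut out by a continuous function on the plane are preconnected and cover the
plane, then so is the strip in which they meet. -/
theorem isPreconnected_strip {H : ℝ × ℝ → ℝ} (hH : Continuous H) {c₁ c₂ : ℝ} (hc : c₁ < c₂)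
    (hU : IsPreconnected {p | H p < c₂}) (hV : IsPreconnected {p | c₁ < H p}) :
    IsPreconnected {p | c₁ < H p ∧ H p < c₂} := by
  set S := {p | c₁ < H p ∧ H p < c₂}
  have hSo : IsOpen S := (isOpen_lt continuous_const hH).inter (isOpen_lt hH continuous_const)
  intro A B hA hB hSAB ⟨a, haS, haA⟩ ⟨b, hbS, hbB⟩
  by_contra hne
  rw [not_nonempty_iff_eq_empty] at hne
  let l : ℝ × ℝ → ℝ := fun p => max 0 (min 1 ((H p - c₁) / (c₂ - c₁)))
  have hl : Continuous l := by fun_prop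
  have hl0 : ∀ p, H p ≤ c₁ → l p = 0 := fun p hp => by
    have : (H p - c₁) / (c₂ - c₁) ≤ 0 := div_nonpos_of_nonpos_of_nonneg (by linarith) (by linarith)
    exact max_eq_left (min_le_of_right_le this)
  have hl1 : ∀ p, c₂ ≤ H p → l p = 1 := fun p hp => by
    have : 1 ≤ (H p - c₁) / (c₂ - c₁) := (one_le_div (by linarith)).2 (by linarith)
    simp [l, min_eq_left this]
  have hfr : ∀ p ∈ frontier (S ∩ A), H p ≤ c₁ ∨ c₂ ≤ H p := by
    intro p hp
    by_contra! hcon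
    have hpS : p ∈ S := hcon
    rw [(hSo.inter hA).frontier_eq] at hp
    rcases hSAB hpS with h | h
    · exact hp.2 ⟨hpS, h⟩
    · obtain ⟨q, ⟨hqS, hqB⟩, -, hqA⟩ := mem_closure_iff.1 hp.1 _ (hSo.inter hB) ⟨hpS, h⟩
      exact (hne ▸ (⟨hqS, hqA, hqB⟩ : q ∈ S ∩ (A ∩ B)) : q ∈ (∅ : Set (ℝ × ℝ)))
  classical
  let g : ℝ × ℝ → 𝕊 := (S ∩ A).piecewise (fun p => (l p : 𝕊)) 0
  have hg : Continuous g := by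
    refine Continuous.piecewise (fun p hp => ?_) ((AddCircle.continuous_mk' 1).comp hl)
      continuous_const
    rcases hfr p hp with h | h
    · simp [hl0 p h]
    · simp [hl1 p h]
  obtain ⟨θ, hθ, hθg⟩ := exists_continuous_lift_addCircle hg
  obtain ⟨m, hm⟩ := hU.exists_int_of_coe_eq_zero
    (φ := θ - (S ∩ A).piecewise l 0) (hθ.continuousOn.sub (ContinuousOn.piecewise
      (fun p hp => by
        rcases hfr p hp.2 with h | h
        · simp [hl0 p h]
        · exact absurd hp.1 (not_lt.2 h)) hl.continuousOn continuousOn_const)) (fun p _ => by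
      by_cases hp : p ∈ S ∩ A <;> simp [hp, hθg, g])
  obtain ⟨m', hm'⟩ := hV.exists_int_of_coe_eq_zero
    (φ := θ - (S ∩ A).piecewise (l - 1) 0) (hθ.continuousOn.sub (ContinuousOn.piecewise
      (fun p hp => by
        rcases hfr p hp.2 with h | h
        · exact absurd hp.1 (not_lt.2 h)
        · simp [hl1 p h]) (hl.continuousOn.sub continuousOn_const) continuousOn_const))
      (fun p _ => by
      by_cases hp : p ∈ S ∩ A <;> simp [hp, hθg, g])
  have hbA : b ∉ S ∩ A := fun h =>
    (hne ▸ (⟨hbS, h.2, hbB⟩ : b ∈ S ∩ (A ∩ B)) : b ∈ (∅ : Set (ℝ × ℝ)))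
  have haA' : a ∈ S ∩ A := ⟨haS, haA⟩
  have e1 := hm a haS.2
  have e2 := hm' a haS.1
  have e3 := hm b hbS.2
  have e4 := hm' b hbS.1
  simp [haA', hbA] at e1 e2 e3 e4
  linarith

/-- `ψ` is invariant under integer translations of the plane. -/
def IsDoublyPeriodic (ψ : ℝ × ℝ → ℝ) : Prop :=
  ∀ (p : ℝ × ℝ) (m n : ℤ), ψ (p + ((m : ℝ), (n : ℝ))) = ψ p

theorem exists_add_int_mem_Icc (p : ℝ × ℝ) :
    ∃ m n : ℤ, p + ((m : ℝ), (n : ℝ)) ∈ Icc ((0 : ℝ), (0 : ℝ)) (1, 1) := by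
  refine ⟨-⌊p.1⌋, -⌊p.2⌋, ?_⟩
  have h1 := Int.floor_le p.1
  have h2 := Int.lt_floor_add_one p.1
  have h3 := Int.floor_le p.2
  have h4 := Int.lt_floor_add_one p.2
  simp only [mem_Icc, Prod.le_def, Prod.fst_add, Prod.snd_add, Int.cast_neg]
  refine ⟨⟨?_, ?_⟩, ?_, ?_⟩ <;> linarith

namespace IsDoublyPeriodic

variable {ψ : ℝ × ℝ → ℝ}

theorem exists_bound (h : IsDoublyPeriodic ψ) (hc : Continuous ψ) : ∃ B, ∀ p, |ψ p| ≤ B := by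
  obtain ⟨B, hB⟩ := (isCompact_Icc (a := ((0 : ℝ), (0 : ℝ))) (b := (1, 1))).exists_bound_of_continuousOn
    hc.continuousOn
  refine ⟨B, fun p => ?_⟩
  obtain ⟨m, n, hmn⟩ := exists_add_int_mem_Icc p
  rw [← h p m n]
  exact hB _ hmn

theorem uniformContinuous (h : IsDoublyPeriodic ψ) (hc : Continuous ψ) : UniformContinuous ψ := by
  have hK : IsCompact (Icc ((-1 : ℝ), (-1 : ℝ)) (2, 2)) := isCompact_Icc
  have huc := hK.uniformContinuousOn_of_continuous hc.continuousOn
  rw [Metric.uniformContinuousOn_iff] at huc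
  rw [Metric.uniformContinuous_iff]
  intro ε hε
  obtain ⟨δ, hδ, hd⟩ := huc ε hε
  refine ⟨min δ 1, by positivity, fun {p q} hpq => ?_⟩
  obtain ⟨m, n, hmn⟩ := exists_add_int_mem_Icc p
  have hpq' : dist (p + ((m : ℝ), (n : ℝ))) (q + ((m : ℝ), (n : ℝ))) < min δ 1 := by
    rwa [dist_add_right]
  rw [← h p m n, ← h q m n]
  generalize p + ((m : ℝ), (n : ℝ)) = p' at hmn hpq' ⊢
  generalize q + ((m : ℝ), (n : ℝ)) = q' at hpq' ⊢
  have h1 : dist p'.1 q'.1 < 1 := (le_max_left _ _).trans_lt (hpq'.trans_le (min_le_right _ _))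
  have h2 : dist p'.2 q'.2 < 1 := (le_max_right _ _).trans_lt (hpq'.trans_le (min_le_right _ _))
  rw [Real.dist_eq, abs_lt] at h1 h2
  obtain ⟨⟨h3, h4⟩, h5, h6⟩ := hmn
  simp only at h3 h4 h5 h6
  refine hd _ ⟨⟨?_, ?_⟩, ?_, ?_⟩ _ ⟨⟨?_, ?_⟩, ?_, ?_⟩ (hpq'.trans_le (min_le_left _ _)) <;>
    simp only <;> linarith

end IsDoublyPeriodic

/-- Among sufficiently many points of the plane two are close modulo integer translations. -/
theorem exists_card_forall_exists_dist_add_int_lt {r : ℝ} (hr : 0 < r) :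
    ∃ N : ℕ, ∀ (s : Finset ℕ) (x : ℕ → ℝ × ℝ), N < s.card →
      ∃ i ∈ s, ∃ j ∈ s, i < j ∧ ∃ m n : ℤ, dist (x i) (x j + ((m : ℝ), (n : ℝ))) < r := by
  obtain ⟨t, -, ht, hcov⟩ := finite_cover_balls_of_compact
    (isCompact_Icc (a := ((0 : ℝ), (0 : ℝ))) (b := (1, 1))) (half_pos hr)
  refine ⟨ht.toFinset.card, fun s x hs => ?_⟩
  have key : ∀ i, ∃ c ∈ ht.toFinset, ∃ m n : ℤ, dist (x i + ((m : ℝ), (n : ℝ))) c < r / 2 := by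
    intro i
    obtain ⟨m, n, hmn⟩ := exists_add_int_mem_Icc (x i)
    obtain ⟨c, hc, hd⟩ := mem_iUnion₂.1 (hcov hmn)
    exact ⟨c, ht.mem_toFinset.2 hc, m, n, hd⟩
  choose c hc m n hd using key
  obtain ⟨i, hi, j, hj, hij, hcij⟩ := Finset.exists_ne_map_eq_of_card_lt_of_maps_to hs
    (fun i _ => hc i)
  have main : ∀ i j, c i = c j → ∃ m n : ℤ, dist (x i) (x j + ((m : ℝ), (n : ℝ))) < r := by
    intro i j hcij
    refine ⟨m j - m i, n j - n i, ?_⟩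
    have h1 := hd i
    have h2 := hd j
    rw [hcij] at h1
    rw [dist_comm] at h2
    have := dist_triangle _ _ _ |>.trans_lt (add_lt_add h1 h2)
    rw [add_halves] at this
    rw [← dist_add_right (x i) _ ((m i : ℝ), (n i : ℝ))]
    rwa [show x j + (((m j - m i : ℤ) : ℝ), ((n j - n i : ℤ) : ℝ)) + ((m i : ℝ), (n i : ℝ)) =
      x j + ((m j : ℝ), (n j : ℝ)) by ext <;> simp <;> ring]
  rcases lt_or_gt_of_ne hij with h | h
  · exact ⟨i, hi, j, hj, h, main i j hcij⟩
  · exact ⟨j, hj, i, hi, h, main j i hcij.symm⟩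

theorem neg_add_intVec (p : ℝ × ℝ) (a b : ℝ) : -(p + (a, b)) = -p + (-a, -b) := by
  rw [neg_add, Prod.neg_mk a b]

theorem homeomorph_mul_apply {X : Type*} [TopologicalSpace X] (G G' : X ≃ₜ X) (p : X) :
    (G * G') p = G (G' p) := rfl

/-- A height function: a lift of a circle-valued map of the torus whose degrees are `1` and `0`. -/
structure IsHeight (H : ℝ × ℝ → ℝ) : Prop where
  continuous : Continuous H
  map_add : ∀ (p : ℝ × ℝ) (m n : ℤ), H (p + ((m : ℝ), (n : ℝ))) = H p + m

namespace IsHeight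

variable {H : ℝ × ℝ → ℝ}

theorem periodic (hH : IsHeight H) : IsDoublyPeriodic fun p => H p - p.1 := fun p m n => by
  simp [hH.map_add]

theorem exists_bound (hH : IsHeight H) : ∃ B, ∀ p, |H p - p.1| ≤ B :=
  hH.periodic.exists_bound (hH.continuous.sub continuous_fst)

theorem uniformContinuous (hH : IsHeight H) : UniformContinuous H := by
  have := (hH.periodic.uniformContinuous (hH.continuous.sub continuous_fst)).add
    uniformContinuous_fst
  simpa using this

theorem reflect (hH : IsHeight H) : IsHeight fun p => -H (-p) where
  continuous := by have := hH.continuous; fun_prop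
  map_add p m n := by
    have := hH.map_add (-p) (-m) (-n)
    push_cast at this
    rw [neg_add_intVec, this]
    ring

end IsHeight

/-- `G` commutes with integer translations, moves every height by `β`, and moves second coordinates
by at most `B`. -/
structure IsShift (H : ℝ × ℝ → ℝ) (G : ℝ × ℝ ≃ₜ ℝ × ℝ) (β B : ℝ) : Prop where
  map_add : ∀ (p : ℝ × ℝ) (m n : ℤ), G (p + ((m : ℝ), (n : ℝ))) = G p + ((m : ℝ), (n : ℝ))
  height : ∀ p, H (G p) = H p + β
  disp : ∀ p, |(G p).2 - p.2| ≤ B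

/-- Translation by an integer vector. -/
def intTranslation (m n : ℤ) : ℝ × ℝ ≃ₜ ℝ × ℝ := Homeomorph.addRight ((m : ℝ), (n : ℝ))

@[simp] theorem intTranslation_apply (m n : ℤ) (p : ℝ × ℝ) :
    intTranslation m n p = p + ((m : ℝ), (n : ℝ)) := rfl

theorem IsHeight.isShift_intTranslation {H : ℝ × ℝ → ℝ} (hH : IsHeight H) (m n : ℤ) :
    IsShift H (intTranslation m n) m |(n : ℝ)| where
  map_add p a b := by simp [add_right_comm]
  height p := by simp [hH.map_add]
  disp p := by simp

namespace IsShift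

variable {H : ℝ × ℝ → ℝ} {G G' : ℝ × ℝ ≃ₜ ℝ × ℝ} {β B β' B' : ℝ}

theorem symm (h : IsShift H G β B) : IsShift H G.symm (-β) B where
  map_add p m n := by
    rw [G.symm_apply_eq, h.map_add, G.apply_symm_apply]
  height p := by
    have := h.height (G.symm p)
    rw [G.apply_symm_apply] at this
    linarith
  disp p := by
    have := h.disp (G.symm p)
    rwa [G.apply_symm_apply, abs_sub_comm] at this

theorem mul (h : IsShift H G β B) (h' : IsShift H G' β' B') :
    IsShift H (G * G') (β + β') (B + B') where
  map_add p m n := by simp only [homeomorph_mul_apply, h.map_add, h'.map_add]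
  height p := by simp only [homeomorph_mul_apply, h.height, h'.height]; ring
  disp p := by
    have h1 := h.disp (G' p)
    have h2 := h'.disp p
    simp only [homeomorph_mul_apply]
    rw [abs_le] at *
    constructor <;> linarith

theorem pow (h : IsShift H G β B) (k : ℕ) : IsShift H (G ^ k) (k * β) (k * B) := by
  induction k with
  | zero => exact ⟨by simp, by simp, by simp⟩
  | succ k ih =>
    rw [pow_succ]
    have := ih.mul h
    convert this using 1 <;> push_cast <;> ring

theorem periodic (h : IsShift H G β B) : IsDoublyPeriodic fun p => (G p).2 - p.2 := fun p m n => by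
  simp [h.map_add]

theorem reflect (h : IsShift H G β B) :
    IsShift (fun p => -H (-p)) ((Homeomorph.neg _ * G) * Homeomorph.neg _) (-β) B where
  map_add p m n := by
    have := h.map_add (-p) (-m) (-n)
    push_cast at this
    simp only [homeomorph_mul_apply, Homeomorph.coe_neg]
    rw [neg_add_intVec, this, neg_add]
    simp
  height p := by
    simp only [homeomorph_mul_apply, Homeomorph.coe_neg, neg_neg, h.height]
    ring
  disp p := by
    have := h.disp (-p)
    simp only [homeomorph_mul_apply, Homeomorph.coe_neg]
    rw [abs_sub_comm] at this
    convert this using 2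
    simp; ring

end IsShift

theorem mem_segment_of_dist_lt {a b p : ℝ × ℝ} {r : ℝ} (h : dist a b < r) (hp : p ∈ segment ℝ a b) :
    dist p b < r :=
  (convex_ball b r).segment_subset (mem_ball.2 h) (mem_ball_self (dist_nonneg.trans_lt h)) hp

theorem IsShift.false_of_component_bddBelow {H : ℝ × ℝ → ℝ}
    {G₁ G₂ : ℝ × ℝ ≃ₜ ℝ × ℝ} {β₁ β₂ B₁ B₂ : ℝ} (h₁ : IsShift H G₁ β₁ B₁) (h₂ : IsShift H G₂ β₂ B₂)
    (hβ : β₁ < β₂) {c μ r : ℝ} {p q : ℝ × ℝ}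
    (hμ : IsGLB (H '' connectedComponentIn {p | H p < c} p) μ)
    (hr : ∀ a b, dist a b < r → |H a - H b| < (c - μ) / 3)
    (hq : q ∈ connectedComponentIn {p | H p < c} p) (hqμ : H q < μ + (c - μ) / 3)
    (hd : dist (G₁ q) (G₂ q) < r) : False := by
  set U := connectedComponentIn {p | H p < c} p
  have hUc : ∀ u ∈ U, H u < c := fun u hu =>
    connectedComponentIn_subset {p | H p < c} p hu
  have hpre : IsPreconnected (G₁ '' U ∪ segment ℝ (G₁ q) (G₂ q)) :=
    IsPreconnected.union (G₁ q) (mem_image_of_mem _ hq) (left_mem_segment _ _ _)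
      (isPreconnected_connectedComponentIn.image _ G₁.continuous.continuousOn)
      (convex_segment _ _).isPreconnected
  have hsub : G₂.symm '' (G₁ '' U ∪ segment ℝ (G₁ q) (G₂ q)) ⊆ U := by
    refine Subset.trans ?_ (connectedComponentIn_eq hq).symm.subset
    refine (hpre.image _ G₂.symm.continuous.continuousOn).subset_connectedComponentIn
      ⟨G₂ q, Or.inr (right_mem_segment _ _ _), G₂.symm_apply_apply q⟩ ?_
    rintro _ ⟨a, ⟨u, hu, rfl⟩ | ha, rfl⟩
    · have := hUc u hu
      simp only [mem_ofPred_eq, h₂.symm.height, h₁.height]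
      linarith
    · have h3 := hr _ _ (mem_segment_of_dist_lt hd ha)
      rw [abs_lt, h₂.height] at h3
      have := hUc q hq
      simp only [mem_ofPred_eq, h₂.symm.height]
      linarith [h3.2]
  obtain ⟨_, ⟨u, hu, rfl⟩, hu'⟩ := (isGLB_lt_iff hμ).1 (show μ < μ + (β₂ - β₁) by linarith)
  have := hμ.1 (mem_image_of_mem H (hsub ⟨_, Or.inl ⟨u, hu, rfl⟩, rfl⟩))
  rw [h₂.symm.height, h₁.height] at this
  linarith

section
variable {H : ℝ × ℝ → ℝ} {F : ℝ × ℝ ≃ₜ ℝ × ℝ} {α C : ℝ}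

theorem IsShift.component_not_bddBelow (hH : IsHeight H) (hF : IsShift H F α C) (hα : Irrational α)
    {c : ℝ} {p : ℝ × ℝ} (hp : H p < c) (m : ℝ) :
    ∃ q ∈ connectedComponentIn {p | H p < c} p, H q < m := by
  by_contra! hcon
  set U := connectedComponentIn {p | H p < c} p with hU
  have hpU : p ∈ U := mem_connectedComponentIn hp
  obtain ⟨μ, hμ⟩ : ∃ μ, IsGLB (H '' U) μ := ⟨_, isGLB_csInf ⟨_, mem_image_of_mem H hpU⟩
    ⟨m, forall_mem_image.2 hcon⟩⟩
  have hδ : 0 < c - μ := by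
    have := hμ.1 (mem_image_of_mem H hpU)
    linarith
  obtain ⟨_, ⟨q, hq, rfl⟩, hqμ⟩ := (isGLB_lt_iff hμ).1 (show μ < μ + (c - μ) / 3 by linarith)
  obtain ⟨r, hr0, hr⟩ := Metric.uniformContinuous_iff.1 hH.uniformContinuous ((c - μ) / 3)
    (by linarith)
  obtain ⟨N, hN⟩ := exists_card_forall_exists_dist_add_int_lt hr0
  obtain ⟨i, -, j, -, hij, a, b, hd⟩ := hN (Finset.range (N + 1)) (fun i => (F ^ i) q) (by simp)
  have h₁ := hF.pow i
  have h₂ := (hH.isShift_intTranslation a b).mul (hF.pow j)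
  have hne : (i : ℝ) * α ≠ a + j * α := by
    intro h
    have h3 : ((j : ℤ) - (i : ℤ) : ℤ) ≠ 0 := by omega
    refine (hα.intCast_mul h3).ne_int (-a) ?_
    push_cast
    linarith
  have hr' : ∀ a b, dist a b < r → |H a - H b| < (c - μ) / 3 := fun a b hab => hr hab
  rcases lt_or_gt_of_ne hne with h | h
  · exact h₁.false_of_component_bddBelow h₂ h hμ hr' hq hqμ hd
  · exact h₂.false_of_component_bddBelow h₁ h hμ hr' hq hqμ (by rwa [dist_comm])

theorem IsShift.isPreconnected_lt (hH : IsHeight H) (hF : IsShift H F α C) (hα : Irrational α)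
    (c : ℝ) : IsPreconnected {p | H p < c} := by
  obtain ⟨B, hB⟩ := hH.exists_bound
  have hP : IsPreconnected {p : ℝ × ℝ | p.1 < c - B} :=
    (convex_halfSpace_lt (LinearMap.fst ℝ ℝ ℝ).isLinear (c - B)).isPreconnected
  have hPs : {p : ℝ × ℝ | p.1 < c - B} ⊆ {p | H p < c} := fun p hp => by
    have := (abs_le.1 (hB p)).2
    simp only [mem_ofPred_eq] at hp ⊢
    linarith
  have key : ∀ p, H p < c → {p : ℝ × ℝ | p.1 < c - B} ⊆ connectedComponentIn {p | H p < c} p := by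
    intro p hp
    obtain ⟨q, hq, hqm⟩ := hF.component_not_bddBelow hH hα hp (c - 2 * B)
    rw [connectedComponentIn_eq hq]
    refine hP.subset_connectedComponentIn ?_ hPs
    have := (abs_le.1 (hB q)).1
    simp only [mem_ofPred_eq]
    linarith
  refine isPreconnected_of_forall_pair fun p hp q hq => ?_
  have hx : ((c - B - 1, 0) : ℝ × ℝ) ∈ {p : ℝ × ℝ | p.1 < c - B} := by simp
  refine ⟨connectedComponentIn {p | H p < c} p, connectedComponentIn_subset _ _,
    mem_connectedComponentIn hp, ?_, isPreconnected_connectedComponentIn⟩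
  rw [connectedComponentIn_eq (key p hp hx), ← connectedComponentIn_eq (key q hq hx)]
  exact mem_connectedComponentIn hq

theorem IsShift.isPreconnected_gt (hH : IsHeight H) (hF : IsShift H F α C) (hα : Irrational α)
    (c : ℝ) : IsPreconnected {p | c < H p} := by
  have := (hF.reflect.isPreconnected_lt hH.reflect hα.neg (-c)).image _ continuous_neg.continuousOn
  convert this using 1
  ext p
  simp
end

/-- A height function all of whose half-planes are connected. -/
structure IsTameHeight (H : ℝ × ℝ → ℝ) : Prop extends IsHeight H where
  isPreconnected_lt : ∀ c, IsPreconnected {p | H p < c}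
  isPreconnected_gt : ∀ c, IsPreconnected {p | c < H p}

theorem IsShift.isTameHeight {H : ℝ × ℝ → ℝ} {F : ℝ × ℝ ≃ₜ ℝ × ℝ} {α C : ℝ} (hH : IsHeight H)
    (hF : IsShift H F α C) (hα : Irrational α) : IsTameHeight H :=
  ⟨hH, hF.isPreconnected_lt hH hα, hF.isPreconnected_gt hH hα⟩

theorem IsTameHeight.isPreconnected_strip {H : ℝ × ℝ → ℝ} (hH : IsTameHeight H) (t : ℝ) {η : ℝ}
    (hη : 0 < η) : IsPreconnected {p | |H p - t| < η} := by
  have := _root_.isPreconnected_strip hH.continuous (show t - η < t + η by linarith)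
    (hH.isPreconnected_lt _) (hH.isPreconnected_gt _)
  convert this using 2
  ext p
  rw [abs_lt]
  constructor <;> rintro ⟨h1, h2⟩ <;> constructor <;> linarith

theorem JoinedIn.exists_curve {S : Set (ℝ × ℝ)} {p q : ℝ × ℝ} (h : JoinedIn S p q) :
    ∃ κ : ℝ → ℝ × ℝ, Continuous κ ∧ κ 0 = p ∧ κ 1 = q ∧ (∀ u, κ u ∈ S) ∧ IsCompact (range κ) := by
  obtain ⟨γ, hγ⟩ := h
  refine ⟨γ.extend, γ.continuous_extend, γ.extend_zero, γ.extend_one, fun u => ?_, ?_⟩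
  · have : γ.extend u ∈ range γ := by
      rw [← γ.extend_range]
      exact mem_range_self u
    obtain ⟨v, hv⟩ := this
    rw [← hv]
    exact hγ v
  · rw [γ.extend_range]
    exact isCompact_range γ.continuous

theorem IsPreconnected.joinedIn_of_isOpen {S : Set (ℝ × ℝ)} (hS : IsPreconnected S) (hO : IsOpen S)
    {p q : ℝ × ℝ} (hp : p ∈ S) (hq : q ∈ S) : JoinedIn S p q :=
  (hO.isConnected_iff_isPathConnected.1 ⟨⟨p, hp⟩, hS⟩).joinedIn p hp q hq

theorem IsCompact.exists_abs_snd_le {K : Set (ℝ × ℝ)} (hK : IsCompact K) :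
    ∃ m, ∀ q ∈ K, |q.2| ≤ m :=
  hK.exists_bound_of_continuousOn continuous_snd.continuousOn

/-- Points of equal height at vertical distance at most `1` are joined inside a narrow strip by a
connected set of uniformly bounded vertical extent. -/
theorem IsTameHeight.exists_uniform_joining {H : ℝ × ℝ → ℝ} (hH : IsTameHeight H) {η : ℝ}
    (hη : 0 < η) :
    ∃ Y, ∀ p q : ℝ × ℝ, H p = H q → |p.2 - q.2| ≤ 1 → ∃ K, IsPreconnected K ∧ p ∈ K ∧ q ∈ K ∧
      ∀ a ∈ K, |H a - H p| ≤ η ∧ |a.2 - p.2| ≤ Y := by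
  obtain ⟨B, hB⟩ := hH.exists_bound
  have hHc := hH.continuous
  let P : Set ((ℝ × ℝ) × (ℝ × ℝ)) := ({z | H z.1 = H z.2} ∩ {z | |z.1.2 - z.2.2| ≤ 1}) ∩
    Icc ((0, 0), (-2 * B, -1)) ((1, 1), (1 + 2 * B, 2))
  have hP : IsCompact P := by
    refine isCompact_Icc.inter_left (IsClosed.inter (isClosed_eq ?_ ?_) (isClosed_le ?_ ?_)) <;>
      fun_prop
  let Q : Set ((ℝ × ℝ) × (ℝ × ℝ)) → Prop := fun s => ∃ Y, ∀ z ∈ s, ∃ K, IsPreconnected K ∧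
    z.1 ∈ K ∧ z.2 ∈ K ∧ ∀ a ∈ K, |H a - H z.1| ≤ η ∧ |a.2 - z.1.2| ≤ Y
  have key : Q P := by
    refine hP.induction_on (p := Q) ⟨0, by simp⟩ (fun s t hst ⟨Y, hY⟩ => ⟨Y, fun z hz => hY z (hst hz)⟩)
      (fun s t ⟨Y, hY⟩ ⟨Y', hY'⟩ => ⟨max Y Y', ?_⟩) ?_
    · rintro z (hz | hz)
      · obtain ⟨K, h1, h2, h3, h4⟩ := hY z hz
        exact ⟨K, h1, h2, h3, fun a ha => ⟨(h4 a ha).1, (h4 a ha).2.trans (le_max_left _ _)⟩⟩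
      · obtain ⟨K, h1, h2, h3, h4⟩ := hY' z hz
        exact ⟨K, h1, h2, h3, fun a ha => ⟨(h4 a ha).1, (h4 a ha).2.trans (le_max_right _ _)⟩⟩
    · rintro ⟨p, q⟩ ⟨⟨hpq, -⟩, -⟩
      change H p = H q at hpq
      set S := {a | |H a - H p| < η / 2}
      have hSo : IsOpen S := isOpen_lt (by fun_prop) continuous_const
      have hpS : p ∈ S := by simp [S, hη]
      have hqS : q ∈ S := by simp [S, hη, ← hpq]
      obtain ⟨κ, hκ, hκ0, hκ1, hκS, hκc⟩ :=
        ((hH.isPreconnected_strip (H p) (half_pos hη)).joinedIn_of_isOpen hSo hpS hqS).exists_curve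
      obtain ⟨r, hr, hrS⟩ := Metric.isOpen_iff.1 hSo p hpS
      obtain ⟨r', hr', hrS'⟩ := Metric.isOpen_iff.1 hSo q hqS
      set K := ball p r ∪ (range κ ∪ ball q r') with hK
      have hKpre : IsPreconnected K := by
        refine IsPreconnected.union p (mem_ball_self hr) (Or.inl ⟨0, hκ0⟩)
          (convex_ball p r).isPreconnected (IsPreconnected.union q ⟨1, hκ1⟩ (mem_ball_self hr')
          (isPreconnected_range hκ) (convex_ball q r').isPreconnected)
      have hKS : K ⊆ S := union_subset hrS (union_subset (range_subset_iff.2 hκS) hrS')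
      have hKb : Bornology.IsBounded K :=
        isBounded_ball.union (hκc.isBounded.union isBounded_ball)
      obtain ⟨Y, hY⟩ := hKb.exists_norm_le
      have hYs : ∀ a ∈ K, |a.2| ≤ Y := fun a ha => (norm_snd_le a).trans (hY a ha)
      refine ⟨ball p r ×ˢ ball q r', mem_nhdsWithin_of_mem_nhds
        (prod_mem_nhds (ball_mem_nhds _ hr) (ball_mem_nhds _ hr')), Y + Y, ?_⟩
      rintro ⟨a, b⟩ ⟨ha, hb⟩
      have haK : a ∈ K := Or.inl ha
      refine ⟨K, hKpre, haK, Or.inr (Or.inr hb), fun c hc => ?_⟩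
      have e1 := hKS hc
      have e2 := hKS haK
      simp only [S, mem_ofPred_eq, abs_lt] at e1 e2
      have e3 := hYs c hc
      have e4 := hYs a haK
      rw [abs_le] at e3 e4
      constructor <;> rw [abs_le] <;> constructor <;> linarith
  obtain ⟨Y, hY⟩ := key
  refine ⟨Y, fun p q hpq hy => ?_⟩
  obtain ⟨m, n, hmn⟩ := exists_add_int_mem_Icc p
  obtain ⟨K, hK, hpK, hqK, hKb⟩ := hY (p + ((m : ℝ), (n : ℝ)), q + ((m : ℝ), (n : ℝ))) (by
    have h1 := hB (p + ((m : ℝ), (n : ℝ)))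
    have h2 := hB (q + ((m : ℝ), (n : ℝ)))
    rw [hH.map_add] at h1 h2
    obtain ⟨⟨h3, h4⟩, h5, h6⟩ := hmn
    simp only [Prod.fst_add, Prod.snd_add] at h1 h2 h3 h4 h5 h6
    have hy' : |p.2 + (n : ℝ) - (q.2 + (n : ℝ))| ≤ 1 := by rwa [add_sub_add_right_eq_sub]
    have hpq' : H (p + ((m : ℝ), (n : ℝ))) = H (q + ((m : ℝ), (n : ℝ))) := by
      rw [hH.map_add, hH.map_add, hpq]
    rw [abs_le] at h1 h2 hy
    refine ⟨⟨hpq', hy'⟩, ⟨⟨?_, ?_⟩, ?_, ?_⟩, ⟨?_, ?_⟩, ?_, ?_⟩ <;>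
      simp only [Prod.fst_add, Prod.snd_add] <;> linarith)
  simp only [hH.map_add] at hKb
  refine ⟨intTranslation (-m) (-n) '' K, hK.image _ (Homeomorph.continuous _).continuousOn,
    ⟨_, hpK, ?_⟩, ⟨_, hqK, ?_⟩, ?_⟩
  · ext <;> simp
  · ext <;> simp
  · rintro _ ⟨a, ha, rfl⟩
    have := hKb a ha
    simp only [Prod.snd_add] at this
    rw [intTranslation_apply, hH.map_add]
    push_cast
    simp only [Prod.snd_add]
    rw [show H a + -(m : ℝ) - H p = H a - (H p + m) by ring,
      show a.2 + -(n : ℝ) - p.2 = a.2 - (p.2 + n) by ring]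
    exact this

/-- `τ` is an arc crossing the strip of half-width `η` around the level `t`. -/
def IsCut (H : ℝ × ℝ → ℝ) (t η : ℝ) (τ : Set (ℝ × ℝ)) : Prop :=
  ∃ g : ℝ → ℝ × ℝ, Continuous g ∧ H (g 0) = t - η ∧ H (g 1) = t + η ∧
    (∀ u ∈ Ioo (0 : ℝ) 1, |H (g u) - t| < η) ∧ τ = g '' Icc 0 1

theorem exists_isCut_subset {H : ℝ × ℝ → ℝ} (hH : Continuous H) {t η : ℝ} (hη : 0 < η)
    {κ : ℝ → ℝ × ℝ} (hκ : Continuous κ) (h0 : H (κ 0) ≤ t - η) (h1 : t + η ≤ H (κ 1)) :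
    ∃ τ ⊆ κ '' Icc 0 1, IsCut H t η τ := by
  have hHκ : Continuous fun u => H (κ u) := hH.comp hκ
  obtain ⟨b, ⟨hb01, hb⟩, hbl⟩ := (isCompact_Icc.inter_right (isClosed_le continuous_const hHκ) :
    IsCompact (Icc (0 : ℝ) 1 ∩ {u | t + η ≤ H (κ u)})).exists_isLeast ⟨1, by simp, h1⟩
  obtain ⟨a, ⟨ha01, ha⟩, hag⟩ := (isCompact_Icc.inter_right (isClosed_le hHκ continuous_const) :
    IsCompact (Icc (0 : ℝ) b ∩ {u | H (κ u) ≤ t - η})).exists_isGreatest ⟨0, by simp [hb01.1], h0⟩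
  simp only [mem_ofPred_eq] at ha hb
  have hb' : H (κ b) = t + η := by
    obtain ⟨u, hu, hu'⟩ := intermediate_value_Icc hb01.1 hHκ.continuousOn
      (show t + η ∈ Icc _ _ from ⟨by linarith, hb⟩)
    have : b ≤ u := hbl ⟨⟨hu.1, hu.2.trans hb01.2⟩, hu'.ge⟩
    rw [← hu', le_antisymm hu.2 this]
  have ha' : H (κ a) = t - η := by
    obtain ⟨u, hu, hu'⟩ := intermediate_value_Icc ha01.2 hHκ.continuousOn
      (show t - η ∈ Icc _ _ from ⟨ha, by linarith⟩)
    have : u ≤ a := hag ⟨⟨ha01.1.trans hu.1, hu.2⟩, hu'.le⟩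
    rw [← hu', le_antisymm hu.1 this]
  have hab : a < b := lt_of_le_of_ne ha01.2 fun h => by rw [h] at ha'; linarith
  refine ⟨_, ?_, fun u => κ (a + (b - a) * u), by fun_prop, by simpa, by simpa, fun u hu => ?_, rfl⟩
  · rintro _ ⟨u, hu, rfl⟩
    exact mem_image_of_mem _ ⟨by nlinarith [hu.1, ha01.1], by nlinarith [hu.2, hb01.2]⟩
  · have e1 : a < a + (b - a) * u := by nlinarith [hu.1]
    have e2 : a + (b - a) * u < b := by nlinarith [hu.2]
    rw [abs_lt]
    constructor
    · by_contra! hc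
      exact absurd (hag ⟨⟨by linarith [ha01.1], e2.le⟩, by simp only [mem_ofPred_eq]; linarith⟩)
        (not_le.2 e1)
    · by_contra! hc
      exact absurd (hbl ⟨⟨by linarith [ha01.1], by linarith [hb01.2]⟩, by
        simp only [mem_ofPred_eq]; linarith⟩) (not_le.2 e2)

namespace IsCut

variable {H : ℝ × ℝ → ℝ} {t η : ℝ} {τ : Set (ℝ × ℝ)}

theorem isCompact (h : IsCut H t η τ) : IsCompact τ := by
  obtain ⟨g, hg, -, -, -, rfl⟩ := h
  exact isCompact_Icc.image hg

theorem isPreconnected (h : IsCut H t η τ) : IsPreconnected τ := by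
  obtain ⟨g, hg, -, -, -, rfl⟩ := h
  exact isPreconnected_Icc.image _ hg.continuousOn

theorem abs_le (h : IsCut H t η τ) (hη : 0 ≤ η) {p : ℝ × ℝ} (hp : p ∈ τ) : |H p - t| ≤ η := by
  obtain ⟨g, hg, h0, h1, h2, rfl⟩ := h
  obtain ⟨u, hu, rfl⟩ := hp
  rcases eq_or_lt_of_le hu.1 with rfl | hu0
  · rw [h0]; simp [abs_of_nonneg hη]
  rcases eq_or_lt_of_le hu.2 with rfl | hu1
  · rw [h1]; simp [abs_of_nonneg hη]
  exact (h2 u ⟨hu0, hu1⟩).le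

theorem exists_mem (h : IsCut H t η τ) : ∃ p ∈ τ, |H p - t| < η := by
  obtain ⟨g, hg, -, -, h2, rfl⟩ := h
  exact ⟨g (1 / 2), mem_image_of_mem _ (by norm_num), h2 _ (by norm_num)⟩

theorem image {G : ℝ × ℝ ≃ₜ ℝ × ℝ} {β B : ℝ} (hG : IsShift H G β B) (h : IsCut H t η τ) :
    IsCut H (t + β) η (G '' τ) := by
  obtain ⟨g, hg, h0, h1, h2, rfl⟩ := h
  refine ⟨G ∘ g, G.continuous.comp hg, ?_, ?_, fun u hu => ?_, (image_comp _ _ _).symm⟩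
  · simp only [comp_apply, hG.height, h0]; ring
  · simp only [comp_apply, hG.height, h1]; ring
  · simp only [comp_apply, hG.height, add_sub_add_right_eq_sub]
    exact h2 u hu

/-- A connected set inside a strip that avoids an arc crossing a wider strip cannot be vertically
unbounded in both directions. -/
theorem false_of_unbounded (hH : IsTameHeight H) (h : IsCut H t η τ) {c : ℝ} (hc : c < η)
    {K : Set (ℝ × ℝ)} (hK : IsPreconnected K) (hKc : ∀ q ∈ K, |H q - t| ≤ c ∧ q ∉ τ)
    (hup : ∀ m, ∃ q ∈ K, m < q.2) (hdn : ∀ m, ∃ q ∈ K, q.2 < m) : False := by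
  obtain ⟨B, hB⟩ := hH.exists_bound
  have hHc := hH.continuous
  have hB0 : 0 ≤ B := (abs_nonneg _).trans (hB 0)
  obtain ⟨q₀, hq₀, -⟩ := hup 0
  have hc0 : 0 ≤ c := (abs_nonneg _).trans (hKc q₀ hq₀).1
  obtain ⟨d, hcd, hdη⟩ := exists_between hc
  set O := {p | |H p - t| < d} ∩ τᶜ with hO
  have hOo : IsOpen O := (isOpen_lt (by fun_prop) continuous_const).inter
    h.isCompact.isClosed.isOpen_compl
  have hKO : K ⊆ O := fun q hq => ⟨(hKc q hq).1.trans_lt hcd, (hKc q hq).2⟩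
  set X := |t| + η + B + 1
  have hX : ∀ p ∈ O, -X < p.1 ∧ p.1 < X := fun p hp => by
    have h1 := hB p
    have h2 : |H p - t| < d := hp.1
    rw [_root_.abs_le] at h1
    rw [abs_lt] at h2
    have h3 := neg_abs_le t
    have h4 := le_abs_self t
    constructor <;> simp only [X] <;> linarith
  obtain ⟨g, hg, h0, h1, h2, hτ⟩ := h
  have hj : JoinedIn Oᶜ (-X, 0) (X, 0) := by
    have e1 : JoinedIn {p | H p < t - d} (-X, 0) (g 0) := by
      refine (hH.isPreconnected_lt _).joinedIn_of_isOpen (isOpen_lt hHc continuous_const) ?_ ?_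
      · have h1 := (_root_.abs_le.1 (hB (-X, 0))).2
        have h3 := neg_abs_le t
        simp only [mem_ofPred_eq, X] at h1 ⊢
        linarith
      · simp only [mem_ofPred_eq, h0]; linarith
    have e2 : JoinedIn τ (g 0) (g 1) := JoinedIn.ofLine hg.continuousOn rfl rfl hτ.ge
    have e3 : JoinedIn {p | t + d < H p} (g 1) (X, 0) := by
      refine (hH.isPreconnected_gt _).joinedIn_of_isOpen (isOpen_lt continuous_const hHc) ?_ ?_
      · simp only [mem_ofPred_eq, h1]; linarith
      · have h1 := (_root_.abs_le.1 (hB (X, 0))).1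
        have h3 := le_abs_self t
        simp only [mem_ofPred_eq, X] at h1 ⊢
        linarith
    refine (e1.mono ?_).trans ((e2.mono ?_).trans (e3.mono ?_))
    · intro p hp hpO
      have h2 : |H p - t| < d := hpO.1
      have := (abs_lt.1 h2).1
      simp only [mem_ofPred_eq] at hp
      linarith
    · exact fun p hp hpO => hpO.2 hp
    · intro p hp hpO
      have h2 : |H p - t| < d := hpO.1
      have := (abs_lt.1 h2).2
      simp only [mem_ofPred_eq] at hp
      linarith
  obtain ⟨l, hl, hl0, hl1, hlO, hlc⟩ := hj.exists_curve
  obtain ⟨m, hm⟩ := hlc.exists_abs_snd_le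
  obtain ⟨a, ha, ham⟩ := hdn (-m)
  obtain ⟨b, hb, hbm⟩ := hup m
  have hab : JoinedIn O a b := by
    have hsub := hK.subset_connectedComponentIn ha hKO
    exact (isPreconnected_connectedComponentIn.joinedIn_of_isOpen hOo.connectedComponentIn
      (hsub ha) (hsub hb)).mono (connectedComponentIn_subset _ _)
  obtain ⟨κ, hκ, hκ0, hκ1, hκO, -⟩ := hab.exists_curve
  obtain ⟨u, v, huv⟩ := exists_crossing hκ hl
    (fun u => by rw [hl0, hl1]; exact hX _ (hκO u))
    (fun v => by
      have := _root_.abs_le.1 (hm _ (mem_range_self v))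
      rw [hκ0, hκ1]
      constructor <;> linarith)
  exact hlO v (huv ▸ hκO u)

end IsCut

theorem IsPreconnected.biUnion_intTranslation {K : Set (ℝ × ℝ)} (hK : IsPreconnected K) {k : ℤ}
    {p : ℝ × ℝ} (hp : p ∈ K) (hpk : p + (0, (k : ℝ)) ∈ K) {I : Set ℤ} (hI : I.OrdConnected) :
    IsPreconnected (⋃ i ∈ I, intTranslation 0 (i * k) '' K) := by
  refine IsPreconnected.biUnion_of_chain hI
    (fun i _ => hK.image _ (Homeomorph.continuous _).continuousOn) fun i _ _ => ?_
  refine ⟨p + (0, (((i + 1) * k : ℤ) : ℝ)), ⟨p + (0, (k : ℝ)), hpk, ?_⟩, ⟨p, hp, ?_⟩⟩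
  · ext
    · simp
    · simp; ring
  · simp [Order.succ_eq_add_one]

/-- The points of the strip which are joined to the end `e = ±1` of the strip, inside a narrower
strip, in the complement of `τ`. -/
def Side (H : ℝ × ℝ → ℝ) (t η : ℝ) (τ : Set (ℝ × ℝ)) (e : ℤˣ) : Set (ℝ × ℝ) :=
  {p | ∃ c < η, ∃ K, IsPreconnected K ∧ p ∈ K ∧ (∀ q ∈ K, |H q - t| ≤ c ∧ q ∉ τ) ∧
    ∀ m : ℝ, ∃ q ∈ K, m < ((e : ℤ) : ℝ) * q.2}

theorem units_mul_self_cast (e : ℤˣ) : ((e : ℤ) : ℝ) * ((e : ℤ) : ℝ) = 1 := by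
  rcases Int.units_eq_one_or e with rfl | rfl <;> simp

theorem abs_units_mul_cast (e : ℤˣ) (x : ℝ) : |((e : ℤ) : ℝ) * x| = |x| := by
  rcases Int.units_eq_one_or e with rfl | rfl <;> simp

/-- Points of equal height at vertical distance at most `1` are joined by connected sets of
vertical extent at most `Y` on which heights vary by at most `δ`. -/
def HasJoining (H : ℝ × ℝ → ℝ) (δ Y : ℝ) : Prop :=
  ∀ p q : ℝ × ℝ, H p = H q → |p.2 - q.2| ≤ 1 → ∃ K, IsPreconnected K ∧ p ∈ K ∧ q ∈ K ∧
    ∀ a ∈ K, |H a - H p| ≤ δ ∧ |a.2 - p.2| ≤ Y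

namespace Side

variable {H : ℝ × ℝ → ℝ} {t η : ℝ} {τ : Set (ℝ × ℝ)} {e : ℤˣ} {p : ℝ × ℝ}

theorem notMem (h : p ∈ Side H t η τ e) : p ∉ τ := by
  obtain ⟨c, -, K, -, hp, hK, -⟩ := h
  exact (hK p hp).2

theorem abs_lt (h : p ∈ Side H t η τ e) : |H p - t| < η := by
  obtain ⟨c, hc, K, -, hp, hK, -⟩ := h
  exact (hK p hp).1.trans_lt hc

theorem map {G : ℝ × ℝ ≃ₜ ℝ × ℝ} {β B : ℝ} (hG : IsShift H G β B) (h : p ∈ Side H t η τ e) :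
    G p ∈ Side H (t + β) η (G '' τ) e := by
  obtain ⟨c, hc, K, hKp, hp, hK, hu⟩ := h
  refine ⟨c, hc, G '' K, hKp.image _ G.continuous.continuousOn, mem_image_of_mem _ hp, ?_,
    fun m => ?_⟩
  · rintro _ ⟨q, hq, rfl⟩
    rw [hG.height, add_sub_add_right_eq_sub, G.injective.mem_set_image]
    exact hK q hq
  · obtain ⟨q, hq, hqm⟩ := hu (m + B)
    refine ⟨G q, mem_image_of_mem _ hq, ?_⟩
    have h1 := hG.disp q
    rw [← abs_units_mul_cast e, abs_le] at h1
    linarith [h1.1]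

theorem map_iff {G : ℝ × ℝ ≃ₜ ℝ × ℝ} {β B : ℝ} (hG : IsShift H G β B) :
    G p ∈ Side H (t + β) η (G '' τ) e ↔ p ∈ Side H t η τ e := by
  refine ⟨fun h => ?_, map hG⟩
  have := map hG.symm h
  rwa [G.symm_apply_apply, add_neg_cancel_right, ← image_comp, G.symm_comp_self, image_id] at this

theorem union_mem {a b : ℝ × ℝ} (hb : b ∈ Side H t η τ e) {K : Set (ℝ × ℝ)} (hK : IsPreconnected K)
    (haK : a ∈ K) (hbK : b ∈ K) {c : ℝ} (hc : c < η) (hKc : ∀ q ∈ K, |H q - t| ≤ c ∧ q ∉ τ) :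
    a ∈ Side H t η τ e := by
  obtain ⟨c', hc', K', hKp', hb', hK', hu'⟩ := hb
  refine ⟨max c c', max_lt hc hc', K ∪ K', IsPreconnected.union b hbK hb' hK hKp', Or.inl haK, ?_,
    fun m => ?_⟩
  · rintro q (hq | hq)
    · exact ⟨(hKc q hq).1.trans (le_max_left _ _), (hKc q hq).2⟩
    · exact ⟨(hK' q hq).1.trans (le_max_right _ _), (hK' q hq).2⟩
  · obtain ⟨q, hq, hqm⟩ := hu' m
    exact ⟨q, Or.inr hq, hqm⟩

theorem disjoint (hH : IsTameHeight H) (hτ : IsCut H t η τ) (h : p ∈ Side H t η τ e)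
    (h' : p ∈ Side H t η τ (-e)) : False := by
  have key : ∀ p, p ∈ Side H t η τ 1 → p ∈ Side H t η τ (-1) → False := by
    rintro p ⟨c, hc, K, hKp, hp, hK, hu⟩ ⟨c', hc', K', hKp', hp', hK', hu'⟩
    refine hτ.false_of_unbounded hH (max_lt hc hc') (hKp.union p hp hp' hKp') ?_ (fun m => ?_)
      (fun m => ?_)
    · rintro q (hq | hq)
      · exact ⟨(hK q hq).1.trans (le_max_left _ _), (hK q hq).2⟩
      · exact ⟨(hK' q hq).1.trans (le_max_right _ _), (hK' q hq).2⟩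
    · obtain ⟨q, hq, hqm⟩ := hu m
      exact ⟨q, Or.inl hq, by simpa using hqm⟩
    · obtain ⟨q, hq, hqm⟩ := hu' (-m)
      exact ⟨q, Or.inr hq, by simpa using hqm⟩
  rcases Int.units_eq_one_or e with rfl | rfl
  · exact key p h h'
  · exact key p (by simpa using h') h

theorem exists_ball (hH : IsTameHeight H) (hτ : IsClosed τ) (hp : |H p - t| < η)
    (hpτ : p ∉ τ) : ∃ r > 0, ∀ a ∈ ball p r, ∀ b ∈ ball p r, b ∈ Side H t η τ e →
      a ∈ Side H t η τ e := by
  obtain ⟨c, hpc, hc⟩ := exists_between hp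
  have hHc := hH.continuous
  have hO : IsOpen ({q | |H q - t| < c} ∩ τᶜ) :=
    (isOpen_lt (by fun_prop) continuous_const).inter hτ.isOpen_compl
  obtain ⟨r, hr, hrO⟩ := Metric.isOpen_iff.1 hO p ⟨hpc, hpτ⟩
  refine ⟨r, hr, fun a ha b hb h => union_mem h (convex_ball p r).isPreconnected ha hb hc ?_⟩
  exact fun q hq => ⟨le_of_lt (hrO hq).1, (hrO hq).2⟩

/-- The open part of a cut disjoint from `τ` lies on a single side of `τ`. -/
theorem of_mem_isCut (hH : IsTameHeight H) {a : Set (ℝ × ℝ)} (ha : IsCut H t η a)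
    (hd : Disjoint a τ) {q : ℝ × ℝ} (hp : p ∈ a) (hps : p ∈ Side H t η τ e) (hq : q ∈ a)
    (hqη : |H q - t| < η) : q ∈ Side H t η τ e := by
  have hpη := abs_lt hps
  obtain ⟨g, hg, h0, h1, h2, rfl⟩ := ha
  have hη : 0 < η := (abs_nonneg _).trans_lt hqη
  have key : ∀ u ∈ Icc (0 : ℝ) 1, |H (g u) - t| < η → u ∈ Ioo (0 : ℝ) 1 := by
    intro u hu hu'
    refine ⟨lt_of_le_of_ne hu.1 ?_, lt_of_le_of_ne hu.2 ?_⟩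
    · rintro rfl
      rw [h0] at hu'
      simp [abs_of_pos hη] at hu'
    · rintro rfl
      rw [h1] at hu'
      simp [abs_of_pos hη] at hu'
  obtain ⟨u, hu, rfl⟩ := hp
  obtain ⟨v, hv, rfl⟩ := hq
  have hsub : uIcc u v ⊆ Ioo 0 1 :=
    ordConnected_Ioo.uIcc_subset (key u hu hpη) (key v hv hqη)
  have hHc := hH.continuous
  obtain ⟨w, hw, hwm⟩ := (isCompact_uIcc (a := u) (b := v)).exists_isMaxOn ⟨u, left_mem_uIcc⟩
    (f := fun w => |H (g w) - t|) (by fun_prop)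
  refine union_mem hps (isPreconnected_uIcc.image g hg.continuousOn)
    (mem_image_of_mem _ right_mem_uIcc) (mem_image_of_mem _ left_mem_uIcc) (h2 w (hsub hw)) ?_
  rintro _ ⟨x, hx, rfl⟩
  exact ⟨hwm hx, disjoint_left.1 hd (mem_image_of_mem _ (Ioo_subset_Icc_self (hsub hx)))⟩

theorem subset_of_forall_notMem {a : Set (ℝ × ℝ)} (h : ∀ p ∈ a, p ∉ Side H t η τ e) :
    Side H t η τ e ⊆ Side H t η a e := by
  rintro p ⟨c, hc, K, hKp, hp, hK, hu⟩
  exact ⟨c, hc, K, hKp, hp, fun q hq => ⟨(hK q hq).1, fun hqa =>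
    h q hqa ⟨c, hc, K, hKp, hq, hK, hu⟩⟩, hu⟩

theorem of_far {δ Y : ℝ} (hY : HasJoining H δ Y) (hH : IsHeight H) (hδ : δ < η) (hp : H p = t)
    {y₀ m : ℝ} (hτ : ∀ a ∈ τ, |a.2 - y₀| ≤ m) (hfar : m + Y < ((e : ℤ) : ℝ) * (p.2 - y₀)) :
    p ∈ Side H t η τ e := by
  have hq : H (p + (0, ((e : ℤ) : ℝ))) = H p := by
    have := hH.map_add p 0 e
    simpa using this
  obtain ⟨K, hK, hpK, hqK, hKb⟩ := hY p (p + (0, ((e : ℤ) : ℝ))) hq.symm (by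
    rcases Int.units_eq_one_or e with rfl | rfl <;> simp)
  refine ⟨δ, hδ, ⋃ i ∈ Ici (0 : ℤ), intTranslation 0 (i * (e : ℤ)) '' K,
    hK.biUnion_intTranslation hpK hqK ordConnected_Ici, ?_, ?_, fun M => ?_⟩
  · exact mem_biUnion (mem_Ici.2 le_rfl) ⟨p, hpK, by simp [← Prod.zero_eq_mk]⟩
  · intro q hq
    obtain ⟨i, hi, a, ha, rfl⟩ := mem_iUnion₂.1 hq
    have h1 := hKb a ha
    have hi0 : (0 : ℝ) ≤ i := by exact_mod_cast hi
    rw [intTranslation_apply, hH.map_add, ← hp]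
    refine ⟨by simpa using h1.1, fun hmem => ?_⟩
    have h2 := hτ _ hmem
    have h3 := h1.2
    rw [← abs_units_mul_cast e, abs_le] at h2 h3
    simp only [Prod.snd_add, Int.cast_mul] at h2
    have h4 := units_mul_self_cast e
    nlinarith [h2.2, h3.1]
  · obtain ⟨n, hn⟩ := exists_nat_gt (M - ((e : ℤ) : ℝ) * p.2)
    refine ⟨p + (((0 : ℤ) : ℝ), ((n * (e : ℤ) : ℤ) : ℝ)), mem_biUnion (mem_Ici.2 (Int.natCast_nonneg n))
      ⟨p, hpK, by simp⟩, ?_⟩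
    have h4 := units_mul_self_cast e
    simp only [Prod.snd_add, Int.cast_mul, Int.cast_natCast]
    nlinarith

/-- The `e`-sides of two disjoint cuts are nested. -/
theorem subset_or_subset {δ Y : ℝ} (hY : HasJoining H δ Y) (hδ : δ < η) (hH : IsTameHeight H)
    {a b : Set (ℝ × ℝ)} (ha : IsCut H t η a) (hb : IsCut H t η b) (hd : Disjoint a b) :
    Side H t η b e ⊆ Side H t η a e ∨ Side H t η a e ⊆ Side H t η b e := by
  by_contra! hcon
  have hab : ∃ p ∈ a, p ∈ Side H t η b e := by
    by_contra! h
    exact hcon.1 (subset_of_forall_notMem h)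
  have hba : ∃ p ∈ b, p ∈ Side H t η a e := by
    by_contra! h
    exact hcon.2 (subset_of_forall_notMem h)
  obtain ⟨p, hpa, hpb⟩ := hab
  obtain ⟨q, hqb, hqa⟩ := hba
  have h1 : ∀ x ∈ a, x ∉ Side H t η b (-e) := fun x hx hx' =>
    disjoint hH hb (of_mem_isCut hH ha hd hpa hpb hx (abs_lt hx')) hx'
  have h2 : ∀ x ∈ b, x ∉ Side H t η a (-e) := fun x hx hx' =>
    disjoint hH ha (of_mem_isCut hH hb hd.symm hqb hqa hx (abs_lt hx')) hx'
  have heq : Side H t η b (-e) = Side H t η a (-e) :=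
    (subset_of_forall_notMem h1).antisymm (subset_of_forall_notMem h2)
  have hη : 0 < η := (abs_nonneg _).trans_lt (abs_lt hpb)
  obtain ⟨m, hm⟩ := hb.isCompact.exists_abs_snd_le
  obtain ⟨z, hz⟩ : (Side H t η b (-e)).Nonempty := by
    obtain ⟨x₀, hx₀⟩ : ∃ x : ℝ × ℝ, H x = t := by
      obtain ⟨g, hg, h0, h1, -, -⟩ := hb
      obtain ⟨u, hu⟩ := mem_range_of_exists_le_of_exists_ge (hH.continuous.comp hg)
        ⟨0, show H (g 0) ≤ t by linarith⟩ ⟨1, show t ≤ H (g 1) by linarith⟩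
      exact ⟨_, hu⟩
    obtain ⟨n, hn⟩ := exists_nat_gt (m + Y - (((-e : ℤˣ) : ℤ) : ℝ) * x₀.2)
    refine ⟨x₀ + (((0 : ℤ) : ℝ), ((n * ((-e : ℤˣ) : ℤ) : ℤ) : ℝ)), of_far hY hH.toIsHeight hδ ?_
      (y₀ := 0) (m := m) (by simpa using hm) ?_⟩
    · rw [hH.map_add, hx₀]; simp
    · have h4 := units_mul_self_cast (-e)
      simp only [Prod.snd_add, Int.cast_mul, Int.cast_natCast, sub_zero]
      nlinarith
  set D := Side H t η b (-e) with hD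
  have hDo : IsOpen D := Metric.isOpen_iff.2 fun x hx => by
    obtain ⟨r, hr, h⟩ := exists_ball (e := -e) hH hb.isCompact.isClosed (abs_lt hx) (notMem hx)
    exact ⟨r, hr, fun y hy => h y hy x (mem_ball_self hr) hx⟩
  have hDc : ∀ x ∈ closure D, |H x - t| < η → x ∈ D := by
    intro x hx hxη
    have key : ∀ τ, IsCut H t η τ → D = Side H t η τ (-e) → x ∉ τ → x ∈ D := by
      intro τ hτ hDτ hxτ
      obtain ⟨r, hr, h⟩ := exists_ball (e := -e) hH hτ.isCompact.isClosed hxη hxτ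
      obtain ⟨y, hy, hyD⟩ := mem_closure_iff.1 hx _ isOpen_ball (mem_ball_self hr)
      rw [hDτ] at hyD ⊢
      exact h x (mem_ball_self hr) y hy hyD
    by_cases hxb : x ∈ b
    · exact key a ha heq (disjoint_right.1 hd hxb)
    · exact key b hb rfl hxb
  have hsub : {x | |H x - t| < η} ⊆ D := by
    refine (hH.isPreconnected_strip t hη).subset_of_closure_inter_subset hDo ⟨z, abs_lt hz, hz⟩ ?_
    exact fun x hx => hDc x hx.1 hx.2
  exact disjoint hH hb hpb (hsub (abs_lt hpb))

end Side

/-- The number of vertical translates of the cut `τ` lying below `p`, suitably normalized. -/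
def crossCount (H : ℝ × ℝ → ℝ) (t η : ℝ) (τ : Set (ℝ × ℝ)) (p : ℝ × ℝ) : ℤ :=
  sSup {j : ℤ | p ∈ Side H t η (intTranslation 0 j '' τ) 1}

theorem intTranslation_image_image (i j : ℤ) (τ : Set (ℝ × ℝ)) :
    intTranslation 0 i '' (intTranslation 0 j '' τ) = intTranslation 0 (i + j) '' τ := by
  rw [← image_comp]
  congr 1
  funext p
  ext <;> simp [add_assoc, add_comm (j : ℝ)]

theorem IsShift.image_intTranslation_image {H : ℝ × ℝ → ℝ} {G : ℝ × ℝ ≃ₜ ℝ × ℝ} {β B : ℝ}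
    (hG : IsShift H G β B) (j : ℤ) (τ : Set (ℝ × ℝ)) :
    G '' (intTranslation 0 j '' τ) = intTranslation 0 j '' (G '' τ) := by
  rw [← image_comp, ← image_comp]
  congr 1
  funext p
  exact hG.map_add p 0 j

section
variable {H : ℝ × ℝ → ℝ} {t η δ Y : ℝ} {a b τ : Set (ℝ × ℝ)} {p q : ℝ × ℝ}

theorem IsCut.intTranslation_image (hH : IsHeight H) (hτ : IsCut H t η τ) (j : ℤ) :
    IsCut H t η (intTranslation 0 j '' τ) := by
  simpa using hτ.image (hH.isShift_intTranslation 0 j)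

theorem intTranslation_mem_side_iff (hH : IsHeight H) (j : ℤ) {e : ℤˣ} :
    intTranslation 0 j p ∈ Side H t η (intTranslation 0 j '' τ) e ↔ p ∈ Side H t η τ e := by
  simpa using Side.map_iff (hH.isShift_intTranslation 0 j) (t := t) (η := η) (τ := τ) (p := p)
    (e := e)

theorem side_subset_of_intTranslation (hH : IsHeight H) (j : ℤ) {e : ℤˣ}
    (h : Side H t η a e ⊆ Side H t η b e) :
    Side H t η (intTranslation 0 j '' a) e ⊆ Side H t η (intTranslation 0 j '' b) e := by
  intro p hp
  obtain ⟨q, rfl⟩ := (intTranslation 0 j).surjective p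
  exact (intTranslation_mem_side_iff hH j).2 (h ((intTranslation_mem_side_iff hH j).1 hp))

theorem IsTameHeight.mem_side_of_lt (hH : IsTameHeight H) (hY : HasJoining H δ Y) (hδ : δ < η)
    {m : ℝ} (hm : ∀ a ∈ τ, |a.2| ≤ m) (hp : H p = t) {j : ℤ}
    (hj : (j : ℝ) < p.2 - m - Y) : p ∈ Side H t η (intTranslation 0 j '' τ) 1 := by
  refine Side.of_far hY hH.toIsHeight hδ hp (y₀ := j) (m := m) ?_ (by simp; linarith)
  rintro _ ⟨x, hx, rfl⟩
  simpa using hm x hx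

theorem IsTameHeight.le_of_mem_side (hH : IsTameHeight H) (hY : HasJoining H δ Y) (hδ : δ < η)
    (hτ : IsCut H t η τ) {m : ℝ} (hm : ∀ a ∈ τ, |a.2| ≤ m) (hp : H p = t) {j : ℤ}
    (hj : p ∈ Side H t η (intTranslation 0 j '' τ) 1) : (j : ℝ) ≤ p.2 + m + Y := by
  by_contra! hc
  refine Side.disjoint hH (hτ.intTranslation_image hH.toIsHeight j) hj
    (Side.of_far hY hH.toIsHeight hδ hp (y₀ := j) (m := m) ?_ (by simp; linarith))
  rintro _ ⟨x, hx, rfl⟩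
  simpa using hm x hx

theorem IsTameHeight.isGreatest_crossCount (hH : IsTameHeight H) (hY : HasJoining H δ Y)
    (hδ : δ < η) (hτ : IsCut H t η τ) (hp : H p = t) :
    IsGreatest {j : ℤ | p ∈ Side H t η (intTranslation 0 j '' τ) 1} (crossCount H t η τ p) := by
  obtain ⟨m, hm⟩ := hτ.isCompact.exists_abs_snd_le
  obtain ⟨j, hj⟩ := exists_int_lt (p.2 - m - Y)
  obtain ⟨k, hk⟩ := exists_int_gt (p.2 + m + Y)
  have hne : {j : ℤ | p ∈ Side H t η (intTranslation 0 j '' τ) 1}.Nonempty :=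
    ⟨j, hH.mem_side_of_lt hY hδ hm hp hj⟩
  have hbd : BddAbove {j : ℤ | p ∈ Side H t η (intTranslation 0 j '' τ) 1} :=
    ⟨k, fun i hi => by
      have := hH.le_of_mem_side hY hδ hτ hm hp hi
      exact_mod_cast (this.trans hk.le)⟩
  exact ⟨Int.csSup_mem hne hbd, fun i hi => le_csSup hbd hi⟩

theorem IsTameHeight.abs_crossCount_sub_le (hH : IsTameHeight H) (hY : HasJoining H δ Y)
    (hδ : δ < η) (hτ : IsCut H t η τ) (hτ0 : ∀ a ∈ τ, a.2 = 0) (hp : H p = t) :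
    |(crossCount H t η τ p : ℝ) - p.2| ≤ Y + 1 := by
  have hm : ∀ a ∈ τ, |a.2| ≤ 0 := fun a ha => by simp [hτ0 a ha]
  obtain ⟨h1, h2⟩ := hH.isGreatest_crossCount hY hδ hτ hp
  have h3 := hH.le_of_mem_side hY hδ hτ hm hp h1
  have h4 : ((⌈p.2 - 0 - Y⌉ - 1 : ℤ) : ℝ) ≤ crossCount H t η τ p := by
    refine Int.cast_le.2 (h2 (hH.mem_side_of_lt hY hδ hm hp ?_))
    push_cast
    linarith [Int.ceil_lt_add_one (p.2 - 0 - Y)]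
  push_cast at h4
  have h5 := Int.le_ceil (p.2 - 0 - Y)
  rw [abs_le]
  constructor <;> linarith

theorem crossCount_image {G : ℝ × ℝ ≃ₜ ℝ × ℝ} {β B : ℝ} (hG : IsShift H G β B) :
    crossCount H (t + β) η (G '' τ) (G p) = crossCount H t η τ p := by
  unfold crossCount
  congr 1
  ext j
  simp only [mem_ofPred_eq, ← hG.image_intTranslation_image, Side.map_iff hG]

theorem IsTameHeight.side_antitone (hH : IsTameHeight H) (hY : HasJoining H δ Y) (hδ : δ < η)
    (hb : IsCut H t η b) (hbb : Disjoint b (intTranslation 0 1 '' b)) (hp : H p = t) :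
    Antitone fun j : ℤ => Side H t η (intTranslation 0 j '' b) 1 := by
  have h0 := hH.toIsHeight
  have hstep : Side H t η (intTranslation 0 1 '' b) 1 ⊆ Side H t η b 1 := by
    rcases Side.subset_or_subset (e := 1) hY hδ hH hb (hb.intTranslation_image h0 1) hbb with h | h
    · exact h
    · exfalso
      have hmono : Monotone fun j : ℤ => Side H t η (intTranslation 0 j '' b) 1 :=
        monotone_int_of_le_succ fun j => by
          have := side_subset_of_intTranslation h0 j h
          rwa [intTranslation_image_image] at this
      obtain ⟨h1, h2⟩ := hH.isGreatest_crossCount hY hδ hb hp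
      have h3 := h2 (hmono (by linarith : crossCount H t η b p ≤ crossCount H t η b p + 1) h1)
      linarith
  exact antitone_int_of_succ_le fun j => by
    have := side_subset_of_intTranslation h0 j hstep
    rwa [intTranslation_image_image] at this

/-- If a cut `a` meets only few consecutive translates of `b`, then the crossing counts of `a` and
`b` have almost the same increments. -/
theorem IsTameHeight.abs_crossCount_sub_sub_le (hH : IsTameHeight H) (hY : HasJoining H δ Y)
    (hδ : δ < η) (ha : IsCut H t η a) (hb : IsCut H t η b)
    (hbb : Disjoint b (intTranslation 0 1 '' b)) (j₁ : ℤ) (W : ℕ)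
    (hd : ∀ j : ℤ, j < j₁ ∨ j₁ + W < j → Disjoint a (intTranslation 0 j '' b))
    (hp : H p = t) (hq : H q = t) :
    |(crossCount H t η b p - crossCount H t η b q) -
      (crossCount H t η a p - crossCount H t η a q)| ≤ W + 2 := by
  have h0 := hH.toIsHeight
  have hanti := hH.side_antitone hY hδ hb hbb hp
  have hdich : ∀ j : ℤ, j < j₁ ∨ j₁ + W < j →
      Side H t η (intTranslation 0 j '' b) 1 ⊆ Side H t η a 1 ∨
      Side H t η a 1 ⊆ Side H t η (intTranslation 0 j '' b) 1 := fun j hj =>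
    Side.subset_or_subset hY hδ hH ha (hb.intTranslation_image h0 j) (hd j hj)
  obtain ⟨m, hm⟩ := ha.isCompact.exists_abs_snd_le
  have hpj : ∀ j : ℤ, H (intTranslation 0 j p) = t := fun j => by
    rw [intTranslation_apply, h0.map_add, hp]; simp
  obtain ⟨c, hc, hcmax⟩ : ∃ c, IsGreatest {c : ℤ | Side H t η a 1 ⊆
      Side H t η (intTranslation 0 c '' b) 1} c := by
    have hne : {c : ℤ | Side H t η a 1 ⊆ Side H t η (intTranslation 0 c '' b) 1}.Nonempty := by
      obtain ⟨k, hk⟩ := exists_int_lt (-p.2 - m - Y)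
      set x := intTranslation 0 k p
      have hxa : x ∉ Side H t η a 1 := fun hx => by
        have h1 := hH.le_of_mem_side (j := 0) hY hδ ha hm (hpj k) (by
          convert hx using 2
          ext; simp [intTranslation, ← Prod.zero_eq_mk])
        simp at h1
        linarith
      have hx := (hH.isGreatest_crossCount hY hδ hb (hpj k)).1
      set s := crossCount H t η b x
      refine ⟨min s (j₁ - 1), (hdich _ (Or.inl (by have := min_le_right s (j₁ - 1); omega))).resolve_left
        fun h => hxa (h (hanti (min_le_left _ _) hx))⟩
    obtain ⟨k, hk⟩ := exists_int_gt (m + Y - p.2)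
    set x := intTranslation 0 k p
    have hxa : x ∈ Side H t η a 1 := by
      refine Side.of_far hY h0 hδ (hpj k) (y₀ := 0) (m := m) (by simpa using hm) ?_
      simp [x]
      linarith
    have hbd : BddAbove {c : ℤ | Side H t η a 1 ⊆ Side H t η (intTranslation 0 c '' b) 1} :=
      ⟨_, fun i hi => (hH.isGreatest_crossCount hY hδ hb (hpj k)).2 (hi hxa)⟩
    exact ⟨_, Int.csSup_mem hne hbd, fun i hi => le_csSup hbd hi⟩
  have hcW : Side H t η (intTranslation 0 (c + (W + 2)) '' b) 1 ⊆ Side H t η a 1 := by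
    have key : ∀ j : ℤ, c < j → (j < j₁ ∨ j₁ + W < j) →
        Side H t η (intTranslation 0 j '' b) 1 ⊆ Side H t η a 1 := fun j hj hj' =>
      (hdich j hj').resolve_right fun h => by have := hcmax h; omega
    rcases lt_or_ge (c + 1) j₁ with h | h
    · exact (hanti (by omega)).trans (key (c + 1) (by omega) (Or.inl h))
    · rcases lt_or_ge (j₁ + W) (c + 1) with h' | h'
      · exact (hanti (by omega)).trans (key (c + 1) (by omega) (Or.inr h'))
      · exact (hanti (by omega)).trans (key (j₁ + W + 1) (by omega) (Or.inr (by omega)))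
  have main : ∀ x, H x = t → crossCount H t η b x - c - (W + 2) ≤ crossCount H t η a x ∧
      crossCount H t η a x ≤ crossCount H t η b x - c := by
    intro x hx
    obtain ⟨h1, h2⟩ := hH.isGreatest_crossCount hY hδ ha hx
    obtain ⟨h3, h4⟩ := hH.isGreatest_crossCount hY hδ hb hx
    constructor
    · refine h2 ?_
      have := side_subset_of_intTranslation h0 (crossCount H t η b x - c - (W + 2)) hcW
      rw [intTranslation_image_image,
        show crossCount H t η b x - c - (W + 2) + (c + (W + 2)) = crossCount H t η b x by ring]
        at this
      exact this h3
    · have := side_subset_of_intTranslation h0 (crossCount H t η a x) hc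
      rw [intTranslation_image_image] at this
      have := h4 (this h1)
      linarith
  have e1 := main p hp
  have e2 := main q hq
  rw [abs_le]
  constructor <;> omega

/-- Near the level `t` there is a connected set of vertical extent at most `M` containing a point
and a vertical translate of it. -/
def IsLoose (H : ℝ × ℝ → ℝ) (t η M : ℝ) : Prop :=
  ∃ K : Set (ℝ × ℝ), IsPreconnected K ∧ (∀ q ∈ K, |H q - t| ≤ η ∧ |q.2| ≤ M) ∧
    ∃ m : ℤ, 0 < m ∧ ∃ p ∈ K, p + (0, (m : ℝ)) ∈ K

theorem IsHeight.exists_horizontal_isCut (hH : IsHeight H) (hη : 0 < η) (t : ℝ) :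
    ∃ σ, IsCut H t η σ ∧ ∀ a ∈ σ, a.2 = 0 := by
  obtain ⟨B, hB⟩ := hH.exists_bound
  have h1 := (abs_le.1 (hB (t - η - B, 0))).2
  have h2 := (abs_le.1 (hB (t + η + B, 0))).1
  simp only at h1 h2
  obtain ⟨τ, hτ, hcut⟩ := exists_isCut_subset hH.continuous (t := t) hη
    (κ := fun u => (t - η - B + u * (2 * (η + B)), 0)) (by fun_prop) (by
      simp only [zero_mul, add_zero]; linarith) (by
      simp only [one_mul, show t - η - B + 2 * (η + B) = t + η + B by ring]; linarith)
  refine ⟨τ, hcut, fun a ha => ?_⟩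
  obtain ⟨u, -, rfl⟩ := hτ ha
  rfl

/-- A cut whose points have height coordinate at most `M` and which meets two translates of a
horizontal cut makes the strip loose. -/
theorem isLoose_of_meets (hη : 0 < η) (hH : IsHeight H) (ha : IsCut H t η a) (hb : IsCut H t η b)
    {M : ℝ} (haM : ∀ x ∈ a, |x.2| ≤ M) (hb0 : ∀ x ∈ b, x.2 = 0) {i j : ℤ} (hij : i < j)
    (hi : ¬ Disjoint a (intTranslation 0 i '' b)) (hj : ¬ Disjoint a (intTranslation 0 j '' b)) :
    IsLoose H t η M := by
  obtain ⟨x, hxa, hxb⟩ := not_disjoint_iff.1 hi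
  obtain ⟨y, hya, hyb⟩ := not_disjoint_iff.1 hj
  obtain ⟨p, hpb, -⟩ := hb.exists_mem
  have hyt : ∀ k : ℤ, ∀ z ∈ intTranslation 0 k '' b, z.2 = k := by
    rintro k _ ⟨z, hz, rfl⟩
    simp [hb0 z hz]
  refine ⟨intTranslation 0 i '' b ∪ (a ∪ intTranslation 0 j '' b), ?_, ?_, j - i, by omega,
    p + (0, (i : ℝ)), Or.inl ⟨p, hpb, by simp⟩, Or.inr (Or.inr ⟨p, hpb, ?_⟩)⟩
  · exact (hb.intTranslation_image hH i).isPreconnected.union x hxb (Or.inl hxa)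
      (ha.isPreconnected.union y hya hyb (hb.intTranslation_image hH j).isPreconnected)
  · rintro q (hq | hq | hq)
    · refine ⟨(hb.intTranslation_image hH i).abs_le hη.le hq, ?_⟩
      rw [hyt i q hq, ← hyt i x hxb]
      exact haM x hxa
    · exact ⟨ha.abs_le hη.le hq, haM q hq⟩
    · refine ⟨(hb.intTranslation_image hH j).abs_le hη.le hq, ?_⟩
      rw [hyt j q hq, ← hyt j y hyb]
      exact haM y hya
  · rw [intTranslation_apply]
    push_cast
    ext <;> simp

/-- The vertical separation of two orbits on the same levels is, up to a bounded error, an integer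
sequence whose increments over time `k` are at most `2` whenever the target level is not loose. -/
theorem IsTameHeight.exists_int_separation {F : ℝ × ℝ ≃ₜ ℝ × ℝ} {α : ℝ} {C : ℕ}
    (hH : IsTameHeight H) (hF : IsShift H F α C) (hY : HasJoining H δ Y) (hδ : δ < η) (hη : 0 < η)
    (k : ℕ) {z w : ℝ × ℝ} (hz : H z = t) (hw : H w = t) :
    ∃ D : ℕ → ℤ, (∀ i, |(D i : ℝ) - (((F ^ i) z).2 - ((F ^ i) w).2)| ≤ 2 * Y + 2) ∧
      (∀ i, |D (i + k) - D i| ≤ 2 * (C * k) + 2) ∧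
      ∀ i, ¬ IsLoose H (t + (i + k : ℕ) * α) η (C * k) → |D (i + k) - D i| ≤ 2 := by
  choose σ hσ hσ0 using fun i : ℕ => hH.toIsHeight.exists_horizontal_isCut hη (t + i * α)
  have hzi : ∀ i : ℕ, H ((F ^ i) z) = t + i * α := fun i => by rw [(hF.pow i).height, hz]
  have hwi : ∀ i : ℕ, H ((F ^ i) w) = t + i * α := fun i => by rw [(hF.pow i).height, hw]
  have ht : ∀ i : ℕ, t + i * α + k * α = t + (i + k : ℕ) * α := fun i => by push_cast; ring
  have hFk : ∀ (i : ℕ) (x : ℝ × ℝ), (F ^ k) ((F ^ i) x) = (F ^ (i + k)) x := fun i x => by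
    rw [add_comm, pow_add, homeomorph_mul_apply]
  have hcut : ∀ i, IsCut H (t + (i + k : ℕ) * α) η ((F ^ k) '' σ i) := fun i => by
    rw [← ht]; exact (hσ i).image (hF.pow k)
  have hbb : ∀ i, Disjoint (σ i) (intTranslation 0 1 '' σ i) := fun i => by
    rw [disjoint_left]
    rintro x hx ⟨y, hy, rfl⟩
    have h1 := hσ0 i _ hx
    simp [hσ0 i y hy] at h1
  have hM : ∀ i, ∀ x ∈ (F ^ k) '' σ i, |x.2| ≤ C * k := by
    rintro i _ ⟨x, hx, rfl⟩
    have := (hF.pow k).disp x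
    rw [hσ0 i x hx, sub_zero] at this
    linarith
  have key : ∀ (i : ℕ) (j₁ : ℤ) (W : ℕ), (∀ j : ℤ, j < j₁ ∨ j₁ + W < j →
      Disjoint ((F ^ k) '' σ i) (intTranslation 0 j '' σ (i + k))) →
      |(crossCount H (t + (i + k : ℕ) * α) η (σ (i + k)) ((F ^ (i + k)) z) -
        crossCount H (t + (i + k : ℕ) * α) η (σ (i + k)) ((F ^ (i + k)) w)) -
       (crossCount H (t + i * α) η (σ i) ((F ^ i) z) -
        crossCount H (t + i * α) η (σ i) ((F ^ i) w))| ≤ W + 2 := by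
    intro i j₁ W hd
    have := hH.abs_crossCount_sub_sub_le hY hδ (hcut i) (hσ (i + k)) (hbb _) j₁ W hd
      (hzi (i + k)) (hwi (i + k))
    rwa [← ht, ← hFk, ← hFk, crossCount_image (hF.pow k), crossCount_image (hF.pow k), ht, hFk,
      hFk] at this
  refine ⟨fun i => crossCount H (t + i * α) η (σ i) ((F ^ i) z) -
    crossCount H (t + i * α) η (σ i) ((F ^ i) w), fun i => ?_, fun i => ?_, fun i hi => ?_⟩
  · have h1 := hH.abs_crossCount_sub_le hY hδ (hσ i) (hσ0 i) (hzi i)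
    have h2 := hH.abs_crossCount_sub_le hY hδ (hσ i) (hσ0 i) (hwi i)
    rw [abs_le] at *
    push_cast
    constructor <;> linarith
  · refine (key i (-(C * k)) (2 * (C * k)) fun j hj => ?_).trans (by push_cast; rfl)
    rw [disjoint_left]
    rintro x hx ⟨y, hy, rfl⟩
    have h1 := hM i _ hx
    simp only [intTranslation_apply, Prod.snd_add, hσ0 _ y hy, zero_add] at h1
    have h2 : |j| ≤ C * k := by exact_mod_cast h1
    rw [abs_le] at h2
    push_cast at hj
    omega
  · by_cases hex : ∃ j : ℤ, ¬ Disjoint ((F ^ k) '' σ i) (intTranslation 0 j '' σ (i + k))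
    · obtain ⟨j, hj⟩ := hex
      refine (key i j 0 fun j' hj' => ?_).trans (by simp)
      by_contra hcon
      rcases lt_or_gt_of_ne (show j ≠ j' by omega) with h | h
      · exact hi (isLoose_of_meets hη hH.toIsHeight (hcut i) (hσ _) (hM i) (hσ0 _) h hj hcon)
      · exact hi (isLoose_of_meets hη hH.toIsHeight (hcut i) (hσ _) (hM i) (hσ0 _) h hcon hj)
    · push Not at hex
      exact (key i 0 0 fun j _ => hex j).trans (by simp)
end

/-- Near `p` the height stays below `H p + ε`. -/
def IsNearMax (H : ℝ × ℝ → ℝ) (r ε : ℝ) (p : ℝ × ℝ) : Prop :=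
  ∀ q ∈ closedBall p r, H q < H p + ε

/-- Near `p` the height stays above `H p - ε`. -/
def IsNearMin (H : ℝ × ℝ → ℝ) (r ε : ℝ) (p : ℝ × ℝ) : Prop :=
  ∀ q ∈ closedBall p r, H p - ε < H q

theorem exists_isCut_subset_closedBall {H : ℝ × ℝ → ℝ} (hH : Continuous H) {r ε : ℝ} (hε : 0 < ε)
    {p : ℝ × ℝ} (hmax : ¬ IsNearMax H r ε p) (hmin : ¬ IsNearMin H r ε p) :
    ∃ τ ⊆ closedBall p r, IsCut H (H p) ε τ := by
  simp only [IsNearMax, IsNearMin, not_forall, not_lt, exists_prop] at hmax hmin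
  obtain ⟨a, ha, hHa⟩ := hmax
  obtain ⟨b, hb, hHb⟩ := hmin
  obtain ⟨τ, hτ, hcut⟩ := exists_isCut_subset hH (t := H p) hε (κ := AffineMap.lineMap b a)
    AffineMap.lineMap_continuous (by simpa using hHb) (by simpa using hHa)
  refine ⟨τ, hτ.trans ?_, hcut⟩
  rw [← segment_eq_image_lineMap]
  exact (convex_closedBall p r).segment_subset hb ha

/-- In a loose strip, a cut lying far enough on one side of another cut meets that side. -/
theorem IsLoose.exists_mem_side {H : ℝ × ℝ → ℝ} {t η M ε ρ : ℝ} (hK : IsLoose H t η M)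
    (hH : IsTameHeight H) (hηε : η < ε) {a τ : Set (ℝ × ℝ)} (ha : IsCut H t ε a) {x y : ℝ}
    (haρ : ∀ p ∈ a, |p.2 - x| ≤ ρ) (hτρ : ∀ p ∈ τ, |p.2 - y| ≤ ρ) {e : ℤˣ}
    (hxy : 2 * ρ + 2 * M < ((e : ℤ) : ℝ) * (x - y)) : ∃ q ∈ a, q ∈ Side H t ε τ e := by
  obtain ⟨K, hKc, hKb, m, hm, p, hp, hpm⟩ := hK
  have hm' : (1 : ℝ) ≤ m := by exact_mod_cast hm
  have hHK : ∀ (i : ℤ), ∀ q ∈ intTranslation 0 (i * m) '' K, |H q - t| ≤ η ∧ |q.2 - i * m| ≤ M := by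
    rintro i _ ⟨q, hq, rfl⟩
    rw [intTranslation_apply, hH.map_add]
    simpa using hKb q hq
  have hmem : ∀ i : ℤ, p + (0, ((i * m : ℤ) : ℝ)) ∈ intTranslation 0 (i * m) '' K :=
    fun i => ⟨p, hp, by simp⟩
  obtain ⟨q, hqa, i, hqi⟩ : ∃ q ∈ a, ∃ i : ℤ, q ∈ intTranslation 0 (i * m) '' K := by
    by_contra! hcon
    refine ha.false_of_unbounded hH hηε (hKc.biUnion_intTranslation hp hpm (I := univ) ordConnected_univ)
      (fun q hq => ?_) (fun b => ?_) fun b => ?_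
    · obtain ⟨i, -, hq⟩ := mem_iUnion₂.1 hq
      exact ⟨(hHK i q hq).1, fun h => hcon q h i hq⟩
    · obtain ⟨n, hn⟩ := exists_nat_gt (b - p.2)
      refine ⟨_, mem_iUnion₂.2 ⟨n, mem_univ _, hmem n⟩, ?_⟩
      have : (n : ℝ) ≤ n * m := le_mul_of_one_le_right n.cast_nonneg hm'
      simp only [Prod.snd_add]; push_cast; linarith
    · obtain ⟨n, hn⟩ := exists_nat_gt (p.2 - b)
      refine ⟨_, mem_iUnion₂.2 ⟨-n, mem_univ _, hmem (-n)⟩, ?_⟩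
      have : (n : ℝ) ≤ n * m := le_mul_of_one_le_right n.cast_nonneg hm'
      simp only [Prod.snd_add]; push_cast; linarith
  refine ⟨q, hqa, η, hηε, ⋃ k ∈ {k : ℤ | 0 ≤ (e : ℤ) * (k - i)}, intTranslation 0 (k * m) '' K,
    hKc.biUnion_intTranslation hp hpm ?_, mem_iUnion₂.2 ⟨i, by simp, hqi⟩, fun z hz => ?_,
    fun b => ?_⟩
  · refine ⟨fun k hk l hl n hn => ?_⟩
    obtain ⟨h1, h2⟩ := hn
    have hk : 0 ≤ (e : ℤ) * (k - i) := hk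
    have hl : 0 ≤ (e : ℤ) * (l - i) := hl
    change 0 ≤ (e : ℤ) * (n - i)
    rcases Int.units_eq_one_or e with rfl | rfl <;> simp at * <;> omega
  · obtain ⟨k, hk, hz⟩ := mem_iUnion₂.1 hz
    refine ⟨(hHK k z hz).1, fun hzτ => ?_⟩
    have hk : 0 ≤ (e : ℤ) * (k - i) := hk
    have hk' : (0 : ℝ) ≤ ((e : ℤ) : ℝ) * (k - i) * m := by
      have : (0 : ℝ) ≤ ((e : ℤ) : ℝ) * (k - i) := by exact_mod_cast hk
      positivity
    have h1 := abs_le.1 (hHK k z hz).2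
    have h2 := abs_le.1 (hHK i q hqi).2
    have h3 := abs_le.1 (haρ q hqa)
    have h4 := abs_le.1 (hτρ z hzτ)
    rcases Int.units_eq_one_or e with rfl | rfl <;> simp at hk' hxy <;> linarith
  · obtain ⟨n, hn⟩ := exists_nat_gt (|b| + |p.2| + |(i : ℝ) * m|)
    refine ⟨_, mem_iUnion₂.2 ⟨i + e * n, ?_, hmem (i + e * n)⟩, ?_⟩
    · change 0 ≤ (e : ℤ) * (i + e * n - i)
      rcases Int.units_eq_one_or e with rfl | rfl <;> simp
    · have h0 : (n : ℝ) ≤ n * m := le_mul_of_one_le_right n.cast_nonneg hm'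
      have h1 := le_abs_self b
      have h2 := abs_le.1 (le_refl |p.2|)
      have h3 := abs_le.1 (le_refl |(i : ℝ) * m|)
      simp only [Prod.snd_add]; push_cast
      rcases Int.units_eq_one_or e with rfl | rfl <;> simp <;> linarith

/-- If a strip and its image are both loose, then the vertical displacements of two points of the
mid-level, near which the height oscillates, differ by a bounded amount. -/
theorem IsLoose.displacement_sub_le {H : ℝ × ℝ → ℝ} {t η M r β B : ℝ} (hK : IsLoose H t η M)
    {G : ℝ × ℝ ≃ₜ ℝ × ℝ} (hK' : IsLoose H (t + β) η M) (hH : IsTameHeight H) (hG : IsShift H G β B)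
    (hη : 0 < η) (hM : 0 ≤ M) (hr : r ≤ 1)
    (hGr : ∀ p q, dist p q ≤ r → |(G p).2 - p.2 - ((G q).2 - q.2)| ≤ 1)
    {z w : ℝ × ℝ} (hz : H z = t) (hw : H w = t)
    (hz1 : ¬ IsNearMax H r (2 * η) z) (hz2 : ¬ IsNearMin H r (2 * η) z)
    (hw1 : ¬ IsNearMax H r (2 * η) w) (hw2 : ¬ IsNearMin H r (2 * η) w) :
    (G z).2 - z.2 - ((G w).2 - w.2) ≤ 4 * M + 10 := by
  by_contra! hcon
  obtain ⟨ζ, hζr, hζ⟩ := exists_isCut_subset_closedBall hH.continuous (by positivity) hz1 hz2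
  obtain ⟨ω, hωr, hω⟩ := exists_isCut_subset_closedBall hH.continuous (by positivity) hw1 hw2
  rw [hz] at hζ
  rw [hw] at hω
  have hball : ∀ p q : ℝ × ℝ, q ∈ closedBall p r → |q.2 - p.2| ≤ 1 ∧ |(G q).2 - (G p).2| ≤ 2 := by
    intro p q hq
    have h1 : |q.2 - p.2| ≤ 1 := by
      rw [← Real.dist_eq]
      exact ((le_max_right _ _).trans (mem_closedBall.1 hq)).trans hr
    refine ⟨h1, ?_⟩
    have h2 := abs_le.1 (hGr q p hq)
    have h1 := abs_le.1 h1
    rw [abs_le]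
    constructor <;> linarith
  set j : ℤ := ⌊z.2 - w.2 + 2 * M + 2⌋ + 1 with hj
  have hj1 : z.2 - w.2 + 2 * M + 2 < j := by rw [hj]; push_cast; exact Int.lt_floor_add_one _
  have hj2 : (j : ℝ) ≤ z.2 - w.2 + 2 * M + 3 := by
    rw [hj]; push_cast; linarith [Int.floor_le (z.2 - w.2 + 2 * M + 2)]
  have ha := hω.intTranslation_image hH.toIsHeight j
  have hay : ∀ p ∈ intTranslation 0 j '' ω, |p.2 - (w.2 + j)| ≤ 1 := by
    rintro _ ⟨p, hp, rfl⟩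
    simpa using (hball w p (hωr hp)).1
  have hζy : ∀ p ∈ ζ, |p.2 - z.2| ≤ 1 := fun p hp => (hball z p (hζr hp)).1
  obtain ⟨q, hqa, hq⟩ := hK.exists_mem_side hH (by linarith : η < 2 * η) ha hay hζy (e := 1)
    (by simp only [Units.val_one, Int.cast_one, one_mul]; linarith)
  have hd : Disjoint (intTranslation 0 j '' ω) ζ := by
    rw [disjoint_left]
    intro p hp hp'
    have h1 := abs_le.1 (hay p hp)
    have h2 := abs_le.1 (hζy p hp')
    linarith
  obtain ⟨_, ⟨q', hqa', rfl⟩, hq'⟩ := hK'.exists_mem_side hH (by linarith : η < 2 * η) (ha.image hG)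
    (x := (G w).2 + j) (y := (G z).2) (τ := G '' ζ) (ρ := 2) (e := -1) (by
      rintro _ ⟨_, ⟨p, hp, rfl⟩, rfl⟩
      rw [intTranslation_apply, hG.map_add]
      simpa using (hball w p (hωr hp)).2) (by
      rintro _ ⟨p, hp, rfl⟩
      exact (hball z p (hζr hp)).2) (by
      simp only [Units.val_neg, Units.val_one, Int.cast_neg, Int.cast_one]; linarith)
  rw [Side.map_iff hG] at hq'
  exact Side.disjoint hH hζ (Side.of_mem_isCut hH ha hd hqa hq hqa' (Side.abs_lt hq')) hq'

theorem Finset.card_filter_range_le {P : ℕ → Prop} [DecidablePred P] {J N : ℕ} (hJ : 0 < J)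
    (h : ∀ a, ((Finset.Ico a (a + J)).filter P).card ≤ N) (K : ℕ) :
    ((Finset.range K).filter P).card ≤ (K / J + 1) * N := by
  have hsub : (Finset.range K).filter P ⊆
      (Finset.range (K / J + 1)).biUnion fun b => (Finset.Ico (b * J) (b * J + J)).filter P := by
    intro i hi
    rw [Finset.mem_filter, Finset.mem_range] at hi
    rw [Finset.mem_biUnion]
    refine ⟨i / J, Finset.mem_range.2 (Nat.lt_succ_of_le (Nat.div_le_div_right hi.1.le)),
      Finset.mem_filter.2 ⟨Finset.mem_Ico.2 ⟨Nat.div_mul_le_self i J, ?_⟩, hi.2⟩⟩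
    have := Nat.lt_div_mul_add (a := i) hJ
    omega
  refine (Finset.card_le_card hsub).trans ((Finset.card_biUnion_le_card_mul _ _ N fun b _ => h _).trans ?_)
  rw [Finset.card_range]

theorem Irrational.exists_forall_lt_abs_mul_add {α : ℝ} (hα : Irrational α) (J : ℕ) :
    ∃ ε > 0, ∀ j : ℕ, 0 < j → j ≤ J → ∀ m : ℤ, ε ≤ |j * α + m| := by
  induction J with
  | zero => exact ⟨1, one_pos, fun j h1 h2 => by omega⟩
  | succ J ih =>
    obtain ⟨ε, hε, h⟩ := ih
    have hirr : Irrational (((J + 1 : ℕ) : ℝ) * α) := by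
      rw [mul_comm]
      exact hα.mul_natCast (by omega)
    set x := ((J + 1 : ℕ) : ℝ) * α with hx
    have hpos : 0 < |x - round x| := abs_pos.2 (sub_ne_zero.2 (hirr.ne_int _))
    refine ⟨min ε |x - round x|, lt_min hε hpos, fun j h1 h2 m => ?_⟩
    rcases Nat.lt_or_eq_of_le h2 with h2 | rfl
    · exact (min_le_left _ _).trans (h j h1 (by omega) m)
    · refine (min_le_right _ _).trans ((round_le x (-m)).trans_eq ?_)
      rw [Int.cast_neg, sub_neg_eq_add]

/-- An orbit is rarely at a point near which the height does not oscillate. -/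
theorem IsShift.card_filter_near_le {H : ℝ × ℝ → ℝ} {F : ℝ × ℝ ≃ₜ ℝ × ℝ} {α C : ℝ}
    (hH : IsHeight H) (hF : IsShift H F α C) (hα : Irrational α) {r θ : ℝ} (hr : 0 < r)
    (hθ : 0 < θ) : ∃ ε > 0, ∃ A : ℝ, ∀ (p : ℝ × ℝ) (K : ℕ) (P : ℕ → Prop) [DecidablePred P],
      (∀ i, P i → IsNearMax H r ε ((F ^ i) p) ∨ IsNearMin H r ε ((F ^ i) p)) →
      (((Finset.range K).filter P).card : ℝ) ≤ θ * K + A := by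
  classical
  obtain ⟨N, hN⟩ := exists_card_forall_exists_dist_add_int_lt hr
  obtain ⟨J, hJ⟩ := exists_nat_gt (2 * N / θ)
  have hJ0 : (0 : ℝ) < J := lt_of_le_of_lt (by positivity) hJ
  have hJ0' : 0 < J := by exact_mod_cast hJ0
  obtain ⟨ε, hε, hεJ⟩ := hα.exists_forall_lt_abs_mul_add J
  have key : ∀ (p : ℝ × ℝ) (Q : ℝ × ℝ → Prop), (∀ (x y : ℝ × ℝ) (m n : ℤ), Q x → Q y →
      dist x (y + ((m : ℝ), (n : ℝ))) < r → |H y + m - H x| < ε) → ∀ K : ℕ,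
      ((Finset.range K).filter fun i => Q ((F ^ i) p)).card ≤ (K / J + 1) * N := by
    refine fun p Q hQ => Finset.card_filter_range_le hJ0' fun a => ?_
    by_contra! hcard
    obtain ⟨i, hi, j, hj, hij, m, n, hd⟩ := hN _ (fun i => (F ^ i) p) hcard
    rw [Finset.mem_filter, Finset.mem_Ico] at hi hj
    have h1 := hQ _ _ m n hi.2 hj.2 hd
    rw [(hF.pow i).height, (hF.pow j).height] at h1
    refine (hεJ (j - i) (by omega) (by omega) m).not_gt ?_
    rw [Nat.cast_sub hij.le]
    rwa [show H p + j * α + m - (H p + i * α) = (j - i) * α + m by ring] at h1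
  have hball : ∀ (x y : ℝ × ℝ) (m n : ℤ), dist x (y + ((m : ℝ), (n : ℝ))) < r →
      y + ((m : ℝ), (n : ℝ)) ∈ closedBall x r ∧ x + (((-m : ℤ) : ℝ), ((-n : ℤ) : ℝ)) ∈ closedBall y r := by
    intro x y m n h
    refine ⟨by rw [mem_closedBall, dist_comm]; exact h.le, ?_⟩
    have hx : x + (((-m : ℤ) : ℝ), ((-n : ℤ) : ℝ)) + ((m : ℝ), (n : ℝ)) = x := by ext <;> simp
    rw [mem_closedBall, ← dist_add_right _ _ ((m : ℝ), (n : ℝ)), hx]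
    exact h.le
  refine ⟨ε, hε, 2 * N, fun p K P _ hP => ?_⟩
  have h1 := key p (IsNearMax H r ε) (fun x y m n hx hy hd => by
    obtain ⟨ha, hb⟩ := hball x y m n hd
    have h1 := hx _ ha
    have h2 := hy _ hb
    rw [hH.map_add] at h1 h2
    push_cast at h2
    rw [abs_lt]
    constructor <;> linarith) K
  have h2 := key p (IsNearMin H r ε) (fun x y m n hx hy hd => by
    obtain ⟨ha, hb⟩ := hball x y m n hd
    have h1 := hx _ ha
    have h2 := hy _ hb
    rw [hH.map_add] at h1 h2
    push_cast at h2
    rw [abs_lt]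
    constructor <;> linarith) K
  have h3 : ((Finset.range K).filter P).card ≤ (K / J + 1) * N + (K / J + 1) * N := by
    refine le_trans (Finset.card_le_card fun i hi => ?_) ((Finset.card_union_le _ _).trans (add_le_add h1 h2))
    simp only [Finset.mem_filter, Finset.mem_union] at hi ⊢
    exact (hP i hi.2).imp (fun h => ⟨hi.1, h⟩) fun h => ⟨hi.1, h⟩
  have h4 : ((K / J : ℕ) : ℝ) ≤ K / J := Nat.cast_div_le
  have h5 : 2 * N / J ≤ θ := by
    rw [div_le_iff₀ hJ0]
    rw [div_lt_iff₀ hθ] at hJ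
    linarith
  calc (((Finset.range K).filter P).card : ℝ) ≤ ((K / J + 1) * N + (K / J + 1) * N : ℕ) := by
        exact_mod_cast h3
    _ = ((K / J : ℕ) : ℝ) * (2 * N) + 2 * N := by push_cast; ring
    _ ≤ (K / J : ℝ) * (2 * N) + 2 * N := by gcongr
    _ = (2 * N / J) * K + 2 * N := by ring
    _ ≤ θ * K + 2 * N := by gcongr

theorem le_sum_range_shift_sub {u v : ℕ → ℝ} {c A : ℝ} (huv : ∀ i, |u i - v i| ≤ A)
    (hv : ∀ i j, |v (i + j) - v i| ≤ j * c) (hc : 0 ≤ c) (K n : ℕ) :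
    n * (v K - v 0 - 2 * c * n - 2 * A) ≤ ∑ i ∈ Finset.range K, (u (i + n) - u i) := by
  have h : ∑ i ∈ Finset.range K, (u (i + n) - u i) = ∑ i ∈ Finset.range n, (u (K + i) - u i) := by
    have h1 := Finset.sum_range_add u n K
    have h2 := Finset.sum_range_add u K n
    rw [add_comm n K, h2] at h1
    simp only [Finset.sum_sub_distrib, add_comm _ n]
    linarith
  rw [h, ← nsmul_eq_mul]
  nth_rw 1 [← Finset.card_range n]
  refine Finset.card_nsmul_le_sum _ _ _ fun i hi => ?_
  have hin : (i : ℝ) * c ≤ n * c := by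
    have : (i : ℝ) ≤ n := by exact_mod_cast (Finset.mem_range.1 hi).le
    gcongr
  have h1 := abs_le.1 (huv (K + i))
  have h2 := abs_le.1 (huv i)
  have h3 := abs_le.1 (hv K i)
  have h4 := abs_le.1 (hv 0 i)
  rw [zero_add] at h4
  linarith

theorem sum_range_le_of_forall_ite {u : ℕ → ℝ} {P : ℕ → Prop} [DecidablePred P] {a b : ℝ} {K : ℕ}
    (h : ∀ i, P i → u i ≤ a + b) (h' : ∀ i, ¬ P i → u i ≤ a) :
    ∑ i ∈ Finset.range K, u i ≤ K * a + b * ((Finset.range K).filter P).card := by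
  calc ∑ i ∈ Finset.range K, u i ≤ ∑ i ∈ Finset.range K, (a + if P i then b else 0) := by
        refine Finset.sum_le_sum fun i _ => ?_
        split_ifs with hi
        · exact h i hi
        · simpa using h' i hi
    _ = K * a + b * ((Finset.range K).filter P).card := by
        rw [Finset.sum_add_distrib, Finset.sum_const, Finset.card_range, nsmul_eq_mul,
          ← Finset.sum_filter, Finset.sum_const, nsmul_eq_mul, mul_comm b]

theorem card_mul_le_of_forall_add_notMem {s : Finset ℕ} {K L N : ℕ} (hs : s ⊆ Finset.range K)
    (h : ∀ i ∈ s, ∀ l, 1 ≤ l → l ≤ L → i + l * N ∉ s) : (L + 1) * s.card ≤ K + L * N := by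
  rw [← Finset.card_range (L + 1), ← Finset.card_product, ← Finset.card_range (K + L * N)]
  refine Finset.card_le_card_of_injOn (fun x => x.2 + x.1 * N) (fun x hx => ?_) ?_
  · simp only [Finset.coe_product, mem_prod, Finset.mem_coe, Finset.mem_range] at hx ⊢
    have h1 := Finset.mem_range.1 (hs hx.2)
    have h2 : x.1 * N ≤ L * N := Nat.mul_le_mul_right _ (by omega)
    omega
  · have key : ∀ l l' i i', l' ≤ L → i ∈ s → i' ∈ s → l < l' → i + l * N ≠ i' + l' * N := by
      intro l l' i i' hl' hi hi' hll heq
      refine h i' hi' (l' - l) (by omega) (by omega) ?_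
      have : l' * N = (l' - l) * N + l * N := by rw [← add_mul, Nat.sub_add_cancel hll.le]
      rwa [show i' + (l' - l) * N = i by omega]
    rintro ⟨l, i⟩ hx ⟨l', i'⟩ hx' heq
    simp only [Finset.coe_product, mem_prod, Finset.mem_coe, Finset.mem_range] at hx hx' heq
    rcases lt_trichotomy l l' with hl | rfl | hl
    · exact (key l l' i i' (by omega) hx.2 hx'.2 hl heq).elim
    · rw [Prod.mk.injEq]; exact ⟨rfl, by omega⟩
    · exact (key l' l i' i (by omega) hx'.2 hx.2 hl heq.symm).elim

theorem card_filter_range_add_le (P : ℕ → Prop) [DecidablePred P] (K k : ℕ) :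
    ((Finset.range K).filter fun i => P (i + k)).card ≤ ((Finset.range K).filter P).card + k := by
  have h1 : ((Finset.range K).filter fun i => P (i + k)).card ≤
      ((Finset.range (K + k)).filter P).card := by
    refine Finset.card_le_card_of_injOn (· + k) (fun i hi => ?_) (add_left_injective k).injOn
    simp only [Finset.coe_filter, Finset.mem_range, mem_ofPred_eq] at hi ⊢
    exact ⟨by omega, hi.2⟩
  refine h1.trans ?_
  rw [Finset.range_add_eq_union, Finset.filter_union]
  refine (Finset.card_union_le _ _).trans (Nat.add_le_add_left ((Finset.card_filter_le _ _).trans ?_) _)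
  simp

section
variable {H : ℝ × ℝ → ℝ} {F : ℝ × ℝ ≃ₜ ℝ × ℝ} {α : ℝ}

/-- The difference of the vertical displacements of `z` and `w` under `G`. -/
def dispSub (G : ℝ × ℝ ≃ₜ ℝ × ℝ) (z w : ℝ × ℝ) : ℝ := (G z).2 - z.2 - ((G w).2 - w.2)

theorem IsShift.abs_dispSub_le {G : ℝ × ℝ ≃ₜ ℝ × ℝ} {β B : ℝ} (hG : IsShift H G β B)
    (z w : ℝ × ℝ) : |dispSub G z w| ≤ 2 * B := by
  have h1 := abs_le.1 (hG.disp z)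
  have h2 := abs_le.1 (hG.disp w)
  rw [dispSub, abs_le]
  constructor <;> linarith

theorem dispSub_mul (G G' : ℝ × ℝ ≃ₜ ℝ × ℝ) (z w : ℝ × ℝ) :
    dispSub (G * G') z w = dispSub G' z w + dispSub G (G' z) (G' w) := by
  simp only [dispSub, homeomorph_mul_apply]
  ring

theorem dispSub_pow_apply (i n : ℕ) (z w : ℝ × ℝ) :
    dispSub (F ^ n) ((F ^ i) z) ((F ^ i) w) =
      ((F ^ (i + n)) z).2 - ((F ^ (i + n)) w).2 - (((F ^ i) z).2 - ((F ^ i) w).2) := by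
  rw [dispSub, add_comm i n, pow_add, homeomorph_mul_apply, homeomorph_mul_apply]
  ring

theorem abs_orbit_sub_le {C : ℝ} (hF : IsShift H F α C) (z w : ℝ × ℝ) (i j : ℕ) :
    |((F ^ (i + j)) z).2 - ((F ^ (i + j)) w).2 - (((F ^ i) z).2 - ((F ^ i) w).2)| ≤ j * (2 * C) := by
  rw [← dispSub_pow_apply]
  refine ((hF.pow j).abs_dispSub_le _ _).trans_eq (by ring)

/-- If two orbits on the same levels separate at a linear rate, then many levels are loose. -/
theorem IsTameHeight.le_card_isLoose {C : ℕ} {t δ η Y : ℝ}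
    (hH : IsTameHeight H) (hF : IsShift H F α C) (hY : HasJoining H δ Y) (hδ : δ < η) (hη : 0 < η)
    (k : ℕ) {z w : ℝ × ℝ} (hz : H z = t) (hw : H w = t) (K : ℕ) (P : ℕ → Prop) [DecidablePred P]
    (hP : ∀ i : ℕ, IsLoose H (t + i * α) η (C * k) → P i) :
    k * (dispSub (F ^ K) z w - 4 * C * k - 4 * Y - 4) ≤
      2 * K + 2 * C * k * (((Finset.range K).filter P).card + k) := by
  obtain ⟨D, hD, hDk, hDl⟩ := hH.exists_int_separation hF hY hδ hη k hz hw
  have h1 := le_sum_range_shift_sub (u := fun i => (D i : ℝ)) hD (abs_orbit_sub_le hF z w)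
    (by positivity) K k
  have h2 := sum_range_le_of_forall_ite (u := fun i => (D (i + k) : ℝ) - D i)
    (P := fun i => P (i + k)) (a := 2) (b := 2 * (C * k)) (K := K)
    (fun i _ => by
      have := (abs_le.1 (hDk i)).2
      have : ((D (i + k) - D i : ℤ) : ℝ) ≤ ((2 * (C * k) + 2 : ℤ) : ℝ) := by exact_mod_cast this
      push_cast at this; linarith)
    (fun i hi => by
      have := (abs_le.1 (hDl i fun h => hi (hP _ h))).2
      have : ((D (i + k) - D i : ℤ) : ℝ) ≤ ((2 : ℤ) : ℝ) := by exact_mod_cast this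
      push_cast at this; linarith)
  have h3 : (((Finset.range K).filter fun i => P (i + k)).card : ℝ) ≤
      ((Finset.range K).filter P).card + k := by exact_mod_cast card_filter_range_add_le P K k
  have h4 : 2 * ((C : ℝ) * k) * ((Finset.range K).filter fun i => P (i + k)).card ≤
      2 * (C * k) * (((Finset.range K).filter P).card + k) := by gcongr
  have h5 : dispSub (F ^ K) z w = ((F ^ K) z).2 - ((F ^ K) w).2 - (((F ^ 0) z).2 - ((F ^ 0) w).2) := by
    simp only [dispSub, pow_zero, Homeomorph.one_apply]; ring
  rw [h5]
  refine le_trans (le_of_eq ?_) ((h1.trans h2).trans (le_trans (add_le_add_right h4 _) (le_of_eq ?_))) <;> ring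

/-- If two orbits separate at nearly the maximal rate, then during most time intervals of length
`n` they separate at least at half this rate. -/
theorem IsShift.card_filter_dispSub_lt_le {C Δ e : ℝ} (hF : IsShift H F α C) (hC : 0 ≤ C) {n : ℕ}
    (he : 0 ≤ e) (hn : 0 < n)
    {z w : ℝ × ℝ} (hzw : H z = H w) (hsup : ∀ p q, H p = H q → dispSub (F ^ n) p q ≤ n * (Δ + e))
    {K : ℕ} (hK : K * (Δ - e) ≤ dispSub (F ^ K) z w) (P : ℕ → Prop) [DecidablePred P]
    (hP : ∀ i, P i → dispSub (F ^ n) ((F ^ i) z) ((F ^ i) w) < n * (Δ / 2)) :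
    Δ / 2 * ((Finset.range K).filter P).card ≤ 2 * e * K + 4 * C * n := by
  set v : ℕ → ℝ := fun i => ((F ^ i) z).2 - ((F ^ i) w).2 with hv
  have h1 := le_sum_range_shift_sub (u := v) (v := v) (A := 0) (by simp) (abs_orbit_sub_le hF z w)
    (by positivity) K n
  have hd : ∀ i, v (i + n) - v i = dispSub (F ^ n) ((F ^ i) z) ((F ^ i) w) := fun i =>
    (dispSub_pow_apply i n z w).symm
  have hn0 : (0 : ℝ) < n := by exact_mod_cast hn
  have h2 := sum_range_le_of_forall_ite (u := fun i => v (i + n) - v i)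
    (P := P) (a := n * (Δ + e)) (b := - (n * (Δ / 2))) (K := K)
    (fun i hi => by
      rw [hd]
      have : (0 : ℝ) ≤ n * e := by positivity
      linarith [hP i hi])
    (fun i _ => by
      rw [hd]
      refine hsup _ _ ?_
      rw [(hF.pow i).height, (hF.pow i).height, hzw])
  have h5 : dispSub (F ^ K) z w = v K - v 0 := by
    simp only [dispSub, hv, pow_zero, Homeomorph.one_apply]; ring
  rw [h5] at hK
  have h3 : (n : ℝ) * (K * (Δ - e)) ≤ n * (v K - v 0) := by gcongr
  have h4 := h1.trans h2
  have h6 : (n : ℝ) * (Δ / 2 * ((Finset.range K).filter P).card) ≤ n * (2 * e * K + 4 * C * n) := by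
    nlinarith
  exact le_of_mul_le_mul_left h6 hn0

end

section
variable {H : ℝ × ℝ → ℝ} {F : ℝ × ℝ ≃ₜ ℝ × ℝ} {α : ℝ}

theorem IsShift.exists_radius {C : ℝ} (hF : IsShift H F α C) (m : ℕ) : ∃ r > 0, r ≤ 1 ∧
    ∀ n ≤ m, ∀ p q, dist p q ≤ r →
      |((F ^ n) p).2 - p.2 - (((F ^ n) q).2 - q.2)| ≤ 1 := by
  have h1 : ∀ n : ℕ, ∃ r > 0, ∀ p q, dist p q ≤ r →
      |((F ^ n) p).2 - p.2 - (((F ^ n) q).2 - q.2)| ≤ 1 := by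
    intro n
    obtain ⟨r, hr, h⟩ := Metric.uniformContinuous_iff.1
      ((hF.pow n).periodic.uniformContinuous (by fun_prop)) 1 one_pos
    refine ⟨r / 2, by positivity, fun p q hpq => ?_⟩
    have := h (lt_of_le_of_lt hpq (by linarith))
    rw [Real.dist_eq] at this
    exact this.le
  induction m with
  | zero =>
    obtain ⟨r, hr, h⟩ := h1 0
    refine ⟨min r 1, lt_min hr one_pos, min_le_right _ _, fun n hn p q hpq => ?_⟩
    obtain rfl : n = 0 := by omega
    exact h p q (hpq.trans (min_le_left _ _))
  | succ m ih =>
    obtain ⟨r, hr, hr1, h⟩ := ih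
    obtain ⟨s, hs, h'⟩ := h1 (m + 1)
    refine ⟨min r s, lt_min hr hs, (min_le_left _ _).trans hr1, fun n hn p q hpq => ?_⟩
    rcases Nat.lt_or_eq_of_le hn with hn | rfl
    · exact h n (by omega) p q (hpq.trans (min_le_left _ _))
    · exact h' p q (hpq.trans (min_le_right _ _))

theorem IsShift.false_of_linear_separation {C : ℕ} (hH : IsHeight H) (hF : IsShift H F α C)
    (hα : Irrational α) (hC : 1 ≤ C) {Δ : ℝ} (hΔ : 0 < Δ)
    (hsup : ∀ e > 0, ∃ N : ℕ, ∀ n ≥ N, ∀ p q, H p = H q → dispSub (F ^ n) p q ≤ n * (Δ + e))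
    (hinf : ∀ e > 0, ∀ K : ℕ, 1 ≤ K → ∃ p q, H p = H q ∧ K * (Δ - e) ≤ dispSub (F ^ K) p q) :
    False := by
  classical
  have hT := hF.isTameHeight hH hα
  have hC' : (1 : ℝ) ≤ C := by exact_mod_cast hC
  obtain ⟨k, hk⟩ := exists_nat_gt (8 / Δ)
  have hk' : 8 < k * Δ := (div_lt_iff₀ hΔ).1 hk
  have hk0 : (0 : ℝ) < k := lt_trans (by positivity) hk
  set M : ℝ := C * k with hM
  set θ : ℝ := Δ / (8 * C) with hθ
  have hθ0 : 0 < θ := by positivity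
  obtain ⟨L, hL⟩ := exists_nat_gt (4 / θ)
  have hL' : 4 < L * θ := (div_lt_iff₀ hθ0).1 hL
  set e : ℝ := min (Δ / 2) (θ * Δ / (32 * (L + 1))) with he
  have he0 : 0 < e := by positivity
  have he1 : e ≤ Δ / 2 := min_le_left _ _
  have he2 : 32 * (L + 1) * e ≤ θ * Δ := by
    have := min_le_right (Δ / 2) (θ * Δ / (32 * (L + 1)))
    rw [← he, le_div_iff₀ (by positivity)] at this
    linarith
  obtain ⟨N₀, hN₀⟩ := hsup e he0
  obtain ⟨N₁, hN₁⟩ := exists_nat_gt ((4 * M + 10) / (Δ / 2))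
  set N : ℕ := max N₀ (N₁ + 1) with hN
  have hN1 : 1 ≤ N := le_trans (by omega) (le_max_right _ _)
  have hNΔ : 4 * M + 10 < N * (Δ / 2) := by
    rw [div_lt_iff₀ (by positivity)] at hN₁
    have : (N₁ : ℝ) ≤ N := by exact_mod_cast le_trans (by omega) (le_max_right N₀ (N₁ + 1))
    nlinarith
  obtain ⟨r, hr, hr1, hrF⟩ := hF.exists_radius (L * N)
  obtain ⟨ε, hε, A, hA⟩ := hF.card_filter_near_le hH hα hr (by positivity : 0 < θ / 16)
  set η : ℝ := ε / 2 with hη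
  have hη0 : 0 < η := by positivity
  obtain ⟨Y, hY⟩ := hT.exists_uniform_joining (η := η / 2) (by positivity)
  replace hY : HasJoining H (η / 2) Y := hY
  set B₁ : ℝ := (4 * C * k + 4 * Y + 4) / (2 * C) + k with hB₁
  set B₂ : ℝ := 2 * A + L * (8 * C * (L * N) / Δ) with hB₂
  obtain ⟨K, hK⟩ := exists_nat_gt (max 1 (L * N + (L + 1) * (B₁ + B₂)))
  have hK1 : 1 ≤ K := by exact_mod_cast ((le_max_left _ _).trans hK.le)
  have hK2 : L * N + (L + 1) * (B₁ + B₂) < K := (le_max_right _ _).trans_lt hK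
  obtain ⟨z, w, hzw, hlow⟩ := hinf e he0 K hK1
  set t := H z with ht
  set loose : ℕ → Prop := fun i => IsLoose H (t + i * α) η M with hloose
  set near : ℝ × ℝ → ℕ → Prop := fun p i =>
    IsNearMax H r ε ((F ^ i) p) ∨ IsNearMin H r ε ((F ^ i) p) with hnear
  set slow : ℕ → ℕ → Prop := fun l i =>
    dispSub (F ^ (l * N)) ((F ^ i) z) ((F ^ i) w) < (l * N : ℕ) * (Δ / 2) with hslow
  have hbad : θ * K - B₁ ≤ ((Finset.range K).filter loose).card := by
    have h := hT.le_card_isLoose hF hY (by linarith) hη0 k ht.symm hzw.symm K loose fun i hi => hi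
    set b : ℝ := (((Finset.range K).filter loose).card : ℝ)
    have h1 : (K : ℝ) * (Δ / 2) ≤ dispSub (F ^ K) z w := le_trans (by gcongr; linarith) hlow
    have h2 : (k : ℝ) * (K * (Δ / 4) - (4 * C * k + 4 * Y + 4)) ≤ k * (2 * C * (b + k)) := by
      have h3 : (k : ℝ) * (K * (Δ / 2)) ≤ k * dispSub (F ^ K) z w := by gcongr
      have h4 : 8 * (K : ℝ) ≤ k * Δ * K := by gcongr
      linarith
    have h3 := le_of_mul_le_mul_left h2 hk0
    have h4 : (K * (Δ / 4) - (4 * C * k + 4 * Y + 4)) / (2 * C) ≤ b + k := by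
      rw [div_le_iff₀ (by positivity)]
      linarith
    have h5 : K * (Δ / 4) / (2 * C) = θ * K := by
      rw [hθ]; field_simp; norm_num
    rw [sub_div, h5] at h4
    linarith
  have hnearz := hA z K (near z) fun i hi => hi
  have hnearw := hA w K (near w) fun i hi => hi
  have hslowl : ∀ l ∈ Finset.Icc 1 L, (((Finset.range K).filter (slow l)).card : ℝ) ≤
      θ / (8 * (L + 1)) * K + 8 * C * (L * N) / Δ := by
    intro l hl
    rw [Finset.mem_Icc] at hl
    have hlN : N ≤ l * N := Nat.le_mul_of_pos_left N (by omega)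
    have h := hF.card_filter_dispSub_lt_le (by positivity) he0.le (n := l * N) (by omega) hzw
      (hN₀ _ ((le_max_left _ _).trans hlN)) hlow (slow l) fun i hi => hi
    set c : ℝ := (((Finset.range K).filter (slow l)).card : ℝ)
    have h1 : Δ / 2 * (θ / (8 * (L + 1)) * K + 8 * C * (L * N) / Δ) =
        θ * Δ / (16 * (L + 1)) * K + 4 * C * (L * N) := by field_simp; ring
    have h2 : 2 * e ≤ θ * Δ / (16 * (L + 1)) := by
      rw [le_div_iff₀ (by positivity)]
      linarith
    have h3 : (((l * N : ℕ) : ℝ)) ≤ L * N := by exact_mod_cast Nat.mul_le_mul_right N hl.2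
    refine le_of_mul_le_mul_left (h.trans ?_) (by positivity : 0 < Δ / 2)
    rw [h1]
    gcongr
  set good : ℕ → Prop := fun i =>
    loose i ∧ ¬ near z i ∧ ¬ near w i ∧ ∀ l ∈ Finset.Icc 1 L, ¬ slow l i with hgood
  set s := (Finset.range K).filter good with hs
  have hcover : (((Finset.range K).filter loose).card : ℝ) ≤ s.card + ((Finset.range K).filter (near z)).card
      + ((Finset.range K).filter (near w)).card
      + ∑ l ∈ Finset.Icc 1 L, (((Finset.range K).filter (slow l)).card : ℝ) := by
    have hsub : (Finset.range K).filter loose ⊆ s ∪ (Finset.range K).filter (near z) ∪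
        (Finset.range K).filter (near w) ∪
        (Finset.Icc 1 L).biUnion fun l => (Finset.range K).filter (slow l) := by
      intro i hi
      simp only [hs, hgood, Finset.mem_filter, Finset.mem_union, Finset.mem_biUnion] at hi ⊢
      by_cases h1 : near z i
      · tauto
      by_cases h2 : near w i
      · tauto
      by_cases h3 : ∃ l ∈ Finset.Icc 1 L, slow l i
      · obtain ⟨l, hl, h3⟩ := h3
        exact Or.inr ⟨l, hl, hi.1, h3⟩
      · push Not at h3
        exact Or.inl (Or.inl (Or.inl ⟨hi.1, hi.2, h1, h2, h3⟩))
    have h := (Finset.card_le_card hsub).trans <| (Finset.card_union_le _ _).trans <|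
      add_le_add ((Finset.card_union_le _ _).trans (Nat.add_le_add_right (Finset.card_union_le _ _) _))
        Finset.card_biUnion_le
    exact_mod_cast h
  have hscard : (L + 1) * s.card ≤ K + L * N := by
    refine card_mul_le_of_forall_add_notMem (Finset.filter_subset _ _) fun i hi l hl1 hlL hil => ?_
    rw [hs, Finset.mem_filter] at hi hil
    obtain ⟨-, hi1, hi2, hi3, hi4⟩ := hi
    obtain ⟨-, hil1, -⟩ := hil
    have h1 := hi4 l (Finset.mem_Icc.2 ⟨hl1, hlL⟩)
    simp only [hnear, not_or] at hi2 hi3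
    have hε2 : ε = 2 * η := by rw [hη]; ring
    rw [hε2] at hi2 hi3
    have h2 := IsLoose.displacement_sub_le (G := F ^ (l * N)) (β := (l * N : ℕ) * α) hi1 (by
      convert hil1 using 1; push_cast; ring) hT (hF.pow _) hη0 (by positivity) hr1
      (hrF _ (Nat.mul_le_mul_right _ hlL)) (by rw [(hF.pow i).height])
      (by rw [(hF.pow i).height, hzw]) hi2.1 hi2.2 hi3.1 hi3.2
    refine h1 (lt_of_le_of_lt h2 (hNΔ.trans_le ?_))
    gcongr
    exact Nat.le_mul_of_pos_left N (by omega)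
  have hsum := Finset.sum_le_sum hslowl
  rw [Finset.sum_const, Nat.card_Icc, nsmul_eq_mul, Nat.add_sub_cancel] at hsum
  have h1 : (L : ℝ) * (θ / (8 * (L + 1)) * K) ≤ θ / 8 * K := by
    have : (L : ℝ) * (θ / (8 * (L + 1))) ≤ θ / 8 := by
      rw [← mul_div_assoc, div_le_iff₀ (by positivity)]
      linarith
    rw [← mul_assoc]
    gcongr
  have h2 : θ / 2 * K - (B₁ + B₂) ≤ s.card := by
    have : 0 ≤ θ * K := by positivity
    linarith
  have h3 : ((L : ℝ) + 1) * s.card ≤ K + L * N := by exact_mod_cast hscard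
  have h4 : ((L : ℝ) + 1) * (θ / 2 * K - (B₁ + B₂)) ≤ (L + 1) * s.card := by gcongr
  have h5 : 4 * (K : ℝ) ≤ L * θ * K := by gcongr
  have h6 : 0 ≤ θ * K := by positivity
  linarith
end

theorem Irrational.exists_forall_exists_abs_le {α : ℝ} (hα : Irrational α) {ρ : ℝ} (hρ : 0 < ρ) :
    ∃ J : ℕ, ∀ x : ℝ, ∃ j ≤ J, ∃ m : ℤ, |j * α + m - x| ≤ ρ := by
  obtain ⟨n, hn⟩ := exists_nat_gt (1 / ρ)
  have hn0 : 0 < n := by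
    have : (0 : ℝ) < n := lt_trans (by positivity) hn
    exact_mod_cast this
  obtain ⟨k, hk0, -, hk⟩ := Real.exists_nat_abs_mul_sub_round_le α hn0
  set γ := k * α - round (k * α) with hγ
  have hγ0 : γ ≠ 0 := by
    have hirr : Irrational (k * α) := by
      rw [mul_comm]
      exact hα.mul_natCast hk0.ne'
    exact sub_ne_zero.2 (hirr.ne_int _)
  have hγρ : |γ| ≤ ρ := by
    refine hk.trans ?_
    rw [div_lt_iff₀ hρ] at hn
    rw [div_le_iff₀ (by positivity)]
    linarith
  refine ⟨⌊1 / |γ|⌋₊ * k, fun x => ?_⟩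
  obtain ⟨y, i, hxy, hy0, hy1⟩ : ∃ (y : ℝ) (i : ℤ), x = y + i ∧ 0 ≤ y / γ ∧ |y| ≤ 1 := by
    have h0 := Int.fract_nonneg x
    have h1 := Int.fract_lt_one x
    have h2 := Int.fract_add_floor x
    rcases lt_or_gt_of_ne hγ0 with hneg | hpos
    · refine ⟨Int.fract x - 1, ⌊x⌋ + 1, by push_cast; linarith,
        div_nonneg_of_nonpos (by linarith) hneg.le, ?_⟩
      rw [abs_le]; constructor <;> linarith
    · refine ⟨Int.fract x, ⌊x⌋, h2.symm, by positivity, ?_⟩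
      rw [abs_le]; constructor <;> linarith
  have hl1 := Nat.floor_le hy0
  have hl2 := Nat.lt_floor_add_one (y / γ)
  set l := ⌊y / γ⌋₊ with hl
  refine ⟨l * k, Nat.mul_le_mul_right _ (Nat.floor_le_floor ?_), i - l * round (k * α), ?_⟩
  · rw [← abs_of_nonneg hy0, abs_div]
    gcongr
  · have h1 : ((l * k : ℕ) : ℝ) * α + ((i - l * round (k * α) : ℤ) : ℝ) - x = (l - y / γ) * γ := by
      rw [sub_mul, div_mul_cancel₀ _ hγ0, hγ, hxy]
      push_cast
      ring
    have h2 : |(l : ℝ) - y / γ| ≤ 1 := by rw [abs_le]; constructor <;> linarith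
    rw [h1, abs_mul]
    calc |(l : ℝ) - y / γ| * |γ| ≤ 1 * ρ := by gcongr
      _ = ρ := one_mul ρ

section
variable {H : ℝ × ℝ → ℝ} {F : ℝ × ℝ ≃ₜ ℝ × ℝ} {α : ℝ}

theorem IsShift.dispSub_le_of_invariant {C d : ℝ} (hF : IsShift H F α C) (hC : 0 ≤ C) (hd : 0 ≤ d)
    {R : ℝ × ℝ → ℝ × ℝ → Prop} (hR : ∀ p q, R p q → R (F p) (F q)) {n : ℕ} (hn : 0 < n)
    (h : ∀ p q, R p q → dispSub (F ^ n) p q ≤ n * d) (m : ℕ) {p q : ℝ × ℝ} (hpq : R p q) :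
    dispSub (F ^ m) p q ≤ m * d + 2 * C * n := by
  have hRk : ∀ k : ℕ, R ((F ^ k) p) ((F ^ k) q) := by
    intro k
    induction k with
    | zero => exact hpq
    | succ k ih =>
      rw [pow_succ', homeomorph_mul_apply, homeomorph_mul_apply]
      exact hR _ _ ih
  have hmul : ∀ b : ℕ, dispSub (F ^ (n * b)) p q ≤ (n * b : ℕ) * d := by
    intro b
    induction b with
    | zero => simp [dispSub]
    | succ b ih =>
      rw [Nat.mul_succ, add_comm, pow_add, dispSub_mul]
      have := h _ _ (hRk (n * b))
      push_cast at ih ⊢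
      linarith
  rw [← Nat.mod_add_div m n, pow_add, dispSub_mul]
  have h1 := (le_abs_self _).trans
    ((hF.pow (m % n)).abs_dispSub_le ((F ^ (n * (m / n))) p) ((F ^ (n * (m / n))) q))
  have h2 := hmul (m / n)
  have h3 : ((m % n : ℕ) : ℝ) * C ≤ n * C := by
    have : ((m % n : ℕ) : ℝ) ≤ n := by exact_mod_cast (Nat.mod_lt m hn).le
    gcongr
  have h4 : 0 ≤ ((m % n : ℕ) : ℝ) * d := by positivity
  push_cast at h2 ⊢
  linarith

/-- Orbits on the same levels separate sublinearly in the vertical direction. -/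
theorem IsShift.exists_dispSub_le {C : ℕ} (hH : IsHeight H) (hF : IsShift H F α C)
    (hα : Irrational α) (hC : 1 ≤ C) {ε : ℝ} (hε : 0 < ε) :
    ∃ N : ℕ, ∀ n ≥ N, ∀ p q, H p = H q → dispSub (F ^ n) p q ≤ n * ε := by
  have hev : ∀ d, 0 ≤ d → ∀ n : ℕ, 0 < n → (∀ p q, H p = H q → dispSub (F ^ n) p q ≤ n * d) →
      ∀ e > 0, ∃ N : ℕ, ∀ m ≥ N, ∀ p q, H p = H q → dispSub (F ^ m) p q ≤ m * (d + e) := by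
    intro d hd n hn h e he
    obtain ⟨N, hN⟩ := exists_nat_gt (2 * C * n / e)
    refine ⟨N, fun m hm p q hpq => ?_⟩
    refine (hF.dispSub_le_of_invariant (R := fun p q => H p = H q) C.cast_nonneg hd
      (fun p q h => by rw [hF.height, hF.height, h]) hn h m hpq).trans ?_
    have h1 : (N : ℝ) * e ≤ m * e := by
      have : (N : ℝ) ≤ m := by exact_mod_cast hm
      gcongr
    rw [div_lt_iff₀ he] at hN
    linarith
  set S : Set ℝ := {d | 0 ≤ d ∧ ∃ n : ℕ, 0 < n ∧ ∀ p q, H p = H q → dispSub (F ^ n) p q ≤ n * d}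
    with hS
  have hne : S.Nonempty := ⟨2 * C, by positivity, 1, one_pos, fun p q _ => by
    have := (le_abs_self _).trans ((hF.pow 1).abs_dispSub_le p q)
    push_cast at this ⊢
    linarith⟩
  have hbdd : BddBelow S := ⟨0, fun d hd => hd.1⟩
  have hlt : ∀ e > 0, ∃ d ∈ S, d < sInf S + e := fun e he => exists_lt_of_csInf_lt hne (by linarith)
  have hinf0 : 0 ≤ sInf S := le_csInf hne fun d hd => hd.1
  have hsup : ∀ e > 0, ∃ N : ℕ, ∀ n ≥ N, ∀ p q, H p = H q → dispSub (F ^ n) p q ≤ n * (sInf S + e) := by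
    intro e he
    obtain ⟨d, ⟨hd0, n, hn, h⟩, hd⟩ := hlt (e / 2) (by positivity)
    obtain ⟨N, hN⟩ := hev d hd0 n hn h (e / 2) (by positivity)
    refine ⟨N, fun m hm p q hpq => (hN m hm p q hpq).trans ?_⟩
    exact mul_le_mul_of_nonneg_left (by linarith) m.cast_nonneg
  rcases hinf0.eq_or_lt with h0 | hpos
  · simpa [← h0] using hsup ε hε
  · refine (hF.false_of_linear_separation hH hα hC hpos hsup fun e he K hK => ?_).elim
    by_contra! hcon
    rcases le_or_gt 0 (sInf S - e) with h | h
    · have := csInf_le hbdd (show sInf S - e ∈ S from ⟨h, K, hK, fun p q hpq => (hcon p q hpq).le⟩)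
      linarith
    · have h1 := hcon 0 0 rfl
      have h2 : (0 : ℝ) < K := by exact_mod_cast hK
      rw [show dispSub (F ^ K) 0 0 = 0 by simp [dispSub]] at h1
      nlinarith

theorem IsHeight.exists_dispSub_le_of_near (hH : IsHeight H) {G : ℝ × ℝ ≃ₜ ℝ × ℝ} {β B : ℝ}
    (hG : IsShift H G β B) {a b : ℝ} (hab : a < b) (h : ∀ p q, H p = H q → dispSub G p q ≤ a) :
    ∃ ρ > 0, ∀ p q, (∃ m : ℤ, |H p + m - H q| ≤ ρ) → dispSub G p q ≤ b := by
  obtain ⟨A, hA⟩ := hH.exists_bound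
  have htr : ∀ p q (m n k l : ℤ), dispSub G (p + ((m : ℝ), (n : ℝ))) (q + ((k : ℝ), (l : ℝ))) =
      dispSub G p q := by
    intro p q m n k l
    simp only [dispSub, hG.map_add, Prod.snd_add]
    ring
  have hcont : Continuous fun x : (ℝ × ℝ) × (ℝ × ℝ) => dispSub G x.1 x.2 := by
    unfold dispSub
    fun_prop
  have hHc := hH.continuous
  set S : Set ((ℝ × ℝ) × (ℝ × ℝ)) := (Icc (0, 0) (1, 1) ×ˢ Icc (-(2 * A + 1), 0) (2 * A + 2, 1)) ∩
    {x | b ≤ dispSub G x.1 x.2}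
  have hScomp : IsCompact S :=
    (isCompact_Icc.prod isCompact_Icc).inter_right (isClosed_le continuous_const hcont)
  obtain ⟨ρ, hρ, hmin⟩ := hScomp.exists_forall_le' (f := fun x => |H x.1 - H x.2|) (a := 0)
    (by fun_prop) (fun x hx => by
      rw [abs_pos, sub_ne_zero]
      intro heq
      have h1 : b ≤ dispSub G x.1 x.2 := hx.2
      linarith [h _ _ heq])
  refine ⟨min (ρ / 2) 1, by positivity, fun p q ⟨m, hm⟩ => ?_⟩
  by_contra! hcon
  obtain ⟨i, j, hij⟩ := exists_add_int_mem_Icc p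
  obtain ⟨_, l, hl⟩ := exists_add_int_mem_Icc q
  have h1 : H (p + ((i : ℝ), (j : ℝ))) - H (q + (((i - m : ℤ) : ℝ), (l : ℝ))) = H p + m - H q := by
    rw [hH.map_add, hH.map_add]; push_cast; ring
  have h2 : (p + ((i : ℝ), (j : ℝ)), q + (((i - m : ℤ) : ℝ), (l : ℝ))) ∈ S := by
    refine ⟨⟨hij, ?_⟩, ?_⟩
    · have h3 := abs_le.1 (hA (p + ((i : ℝ), (j : ℝ))))
      have h4 := abs_le.1 (hA (q + (((i - m : ℤ) : ℝ), (l : ℝ))))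
      have h5 := abs_le.1 (hm.trans (min_le_right _ _))
      rw [← h1] at h5
      have h6 : (0 : ℝ) ≤ (p + ((i : ℝ), (j : ℝ))).1 := hij.1.1
      have h7 : (p + ((i : ℝ), (j : ℝ))).1 ≤ (1 : ℝ) := hij.2.1
      exact ⟨⟨by change -(2 * A + 1) ≤ (q + (((i - m : ℤ) : ℝ), (l : ℝ))).1; linarith, hl.1.2⟩,
        ⟨by change (q + (((i - m : ℤ) : ℝ), (l : ℝ))).1 ≤ 2 * A + 2; linarith, hl.2.2⟩⟩
    · change b ≤ dispSub G _ _
      rw [htr]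
      exact hcon.le
  have h3 := hmin _ h2
  change ρ ≤ |H (p + ((i : ℝ), (j : ℝ))) - H (q + (((i - m : ℤ) : ℝ), (l : ℝ)))| at h3
  rw [h1] at h3
  linarith [hm.trans (min_le_left _ _)]

/-- All orbits separate sublinearly in the vertical direction. -/
theorem IsShift.exists_forall_dispSub_le {C : ℕ} (hH : IsHeight H) (hF : IsShift H F α C)
    (hα : Irrational α) (hC : 1 ≤ C) {ε : ℝ} (hε : 0 < ε) :
    ∃ N : ℕ, ∀ n ≥ N, ∀ p q, dispSub (F ^ n) p q ≤ n * ε := by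
  obtain ⟨N₀, hN₀⟩ := hF.exists_dispSub_le hH hα hC (by positivity : 0 < ε / 4)
  have hn0 : (0 : ℝ) < (N₀ + 1 : ℕ) := by positivity
  obtain ⟨ρ, hρ, hnear⟩ := hH.exists_dispSub_le_of_near (hF.pow (N₀ + 1))
    (a := (N₀ + 1 : ℕ) * (ε / 4)) (b := (N₀ + 1 : ℕ) * (ε / 2)) (by gcongr; linarith)
    (hN₀ _ (by omega))
  obtain ⟨J, hJ⟩ := hα.exists_forall_exists_abs_le hρ
  obtain ⟨N, hN⟩ := exists_nat_gt ((2 * C * (N₀ + 1 : ℕ) + 2 * C * J) / (ε / 2))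
  refine ⟨N, fun n hn p q => ?_⟩
  obtain ⟨j, hjJ, m, hjm⟩ := hJ (H q - H p)
  have h1 := hF.dispSub_le_of_invariant (R := fun p q => ∃ m : ℤ, |H p + m - H q| ≤ ρ) C.cast_nonneg
    (by positivity : 0 ≤ ε / 2) (fun p q ⟨m, hm⟩ => ⟨m, by
      rw [hF.height, hF.height]
      convert hm using 2
      ring⟩) (by omega) hnear n (p := (F ^ j) p) (q := q) ⟨m, by
      rw [(hF.pow j).height]
      convert hjm using 2
      ring⟩
  have h2 : dispSub (F ^ n) p q = dispSub (F ^ n) ((F ^ j) p) q - dispSub (F ^ j) ((F ^ n) p) p := by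
    simp only [dispSub, ← homeomorph_mul_apply, ← pow_add, add_comm j n]
    ring
  have h3 := (abs_le.1 ((hF.pow j).abs_dispSub_le ((F ^ n) p) p)).1
  have h4 : (j : ℝ) * C ≤ J * C := by gcongr
  have h5 : (N : ℝ) * (ε / 2) ≤ n * (ε / 2) := by gcongr
  rw [div_lt_iff₀ (by positivity)] at hN
  linarith

/-- Vertical displacements have a uniform average. -/
theorem IsShift.exists_uniform_average {C : ℕ} (hH : IsHeight H) (hF : IsShift H F α C)
    (hα : Irrational α) (hC : 1 ≤ C) :
    ∃ c : ℝ, ∀ ε > 0, ∃ N : ℕ, ∀ n ≥ N, ∀ p, |((F ^ n) p).2 - p.2 - n * c| ≤ n * ε := by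
  set a : ℕ → ℝ := fun n => ((F ^ n) 0).2 with ha
  have hdev : ∀ ε > 0, ∃ N : ℕ, 0 < N ∧ ∀ n ≥ N, ∀ p, |((F ^ n) p).2 - p.2 - a n| ≤ n * ε := by
    intro ε hε
    obtain ⟨N, hN⟩ := hF.exists_forall_dispSub_le hH hα hC hε
    refine ⟨N + 1, by omega, fun n hn p => ?_⟩
    have h1 := hN n (by omega) p 0
    have h2 := hN n (by omega) 0 p
    simp only [dispSub, Prod.snd_zero] at h1 h2
    rw [abs_le]
    constructor <;> linarith
  have hmul : ∀ ε > 0, ∀ n : ℕ, (∀ p, |((F ^ n) p).2 - p.2 - a n| ≤ n * ε) → ∀ k : ℕ,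
      |a (n * k) - k * a n| ≤ k * (n * ε) := by
    intro ε hε n h k
    induction k with
    | zero => simp [ha]
    | succ k ih =>
      have h1 := abs_le.1 (h ((F ^ (n * k)) 0))
      have h2 := abs_le.1 ih
      rw [← homeomorph_mul_apply, ← pow_add, add_comm n (n * k), ← Nat.mul_succ] at h1
      change -(n * ε) ≤ a (n * (k + 1)) - a (n * k) - a n ∧ a (n * (k + 1)) - a (n * k) - a n ≤ n * ε at h1
      push_cast
      rw [abs_le]
      constructor <;> linarith
  have hcomp : ∀ ε > 0, ∀ n m : ℕ, 0 < n → 0 < m → (∀ p, |((F ^ n) p).2 - p.2 - a n| ≤ n * ε) →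
      |a (n * m) / (n * m : ℕ) - a n / n| ≤ ε := by
    intro ε hε n m hn hm h
    have hn' : (0 : ℝ) < n := by exact_mod_cast hn
    have hm' : (0 : ℝ) < m := by exact_mod_cast hm
    have h1 : a (n * m) / (n * m : ℕ) - a n / n = (a (n * m) - m * a n) / (m * n) := by
      push_cast; field_simp
    rw [h1, abs_div, abs_of_pos (by positivity : (0 : ℝ) < m * n), div_le_iff₀ (by positivity)]
    refine (hmul ε hε n h m).trans_eq (by ring)
  have hcauchy : ∀ ε > 0, ∀ n m : ℕ, 0 < n → 0 < m → (∀ p, |((F ^ n) p).2 - p.2 - a n| ≤ n * ε) →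
      (∀ p, |((F ^ m) p).2 - p.2 - a m| ≤ m * ε) → |a n / n - a m / m| ≤ 2 * ε := by
    intro ε hε n m hn hm h h'
    have h1 := abs_le.1 (hcomp ε hε n m hn hm h)
    have h2 := hcomp ε hε m n hm hn h'
    rw [mul_comm m n] at h2
    have h2 := abs_le.1 h2
    rw [abs_le]
    constructor <;> linarith
  obtain ⟨c, hc⟩ := cauchySeq_tendsto_of_complete (u := fun n => a n / n) (by
    rw [Metric.cauchySeq_iff']
    intro ε hε
    obtain ⟨N, hN0, hN⟩ := hdev (ε / 4) (by positivity)
    refine ⟨N, fun n hn => ?_⟩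
    rw [Real.dist_eq]
    linarith [hcauchy (ε / 4) (by positivity) n N (by omega) hN0 (hN n hn) (hN N le_rfl)])
  refine ⟨c, fun ε hε => ?_⟩
  obtain ⟨N, hN0, hN⟩ := hdev (ε / 3) (by positivity)
  refine ⟨N, fun n hn p => ?_⟩
  have hn' : (0 : ℝ) < n := by exact_mod_cast (by omega : 0 < n)
  have h1 : |a n / n - c| ≤ 2 * (ε / 3) := by
    refine le_of_tendsto ((tendsto_const_nhds.sub hc).abs) ?_
    filter_upwards [eventually_ge_atTop N] with m hm
    exact hcauchy _ (by positivity) n m (by omega) (by omega) (hN n hn) (hN m hm)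
  have h2 : |a n - n * c| ≤ n * (2 * (ε / 3)) := by
    have : a n - n * c = n * (a n / n - c) := by field_simp
    rw [this, abs_mul, abs_of_pos hn']
    gcongr
  have h3 := abs_le.1 (hN n hn p)
  have h2 := abs_le.1 h2
  rw [abs_le]
  constructor <;> linarith

end

/-- Displacements of a height-shifting homeomorphism have a uniform average. -/
theorem IsHeight.exists_uniform_average {H : ℝ × ℝ → ℝ} (hH : IsHeight H) {G : ℝ × ℝ ≃ₜ ℝ × ℝ}
    {α : ℝ} (hα : Irrational α)
    (hG : ∀ (p : ℝ × ℝ) (m n : ℤ), G (p + ((m : ℝ), (n : ℝ))) = G p + ((m : ℝ), (n : ℝ)))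
    (hHG : ∀ p, H (G p) = H p + α) :
    ∃ v : ℝ × ℝ, ∀ ε > 0, ∃ N : ℕ, ∀ n ≥ N, ∀ p, ‖(G ^ n) p - p - (n : ℝ) • v‖ ≤ n * ε := by
  have hper : IsDoublyPeriodic fun p => (G p).2 - p.2 := fun p m n => by simp [hG]
  obtain ⟨B, hB⟩ := hper.exists_bound (by fun_prop)
  obtain ⟨C, hC⟩ := exists_nat_ge B
  have hF : IsShift H G α (C + 1 : ℕ) := ⟨hG, hHG, fun p => (hB p).trans (by push_cast; linarith)⟩
  obtain ⟨c, hc⟩ := hF.exists_uniform_average hH hα (by omega)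
  obtain ⟨A, hA⟩ := hH.exists_bound
  refine ⟨(α, c), fun ε hε => ?_⟩
  obtain ⟨N, hN⟩ := hc ε hε
  obtain ⟨N', hN'⟩ := exists_nat_gt (2 * A / ε)
  refine ⟨max N N', fun n hn p => ?_⟩
  rw [Prod.norm_def]
  refine max_le ?_ ?_
  · have h1 := (hF.pow n).height p
    have h2 := abs_le.1 (hA p)
    have h3 := abs_le.1 (hA ((G ^ n) p))
    have h4 : (N' : ℝ) * ε ≤ n * ε := by
      have : (N' : ℝ) ≤ n := by exact_mod_cast (le_max_right _ _).trans hn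
      gcongr
    rw [div_lt_iff₀ hε] at hN'
    change |((G ^ n) p).1 - p.1 - n * α| ≤ n * ε
    rw [abs_le]
    constructor <;> linarith
  · exact hN n ((le_max_left _ _).trans hn) p

theorem map_add_intVec {A : Type*} [AddCommGroup A] {f : ℝ × ℝ → A} {u v : A}
    (h1 : ∀ p, f (p + (1, 0)) = f p + u) (h2 : ∀ p, f (p + (0, 1)) = f p + v) (p : ℝ × ℝ) (m n : ℤ) :
    f (p + ((m : ℝ), (n : ℝ))) = f p + (m • u + n • v) := by
  have h3 (x : ℝ × ℝ) (k : ℤ) : f (x + k • (1, 0)) = f x + k • u :=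
    AddConstMapClass.map_add_zsmul (⟨f, h1⟩ : AddConstMap (ℝ × ℝ) A (1, 0) u) x k
  have h4 (x : ℝ × ℝ) (k : ℤ) : f (x + k • (0, 1)) = f x + k • v :=
    AddConstMapClass.map_add_zsmul (⟨f, h2⟩ : AddConstMap (ℝ × ℝ) A (0, 1) v) x k
  have h5 : p + ((m : ℝ), (n : ℝ)) = p + m • (1, 0) + n • (0, 1) := by ext <;> simp
  rw [h5, h4, h3, add_assoc]

/-- The similarity `z ↦ (a + b i) z` of the plane. -/
def planeSimilarity (a b : ℝ) (h : a ^ 2 + b ^ 2 ≠ 0) : ℝ × ℝ ≃ₜ ℝ × ℝ where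
  toFun p := (a * p.1 - b * p.2, b * p.1 + a * p.2)
  invFun p := ((a * p.1 + b * p.2) / (a ^ 2 + b ^ 2), (a * p.2 - b * p.1) / (a ^ 2 + b ^ 2))
  left_inv p := by ext <;> field_simp <;> ring
  right_inv p := by ext <;> field_simp <;> ring
  continuous_toFun := by fun_prop
  continuous_invFun := by fun_prop

theorem planeSimilarity_apply (a b : ℝ) (h : a ^ 2 + b ^ 2 ≠ 0) (p : ℝ × ℝ) :
    planeSimilarity a b h p = (a * p.1 - b * p.2, b * p.1 + a * p.2) := rfl

theorem planeSimilarity_sub (a b : ℝ) (h : a ^ 2 + b ^ 2 ≠ 0) (p q : ℝ × ℝ) :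
    planeSimilarity a b h (p - q) = planeSimilarity a b h p - planeSimilarity a b h q := by
  ext <;> simp [planeSimilarity_apply] <;> ring

theorem planeSimilarity_smul (a b : ℝ) (h : a ^ 2 + b ^ 2 ≠ 0) (c : ℝ) (p : ℝ × ℝ) :
    planeSimilarity a b h (c • p) = c • planeSimilarity a b h p := by
  ext <;> simp [planeSimilarity_apply] <;> ring

theorem planeSimilarity_add_intVec (a b : ℤ) (h : (a : ℝ) ^ 2 + (b : ℝ) ^ 2 ≠ 0) (p : ℝ × ℝ) (m n : ℤ) :
    planeSimilarity a b h (p + ((m : ℝ), (n : ℝ))) =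
      planeSimilarity a b h p + (((a * m - b * n : ℤ) : ℝ), ((b * m + a * n : ℤ) : ℝ)) := by
  ext <;> simp [planeSimilarity_apply] <;> ring

theorem norm_planeSimilarity_le (a b : ℝ) (h : a ^ 2 + b ^ 2 ≠ 0) (p : ℝ × ℝ) :
    ‖planeSimilarity a b h p‖ ≤ (|a| + |b|) * ‖p‖ := by
  have h1 : |p.1| ≤ ‖p‖ := norm_fst_le p
  have h2 : |p.2| ≤ ‖p‖ := norm_snd_le p
  rw [planeSimilarity_apply, Prod.norm_def]
  refine max_le ?_ ?_
  · calc |a * p.1 - b * p.2| ≤ |a * p.1| + |b * p.2| := abs_sub _ _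
      _ = |a| * |p.1| + |b| * |p.2| := by rw [abs_mul, abs_mul]
      _ ≤ |a| * ‖p‖ + |b| * ‖p‖ := by gcongr
      _ = (|a| + |b|) * ‖p‖ := by ring
  · calc |b * p.1 + a * p.2| ≤ |b * p.1| + |a * p.2| := abs_add_le _ _
      _ = |b| * |p.1| + |a| * |p.2| := by rw [abs_mul, abs_mul]
      _ ≤ |b| * ‖p‖ + |a| * ‖p‖ := by gcongr
      _ = (|a| + |b|) * ‖p‖ := by ring

theorem homeomorph_pow_apply (G : ℝ × ℝ ≃ₜ ℝ × ℝ) (n : ℕ) (p : ℝ × ℝ) : (G ^ n) p = G^[n] p := by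
  induction n generalizing p with
  | zero => rfl
  | succ n ih => rw [pow_succ, homeomorph_mul_apply, ih, iterate_succ_apply]

theorem rotSet_eq_singleton {F : ℝ × ℝ → ℝ × ℝ} {v : ℝ × ℝ}
    (h : ∀ ε > 0, ∃ N : ℕ, ∀ n ≥ N, ∀ p, ‖F^[n] p - p - (n : ℝ) • v‖ ≤ n * ε) : rotSet F = {v} := by
  have key : ∀ (n : ℕ → ℕ) (x : ℕ → ℝ × ℝ), Tendsto n atTop atTop →
      Tendsto (fun i => (n i : ℝ)⁻¹ • (F^[n i] (x i) - x i)) atTop (𝓝 v) := by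
    intro n x hn
    rw [Metric.tendsto_atTop']
    intro ε hε
    obtain ⟨N, hN⟩ := h (ε / 2) (by positivity)
    obtain ⟨I, hI⟩ := eventually_atTop.1 (hn.eventually_ge_atTop (max N 1))
    refine ⟨I, fun i hi => ?_⟩
    have h1 := hI i hi.le
    have h2 : (0 : ℝ) < n i := by exact_mod_cast lt_of_lt_of_le one_pos ((le_max_right _ _).trans h1)
    have h3 := hN (n i) ((le_max_left _ _).trans h1) (x i)
    have h4 : (n i : ℝ)⁻¹ • (F^[n i] (x i) - x i) - v =
        (n i : ℝ)⁻¹ • (F^[n i] (x i) - x i - (n i : ℝ) • v) := by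
      rw [smul_sub _ _ ((n i : ℝ) • v), inv_smul_smul₀ h2.ne']
    rw [dist_eq_norm, h4, norm_smul, norm_inv, Real.norm_natCast, inv_mul_lt_iff₀ h2]
    exact h3.trans_lt (by gcongr; linarith)
  refine Subset.antisymm ?_ ?_
  · rintro u ⟨n, x, hn, hu⟩
    exact tendsto_nhds_unique hu (key n x hn)
  · rintro _ rfl
    exact ⟨id, fun _ => 0, tendsto_id, key id _ tendsto_id⟩

/-- A continuous map to the circle on which the quotient map of `F` acts by an irrational rotation
lifts to the plane, where it is not homotopically trivial. -/
theorem exists_lift_semiconj {h : 𝕋2 → 𝕊} (hhc : Continuous h) {f : 𝕋2 → 𝕋2} {α : ℝ}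
    (hα : Irrational α) (hsemi : ∀ z, h (f z) = h z + (α : 𝕊)) {F : ℝ × ℝ ≃ₜ ℝ × ℝ}
    (hlift : ∀ p, π2 (F p) = f (π2 p)) :
    ∃ (H : ℝ × ℝ → ℝ) (a b : ℤ) (β : ℝ), Continuous H ∧ Irrational β ∧ (a : ℝ) ^ 2 + (b : ℝ) ^ 2 ≠ 0 ∧
      (∀ (p : ℝ × ℝ) (m n : ℤ), H (p + ((m : ℝ), (n : ℝ))) = H p + (a * m + b * n)) ∧
      ∀ p, H (F p) = H p + β := by
  have hπ : Continuous π2 :=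
    ((AddCircle.continuous_mk' 1).comp continuous_fst).prodMk
      ((AddCircle.continuous_mk' 1).comp continuous_snd)
  obtain ⟨H, hHc, hH⟩ := exists_continuous_lift_addCircle (hhc.comp hπ)
  have hconst : ∀ G : ℝ × ℝ → ℝ × ℝ, Continuous G → ∀ c : ℝ,
      (∀ p, h (π2 (G p)) = h (π2 p) + (c : 𝕊)) → ∃ m : ℤ, ∀ p, H (G p) = H p + (m + c) := by
    intro G hG c hGc
    obtain ⟨m, hm⟩ := IsPreconnected.exists_int_of_coe_eq_zero (S := univ)
      (φ := fun p => H (G p) - H p - c) isPreconnected_univ (by fun_prop) (fun p _ => by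
        rw [AddCircle.coe_sub, AddCircle.coe_sub, hH, hH, comp_apply, comp_apply, hGc]
        abel)
    refine ⟨m, fun p => ?_⟩
    linarith [hm p (mem_univ p)]
  obtain ⟨a, ha⟩ := hconst (fun p => p + (1, 0)) (by fun_prop) 0 fun p => by
    simp [π2]
  obtain ⟨b, hb⟩ := hconst (fun p => p + (0, 1)) (by fun_prop) 0 fun p => by
    simp [π2]
  obtain ⟨k, hk⟩ := hconst F F.continuous α fun p => by rw [hlift, hsemi]
  have hper : ∀ (p : ℝ × ℝ) (m n : ℤ), H (p + ((m : ℝ), (n : ℝ))) = H p + (a * m + b * n) := by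
    intro p m n
    rw [map_add_intVec ha hb]
    simp [mul_comm]
  have hβ : Irrational (k + α) := hα.intCast_add k
  refine ⟨H, a, b, k + α, hHc, hβ, fun h0 => ?_, hper, hk⟩
  have ha0 : (a : ℝ) = 0 := by nlinarith [sq_nonneg (a : ℝ), sq_nonneg (b : ℝ)]
  have hb0 : (b : ℝ) = 0 := by nlinarith [sq_nonneg (a : ℝ), sq_nonneg (b : ℝ)]
  obtain ⟨B, hB⟩ := IsDoublyPeriodic.exists_bound (ψ := H) (fun p m n => by
    rw [hper, ha0, hb0]; ring) hHc
  have hiter : ∀ n : ℕ, H ((F ^ n) 0) = H 0 + n * (k + α) := by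
    intro n
    induction n with
    | zero => simp
    | succ n ih => rw [pow_succ', homeomorph_mul_apply, hk, ih]; push_cast; ring
  have hpos : 0 < |k + α| := abs_pos.2 hβ.ne_zero
  obtain ⟨n, hn⟩ := exists_nat_gt (2 * B / |k + α|)
  rw [div_lt_iff₀ hpos] at hn
  have h1 := abs_le.1 (hB ((F ^ n) 0))
  have h2 := abs_le.1 (hB 0)
  rw [hiter] at h1
  have h3 : |(n : ℝ) * (k + α)| ≤ 2 * B := by
    rw [abs_le]; constructor <;> linarith
  rw [abs_mul, Nat.abs_cast] at h3
  linarith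

theorem rotation_set_of_extension_of_irrational_rotation_is_singleton
    (f : 𝕋2 → 𝕋2) (hf : IsHomeomorph f)
    (hhtpy : ContinuousMap.Homotopic ⟨f, hf.continuous⟩ (ContinuousMap.id 𝕋2))
    -- `f` is an extension of an irrational rotation:
    (h : 𝕋2 → 𝕊) (hhc : Continuous h) (hhs : Function.Surjective h)
    (α : ℝ) (hα : Irrational α)
    (hsemi : ∀ z, h (f z) = h z + (α : 𝕊))
    -- `F` is a lift of `f`:
    (F : ℝ × ℝ → ℝ × ℝ) (hF : IsHomeomorph F)
    (hlift : ∀ p, π2 (F p) = f (π2 p))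
    (hT1 : ∀ p : ℝ × ℝ, F (p + (1, 0)) = F p + (1, 0))
    (hT2 : ∀ p : ℝ × ℝ, F (p + (0, 1)) = F p + (0, 1)) :
    ∃ v : ℝ × ℝ, rotSet F = {v} := by
  set Φ : ℝ × ℝ ≃ₜ ℝ × ℝ := hF.homeomorph F with hΦ
  have hΦF : ⇑Φ = F := rfl
  obtain ⟨H, a, b, β, hHc, hβ, hD, hper, hHF⟩ := exists_lift_semiconj hhc hα hsemi (F := Φ) hlift
  have hFper : ∀ (p : ℝ × ℝ) (m n : ℤ), Φ (p + ((m : ℝ), (n : ℝ))) = Φ p + ((m : ℝ), (n : ℝ)) := by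
    intro p m n
    rw [map_add_intVec (f := Φ) hT1 hT2]
    simp
  set D : ℝ := (a : ℝ) ^ 2 + (b : ℝ) ^ 2 with hDdef
  set M := planeSimilarity a b hD with hM
  have hMG : ∀ (n : ℕ) (q : ℝ × ℝ), M (((M⁻¹ * Φ * M) ^ n) q) = (Φ ^ n) (M q) := by
    intro n q
    have h1 : M * (M⁻¹ * Φ * M) ^ n = Φ ^ n * M := by
      induction n with
      | zero => simp
      | succ n ih => rw [pow_succ, ← mul_assoc, ih, pow_succ]; group
    rw [← homeomorph_mul_apply, h1, homeomorph_mul_apply]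
  have hMG1 : ∀ q, M ((M⁻¹ * Φ * M) q) = Φ (M q) := fun q => by simp
  have hH' : IsHeight fun q => H (M q) / D := by
    refine ⟨(hHc.comp M.continuous).div_const D, fun q m n => ?_⟩
    rw [hM, planeSimilarity_add_intVec, hper]
    field_simp
    rw [hDdef]
    push_cast
    ring
  have hβD : Irrational (β / D) := by
    have h1 : D = ((a ^ 2 + b ^ 2 : ℤ) : ℝ) := by rw [hDdef]; push_cast; ring
    rw [h1]
    refine hβ.div_intCast fun h0 => hD ?_
    rw [h1, h0, Int.cast_zero]
  obtain ⟨v, hv⟩ := hH'.exists_uniform_average (G := M⁻¹ * Φ * M) hβD (fun q m n => by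
    refine M.injective ?_
    rw [hMG1, hM, planeSimilarity_add_intVec, planeSimilarity_add_intVec, hFper, ← hM, hMG1])
    (fun q => by rw [hMG1, hHF, add_div])
  refine ⟨M v, rotSet_eq_singleton fun ε hε => ?_⟩
  set c : ℝ := |(a : ℝ)| + |(b : ℝ)| + 1 with hc
  have hc0 : 0 < c := by positivity
  obtain ⟨N, hN⟩ := hv (ε / c) (by positivity)
  refine ⟨N, fun n hn p => ?_⟩
  obtain ⟨q, rfl⟩ := M.surjective p
  have h1 : F^[n] (M q) - M q - (n : ℝ) • M v = M (((M⁻¹ * Φ * M) ^ n) q - q - (n : ℝ) • v) := by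
    rw [hM, planeSimilarity_sub, planeSimilarity_sub, planeSimilarity_smul, ← hM, hMG,
      homeomorph_pow_apply, hΦF]
  rw [h1]
  calc ‖M (((M⁻¹ * Φ * M) ^ n) q - q - (n : ℝ) • v)‖
      ≤ (|(a : ℝ)| + |(b : ℝ)|) * ‖((M⁻¹ * Φ * M) ^ n) q - q - (n : ℝ) • v‖ :=
        norm_planeSimilarity_le _ _ _ _
    _ ≤ c * (n * (ε / c)) := by
        gcongr
        · rw [hc]; linarith
        · exact hN n hn q
    _ = n * ε := by field_simp
end
end

section
/- Let (C_k)_{k∈ℕ} be a sequence of essential continua in the annulus 𝔸, all contained in a fixed compact subset of 𝔸, which is increasing with respect to the partial order ≺ (i.e. C_k ≺ C_{k+1} for all k). Then there exists an essential continuum C ⊂ 𝔸 such that d_H(C_k, C) → 0 as k → ∞; moreover C equals the topological boundary of ⋃_{k∈ℕ} U⁻(C_k). -/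
/- STATEMENT 3: An increasing (for ≺) sequence of essential continua of the
annulus contained in a fixed compact set converges in Hausdorff distance to an
essential continuum, which equals the boundary of the union of the regions
`U⁻(C_k)`. -/

noncomputable section
open Set Metric Filter Topology Function

abbrev 𝔸 : Type := 𝕊 × ℝ
def τ : ℝ × ℝ → 𝔸 := fun p => ((p.1 : 𝕊), p.2)
def θ : 𝔸 → 𝕋2 := fun p => (p.1, (p.2 : 𝕊))

/-- The connected components of a set `S ⊆ 𝔸`. -/
def comps (S : Set 𝔸) : Set (Set 𝔸) := {C | ∃ z ∈ S, C = connectedComponentIn S z}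

/-- A subset of the annulus is unbounded above. -/
def UnbAbove (C : Set 𝔸) : Prop := ¬ BddAbove (Prod.snd '' C)
/-- A subset of the annulus is unbounded below. -/
def UnbBelow (C : Set 𝔸) : Prop := ¬ BddBelow (Prod.snd '' C)

/-- An essential continuum: a compact connected set whose complement has exactly two
unbounded connected components, one unbounded above, the other unbounded below. -/
def IsEssentialContinuum (E : Set 𝔸) : Prop :=
  IsCompact E ∧ IsConnected E ∧
  ∃ U V : Set 𝔸, U ∈ comps Eᶜ ∧ V ∈ comps Eᶜ ∧ U ≠ V ∧
    UnbAbove U ∧ ¬ UnbBelow U ∧ UnbBelow V ∧ ¬ UnbAbove V ∧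
    ∀ C ∈ comps Eᶜ, ¬ Bornology.IsBounded C → C = U ∨ C = V

/-- The lower unbounded complementary region `U⁻(E)` of an essential continuum. -/
def Uminus (E : Set 𝔸) : Set 𝔸 :=
  {z | z ∉ E ∧ UnbBelow (connectedComponentIn Eᶜ z)}

/-- The partial order `C₁ ≺ C₂` on essential continua. -/
def Prec (C₁ C₂ : Set 𝔸) : Prop := C₁ ⊆ Uminus C₂

/-- An essential annular continuum: a compact connected set whose complement has
exactly two connected components, both unbounded. -/
def IsEssentialAnnularContinuum (E : Set 𝔸) : Prop :=
  IsCompact E ∧ IsConnected E ∧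
  ∃ U V : Set 𝔸, U ∈ comps Eᶜ ∧ V ∈ comps Eᶜ ∧ U ≠ V ∧
    UnbAbove U ∧ UnbBelow V ∧ ∀ C ∈ comps Eᶜ, C = U ∨ C = V

/-- The infimum distance between two subsets of the annulus. -/
def setDist (s t : Set 𝔸) : ℝ := sInf {r | ∃ x ∈ s, ∃ y ∈ t, r = dist x y}

/-- The upper width of `A ⊆ 𝔸`. -/
def uw (A : Set 𝔸) : ℝ :=
  sSup {r | ∃ C₁ C₂ : Set 𝔸, IsEssentialContinuum C₁ ∧ IsEssentialContinuum C₂ ∧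
    C₁ ⊆ A ∧ C₂ ⊆ A ∧ r = hausdorffDist C₁ C₂}

/-- The lower width of `A ⊆ 𝔸`. -/
def lw (A : Set 𝔸) : ℝ :=
  sSup {r | ∃ C₁ C₂ : Set 𝔸, IsEssentialContinuum C₁ ∧ IsEssentialContinuum C₂ ∧
    C₁ ⊆ A ∧ C₂ ⊆ A ∧ r = setDist C₁ C₂}

/-- A horizontal annular continuum in the torus. -/
def IsHorizontalAnnularContinuum (C : Set 𝕋2) : Prop :=
  IsCompact C ∧ IsConnected C ∧
  ∀ z ∈ θ ⁻¹' C, IsEssentialAnnularContinuum (connectedComponentIn (θ ⁻¹' C) z)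

/-- A horizontal map `h : 𝕋² → S¹`. -/
def IsHorizontalMap (h : 𝕋2 → 𝕊) : Prop :=
  Continuous h ∧ Function.Surjective h ∧ ∀ t : 𝕊, IsHorizontalAnnularContinuum (h ⁻¹' {t})

/-- The lower density of a set of natural numbers. -/
def lowerDensity (G : Set ℕ) : ℝ :=
  liminf (fun n : ℕ => ((G ∩ Set.Icc 1 n).ncard : ℝ) / n) atTop

/-- An essential simple loop, regarded as a subset of the annulus. -/
def IsEssentialSimpleLoop (Γ : Set 𝔸) : Prop :=
  (∃ γ : 𝕊 → 𝔸, Continuous γ ∧ Function.Injective γ ∧ Γ = Set.range γ) ∧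
  IsEssentialContinuum Γ

/-- A closed essential topological annulus: a homeomorphic copy of `S¹ × [0,1]`
containing an essential loop. -/
def IsClosedEssentialAnnulus (A : Set 𝔸) : Prop :=
  (∃ φ : 𝕊 × (Set.Icc (0:ℝ) 1) → 𝔸, Continuous φ ∧ Function.Injective φ ∧ A = Set.range φ) ∧
  ∃ Γ ⊆ A, IsEssentialSimpleLoop Γ

instance locallyConnectedSpace_annulus : LocallyConnectedSpace 𝔸 := by
  have : LocallyPathConnectedSpace 𝕊 :=
    (QuotientAddGroup.isQuotientMap_mk
      (N := AddSubgroup.zmultiples (1:ℝ))).locallyPathConnectedSpace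
  have : LocallyPathConnectedSpace 𝔸 := Prod.locallyPathConnectedSpace
  infer_instance

section General

variable {X : Type*} [TopologicalSpace X]

/-- A preconnected set which meets a set and its complement meets its frontier. -/
theorem inter_frontier_nonempty_of_isPreconnected {S T : Set X} (hS : IsPreconnected S)
    (h1 : (S ∩ T).Nonempty) (h2 : (S \ T).Nonempty) : (S ∩ frontier T).Nonempty := by
  by_contra hcon
  have hin : ∀ x ∈ S, x ∈ closure T → x ∈ interior T := fun x hx hxT => by
    by_contra h
    exact hcon ⟨x, hx, hxT, h⟩
  obtain ⟨a, haS, haT⟩ := h1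
  obtain ⟨b, hbS, hbT⟩ := h2
  obtain ⟨x, -, hx1, hx2⟩ := hS (interior T) (closure T)ᶜ isOpen_interior
    isClosed_closure.isOpen_compl
    (fun x hx => (em (x ∈ closure T)).imp_left (hin x hx))
    ⟨a, haS, hin a haS (subset_closure haT)⟩
    ⟨b, hbS, fun h => hbT (interior_subset (hin b hbS h))⟩
  exact hx2 (subset_closure (interior_subset hx1))

/-- The frontier of a complementary component of a closed set lies in that set. -/
theorem frontier_connectedComponentIn_compl_subset [LocallyConnectedSpace X] {E : Set X}
    (hE : IsClosed E) (z : X) : frontier (connectedComponentIn Eᶜ z) ⊆ E := by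
  intro x hx
  by_contra hxE
  have ho : IsOpen (connectedComponentIn Eᶜ z) := hE.isOpen_compl.connectedComponentIn
  obtain ⟨y, hyx, hyz⟩ := _root_.mem_closure_iff.1 hx.1 _
    hE.isOpen_compl.connectedComponentIn (mem_connectedComponentIn (F := Eᶜ) hxE)
  have hxz : connectedComponentIn Eᶜ z = connectedComponentIn Eᶜ x :=
    (connectedComponentIn_eq hyz).trans (connectedComponentIn_eq hyx).symm
  rw [ho.frontier_eq] at hx
  exact hx.2 (hxz ▸ mem_connectedComponentIn (F := Eᶜ) hxE)

/-- A closed connected set together with one of its complementary components is connected. -/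
theorem isPreconnected_connectedComponentIn_compl_union [LocallyConnectedSpace X]
    [PreconnectedSpace X] {E : Set X} (hE : IsClosed E) (hEc : IsConnected E) {z : X}
    (hz : z ∉ E) : IsPreconnected (connectedComponentIn Eᶜ z ∪ E) := by
  have hne : (frontier (connectedComponentIn Eᶜ z)).Nonempty := by
    rw [nonempty_frontier_iff]
    refine ⟨⟨z, mem_connectedComponentIn (F := Eᶜ) hz⟩, fun h => ?_⟩
    obtain ⟨e, he⟩ := hEc.nonempty
    exact connectedComponentIn_subset Eᶜ z (h ▸ mem_univ e) he
  obtain ⟨p, hp⟩ := hne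
  have hpE := frontier_connectedComponentIn_compl_subset hE z hp
  have h1 : IsPreconnected (insert p (connectedComponentIn Eᶜ z)) :=
    isPreconnected_connectedComponentIn.subset_closure (subset_insert _ _)
      (insert_subset hp.1 subset_closure)
  have h2 := h1.union p (mem_insert _ _) hpE hEc.isPreconnected
  rwa [insert_union, insert_eq_of_mem (mem_union_right _ hpE)] at h2

/-- A compact set each of whose neighbourhoods contains almost all terms of a sequence of
preconnected sets, and each of whose points is a limit of points of those sets, is preconnected. -/
theorem isPreconnected_of_tendsto [T2Space X] {C : ℕ → Set X} {D : Set X}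
    (hC : ∀ k, IsPreconnected (C k)) (hD : IsCompact D)
    (hsup : ∀ W, IsOpen W → D ⊆ W → ∀ᶠ k in atTop, C k ⊆ W)
    (hinf : ∀ x ∈ D, ∀ W, IsOpen W → x ∈ W → ∀ᶠ k in atTop, (C k ∩ W).Nonempty) :
    IsPreconnected D := by
  rw [isPreconnected_iff_subset_of_fully_disjoint_closed hD.isClosed]
  intro u v hu hv huv hdis
  by_contra! hcon
  obtain ⟨⟨a, haD, hau⟩, ⟨b, hbD, hbv⟩⟩ :
      (∃ a ∈ D, a ∉ u) ∧ ∃ b ∈ D, b ∉ v :=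
    ⟨not_subset.1 hcon.1, not_subset.1 hcon.2⟩
  obtain ⟨P, Q, hP, hQ, hPu, hQv, hPQ⟩ := SeparatedNhds.of_isCompact_isCompact
    (hD.inter_right hu) (hD.inter_right hv)
    (hdis.mono inter_subset_right inter_subset_right)
  have hDPQ : D ⊆ P ∪ Q := fun x hx =>
    (huv hx).imp (fun h => hPu ⟨hx, h⟩) (fun h => hQv ⟨hx, h⟩)
  obtain ⟨k, hk, hka, hkb⟩ := ((hsup _ (hP.union hQ) hDPQ).and
    ((hinf a haD Q hQ (hQv ⟨haD, (huv haD).resolve_left hau⟩)).and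
      (hinf b hbD P hP (hPu ⟨hbD, (huv hbD).resolve_right hbv⟩)))).exists
  obtain ⟨x, -, hxP, hxQ⟩ := hC k P Q hP hQ hk hkb hka
  exact disjoint_left.1 hPQ hxP hxQ

end General

/-- Convergence in Hausdorff distance to a compact set from its upper and lower topological
versions. -/
theorem tendsto_hausdorffDist_zero {X : Type*} [PseudoMetricSpace X] {C : ℕ → Set X} {D : Set X}
    (hD : IsCompact D)
    (hsup : ∀ W, IsOpen W → D ⊆ W → ∀ᶠ k in atTop, C k ⊆ W)
    (hinf : ∀ x ∈ D, ∀ W, IsOpen W → x ∈ W → ∀ᶠ k in atTop, (C k ∩ W).Nonempty) :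
    Tendsto (fun k => hausdorffDist (C k) D) atTop (𝓝 0) := by
  rw [Metric.tendsto_nhds]
  intro ε hε
  obtain ⟨t, htD, htf, hcov⟩ := hD.finite_cover_balls (e := ε / 4) (by positivity)
  have h1 : ∀ᶠ k in atTop, ∀ x ∈ t, (C k ∩ ball x (ε / 4)).Nonempty :=
    (eventually_all_finite htf).2 fun x hx =>
      hinf x (htD hx) _ isOpen_ball (mem_ball_self (by positivity))
  filter_upwards [h1, hsup _ isOpen_thickening (self_subset_thickening (half_pos hε) D)]
    with k hk1 hk2
  have hle : hausdorffDist (C k) D ≤ ε / 2 := by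
    refine hausdorffDist_le_of_mem_dist (by positivity) (fun x hx => ?_) (fun x hx => ?_)
    · obtain ⟨y, hy, hxy⟩ := mem_thickening_iff.1 (hk2 hx)
      exact ⟨y, hy, hxy.le⟩
    · obtain ⟨p, hp, hxp⟩ := mem_iUnion₂.1 (hcov hx)
      obtain ⟨y, hy, hyp⟩ := hk1 p hp
      refine ⟨y, hy, ?_⟩
      have := dist_triangle_right x y p
      rw [mem_ball] at hxp hyp
      linarith
  rw [Real.dist_eq, sub_zero, abs_of_nonneg hausdorffDist_nonneg]
  linarith

theorem UnbBelow.mono {S T : Set 𝔸} (h : UnbBelow S) (hST : S ⊆ T) : UnbBelow T :=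
  fun hT => h (hT.mono (image_mono hST))

theorem UnbAbove.mono {S T : Set 𝔸} (h : UnbAbove S) (hST : S ⊆ T) : UnbAbove T :=
  fun hT => h (hT.mono (image_mono hST))

theorem UnbBelow.exists_lt {S : Set 𝔸} (h : UnbBelow S) (m : ℝ) : ∃ p ∈ S, p.2 < m := by
  obtain ⟨_, ⟨p, hp, rfl⟩, hlt⟩ := not_bddBelow_iff.1 h m
  exact ⟨p, hp, hlt⟩

theorem UnbAbove.exists_gt {S : Set 𝔸} (h : UnbAbove S) (m : ℝ) : ∃ p ∈ S, m < p.2 := by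
  obtain ⟨_, ⟨p, hp, rfl⟩, hlt⟩ := not_bddAbove_iff.1 h m
  exact ⟨p, hp, hlt⟩

theorem isBounded_of_abs_snd_le {S : Set 𝔸} {M : ℝ} (h : ∀ p ∈ S, |p.2| ≤ M) :
    Bornology.IsBounded S :=
  (isCompact_univ.prod (isCompact_Icc (a := -M) (b := M))).isBounded.subset
    fun p hp => mk_mem_prod (mem_univ p.1) (mem_Icc.2 (abs_le.1 (h p hp)))

theorem isPreconnected_snd_lt (m : ℝ) : IsPreconnected {p : 𝔸 | p.2 < m} := by
  have : {p : 𝔸 | p.2 < m} = univ ×ˢ Iio m := by ext; simp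
  exact this ▸ isPreconnected_univ.prod isPreconnected_Iio

theorem isPreconnected_lt_snd (m : ℝ) : IsPreconnected {p : 𝔸 | m < p.2} := by
  have : {p : 𝔸 | m < p.2} = univ ×ˢ Ioi m := by ext; simp
  exact this ▸ isPreconnected_univ.prod isPreconnected_Ioi

theorem unbBelow_snd_lt (m : ℝ) : UnbBelow {p : 𝔸 | p.2 < m} :=
  not_bddBelow_iff.2 fun x => ⟨min m x - 1, ⟨(0, min m x - 1),
    by simp only [mem_ofPred_eq]; linarith [min_le_left m x], rfl⟩, by linarith [min_le_right m x]⟩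

theorem unbAbove_lt_snd (m : ℝ) : UnbAbove {p : 𝔸 | m < p.2} :=
  not_bddAbove_iff.2 fun x => ⟨max m x + 1, ⟨(0, max m x + 1),
    by simp only [mem_ofPred_eq]; linarith [le_max_left m x], rfl⟩, by linarith [le_max_right m x]⟩

theorem mem_uminus_of_isPreconnected {E S : Set 𝔸} (hS : IsPreconnected S) (hSE : S ⊆ Eᶜ)
    (hb : UnbBelow S) {z : 𝔸} (hz : z ∈ S) : z ∈ Uminus E :=
  ⟨hSE hz, hb.mono (hS.subset_connectedComponentIn hz hSE)⟩

theorem disjoint_uminus_self (E : Set 𝔸) : Disjoint E (Uminus E) :=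
  disjoint_left.2 fun _ hz hz' => hz'.1 hz

namespace IsEssentialContinuum

variable {E F : Set 𝔸}

theorem exists_uminus_eq (hE : IsEssentialContinuum E) :
    ∃ z ∉ E, Uminus E = connectedComponentIn Eᶜ z ∧ UnbBelow (Uminus E) ∧
      ¬ UnbAbove (Uminus E) := by
  obtain ⟨-, -, U, V, -, ⟨z, hz, rfl⟩, -, -, hUb, hVb, hVa, huniq⟩ := hE
  have heq : Uminus E = connectedComponentIn Eᶜ z := by
    refine Subset.antisymm (fun w hw => ?_) (fun w hw =>
      ⟨connectedComponentIn_subset _ _ hw, connectedComponentIn_eq hw ▸ hVb⟩)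
    have hnb : ¬ Bornology.IsBounded (connectedComponentIn Eᶜ w) := fun hb =>
      hw.2 (hb.image_snd).bddBelow
    rcases huniq _ ⟨w, hw.1, rfl⟩ hnb with h | h
    · exact absurd (h ▸ hw.2) hUb
    · exact h ▸ mem_connectedComponentIn (F := Eᶜ) hw.1
  exact ⟨z, hz, heq, heq ▸ hVb, heq ▸ hVa⟩

theorem isOpen_uminus (hE : IsEssentialContinuum E) : IsOpen (Uminus E) := by
  obtain ⟨z, -, h, -⟩ := hE.exists_uminus_eq
  exact h ▸ hE.1.isClosed.isOpen_compl.connectedComponentIn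

theorem frontier_uminus_subset (hE : IsEssentialContinuum E) : frontier (Uminus E) ⊆ E := by
  obtain ⟨z, -, h, -⟩ := hE.exists_uminus_eq
  exact h ▸ frontier_connectedComponentIn_compl_subset hE.1.isClosed z

theorem disjoint_uminus_of_isPreconnected (hE : IsEssentialContinuum E) {S : Set 𝔸}
    (hS : IsPreconnected S) (hSE : S ⊆ Eᶜ) (ha : UnbAbove S) : Disjoint S (Uminus E) := by
  obtain ⟨z, -, h, -, hna⟩ := hE.exists_uminus_eq
  rw [disjoint_left]
  intro w hw hwE
  refine hna (ha.mono ?_)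
  rw [h] at hwE ⊢
  rw [connectedComponentIn_eq hwE]
  exact hS.subset_connectedComponentIn hw hSE

theorem disjoint_uminus_of_prec (hE : IsEssentialContinuum E) (hF : IsEssentialContinuum F)
    (hEF : Prec E F) : Disjoint F (Uminus E) := by
  rw [disjoint_left]
  intro x hxF hxE
  obtain ⟨z, hz, hzE, -⟩ := hE.exists_uminus_eq
  have hFEc : F ⊆ Eᶜ := fun y hyF hyE => (hEF hyE).1 hyF
  have hFU : F ⊆ Uminus E := by
    rw [hzE] at hxE ⊢
    rw [connectedComponentIn_eq hxE]
    exact hF.2.1.isPreconnected.subset_connectedComponentIn hxF hFEc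
  obtain ⟨U, -, ⟨w, hw, rfl⟩, -, -, hUa, hUb, -⟩ := hE.2.2
  have hconn := isPreconnected_connectedComponentIn_compl_union hE.1.isClosed hE.2.1 hw
  have hsub : connectedComponentIn Eᶜ w ∪ E ⊆ Fᶜ := by
    rintro y (hy | hy) hyF
    · exact hUb (connectedComponentIn_eq hy ▸ (hFU hyF).2)
    · exact hFEc hyF hy
  obtain ⟨e, he⟩ := hE.2.1.nonempty
  exact disjoint_left.1 (hF.disjoint_uminus_of_isPreconnected hconn hsub
    (hUa.mono subset_union_left)) (Or.inr he) (hEF he)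

theorem uminus_subset_of_prec (hE : IsEssentialContinuum E) (hF : IsEssentialContinuum F)
    (hEF : Prec E F) : Uminus E ⊆ Uminus F := by
  obtain ⟨z, -, hzE, hb, -⟩ := hE.exists_uminus_eq
  exact fun w hw => mem_uminus_of_isPreconnected
    (hzE ▸ isPreconnected_connectedComponentIn)
    (disjoint_right.1 (hE.disjoint_uminus_of_prec hF hEF)) hb hw

end IsEssentialContinuum

/-- A compact connected set which is the frontier of a set containing a neighbourhood of the
lower end and missing a neighbourhood of the upper end is an essential continuum. -/
theorem isEssentialContinuum_frontier {O : Set 𝔸} {M : ℝ} (hcpt : IsCompact (frontier O))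
    (hconn : IsConnected (frontier O)) (hM : ∀ p ∈ frontier O, |p.2| ≤ M)
    (hlow : {p : 𝔸 | p.2 < -M} ⊆ O) (hhigh : Disjoint {p : 𝔸 | M < p.2} O) :
    IsEssentialContinuum (frontier O) := by
  have hLD : {p : 𝔸 | p.2 < -M} ⊆ (frontier O)ᶜ := fun p hp hpD => by
    have := (abs_le.1 (hM p hpD)).1
    simp only [mem_ofPred_eq] at hp
    linarith
  have hHD : {p : 𝔸 | M < p.2} ⊆ (frontier O)ᶜ := fun p hp hpD => by
    have := (abs_le.1 (hM p hpD)).2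
    simp only [mem_ofPred_eq] at hp
    linarith
  obtain ⟨a, ha⟩ : ∃ a : 𝔸, M < a.2 := ⟨(0, M + 1), by simp⟩
  obtain ⟨b, hb⟩ : ∃ b : 𝔸, b.2 < -M := ⟨(0, -M - 1), by simp⟩
  have hH := (isPreconnected_lt_snd M).subset_connectedComponentIn ha hHD
  have hL := (isPreconnected_snd_lt (-M)).subset_connectedComponentIn hb hLD
  have hdis : ∀ z, z ∈ connectedComponentIn (frontier O)ᶜ a →
      z ∉ connectedComponentIn (frontier O)ᶜ b := by
    intro z hza hzb
    have hab := (connectedComponentIn_eq hza).trans (connectedComponentIn_eq hzb).symm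
    obtain ⟨p, hp, hpO⟩ := inter_frontier_nonempty_of_isPreconnected
      isPreconnected_connectedComponentIn
      (⟨b, hL hb, hlow hb⟩ : (connectedComponentIn (frontier O)ᶜ b ∩ O).Nonempty)
      ⟨a, hab ▸ hH ha, disjoint_left.1 hhigh ha⟩
    exact connectedComponentIn_subset _ _ hp hpO
  refine ⟨hcpt, hconn, connectedComponentIn (frontier O)ᶜ a, connectedComponentIn (frontier O)ᶜ b,
    ⟨a, hHD ha, rfl⟩, ⟨b, hLD hb, rfl⟩, fun h => hdis a (hH ha) (h ▸ hH ha),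
    (unbAbove_lt_snd M).mono hH, fun h => ?_, (unbBelow_snd_lt _).mono hL, fun h => ?_, ?_⟩
  · obtain ⟨p, hp, hlt⟩ := h.exists_lt (-M)
    exact hdis p hp (hL hlt)
  · obtain ⟨p, hp, hlt⟩ := h.exists_gt M
    exact hdis p (hH hlt) hp
  · rintro _ ⟨z, -, rfl⟩ hnb
    obtain ⟨p, hp, hpM⟩ : ∃ p ∈ connectedComponentIn (frontier O)ᶜ z, M < |p.2| := by
      by_contra! h
      exact hnb (isBounded_of_abs_snd_le h)
    rcases lt_abs.1 hpM with h | h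
    · exact Or.inl ((connectedComponentIn_eq hp).trans (connectedComponentIn_eq (hH h)).symm)
    · exact Or.inr ((connectedComponentIn_eq hp).trans
        (connectedComponentIn_eq (hL (lt_neg_of_lt_neg h))).symm)

theorem increasing_essential_continua_converge
    (C : ℕ → Set 𝔸) (hC : ∀ k, IsEssentialContinuum (C k))
    (K : Set 𝔸) (hK : IsCompact K) (hCK : ∀ k, C k ⊆ K)
    (hmono : ∀ k, Prec (C k) (C (k + 1))) :
    ∃ D : Set 𝔸, IsEssentialContinuum D ∧
      Tendsto (fun k => hausdorffDist (C k) D) atTop (𝓝 0) ∧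
      D = frontier (⋃ k, Uminus (C k)) := by
  set O : Set 𝔸 := ⋃ k, Uminus (C k)
  have hU : Monotone fun k => Uminus (C k) :=
    monotone_nat_of_le_succ fun k => (hC k).uminus_subset_of_prec (hC (k + 1)) (hmono k)
  have hOo : IsOpen O := isOpen_iUnion fun k => (hC k).isOpen_uminus
  have hCO : ∀ k, C k ⊆ O := fun k => (hmono k).trans (subset_iUnion (fun k => Uminus (C k)) _)
  have hinf : ∀ x ∈ frontier O, ∀ W, IsOpen W → x ∈ W →
      ∀ᶠ k in atTop, (C k ∩ W).Nonempty := by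
    intro x hx W hW hxW
    obtain ⟨V, hVW, hVo, hxV, hVc⟩ :=
      locallyConnectedSpace_iff_subsets_isOpen_isConnected.1 inferInstance x W (hW.mem_nhds hxW)
    obtain ⟨y, hyV, hyO⟩ := _root_.mem_closure_iff.1 hx.1 V hVo hxV
    obtain ⟨m, hm⟩ := mem_iUnion.1 hyO
    rw [hOo.frontier_eq] at hx
    filter_upwards [eventually_ge_atTop m] with k hk
    obtain ⟨p, hpV, hp⟩ := inter_frontier_nonempty_of_isPreconnected hVc.isPreconnected
      (⟨y, hyV, hU hk hm⟩ : (V ∩ Uminus (C k)).Nonempty)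
      ⟨x, hxV, fun h => hx.2 (mem_iUnion.2 ⟨k, h⟩)⟩
    exact ⟨p, (hC k).frontier_uminus_subset hp, hVW hpV⟩
  have hDK : frontier O ⊆ K := fun x hx => by
    rw [← hK.isClosed.closure_eq, _root_.mem_closure_iff]
    intro W hW hxW
    obtain ⟨k, p, hp, hpW⟩ := (hinf x hx W hW hxW).exists
    exact ⟨p, hpW, hCK k hp⟩
  have hD : IsCompact (frontier O) := hK.of_isClosed_subset isClosed_frontier hDK
  have hsup : ∀ W, IsOpen W → frontier O ⊆ W → ∀ᶠ k in atTop, C k ⊆ W := by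
    intro W hW hDW
    have hcl : K ∩ (closure O \ W) ⊆ ⋃ k, Uminus (C k) := fun x hx => by
      by_contra hxO
      exact hx.2.2 (hDW (hOo.frontier_eq ▸ ⟨hx.2.1, hxO⟩))
    obtain ⟨m, hm⟩ := (hK.inter_right (isClosed_closure.sdiff hW)).elim_directed_cover
      (fun k => Uminus (C k)) (fun k => (hC k).isOpen_uminus) hcl hU.directed_le
    filter_upwards [eventually_ge_atTop m] with k hk x hx
    by_contra hxW
    exact disjoint_left.1 (disjoint_uminus_self (C k)) hx
      (hU hk (hm ⟨hCK k hx, subset_closure (hCO k hx), hxW⟩))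
  have hne : (frontier O).Nonempty := by
    by_contra h
    obtain ⟨k, hk⟩ := (hsup ∅ isOpen_empty (not_nonempty_iff_eq_empty.1 h).subset).exists
    obtain ⟨x, hx⟩ := (hC k).2.1.nonempty
    exact hk hx
  have hconn : IsConnected (frontier O) :=
    ⟨hne, isPreconnected_of_tendsto (fun k => (hC k).2.1.isPreconnected) hD hsup hinf⟩
  obtain ⟨M, hM⟩ : ∃ M : ℝ, ∀ p ∈ K, |p.2| ≤ M :=
    hK.exists_bound_of_continuousOn continuous_snd.continuousOn
  refine ⟨frontier O, isEssentialContinuum_frontier hD hconn (fun p hp => hM p (hDK hp))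
    (fun p hp => mem_iUnion.2 ⟨0, ?_⟩) ?_, tendsto_hausdorffDist_zero hD hsup hinf, rfl⟩
  · refine mem_uminus_of_isPreconnected (isPreconnected_snd_lt (-M)) (fun q hq hqC => ?_)
      (unbBelow_snd_lt _) hp
    have := (abs_le.1 (hM q (hCK 0 hqC))).1
    simp only [mem_ofPred_eq] at hq
    linarith
  · refine disjoint_iUnion_right.2 fun k => (hC k).disjoint_uminus_of_isPreconnected
      (isPreconnected_lt_snd M) (fun q hq hqC => ?_) (unbAbove_lt_snd M)
    have := (abs_le.1 (hM q (hCK k hqC))).2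
    simp only [mem_ofPred_eq] at hq
    linarith
end
end

section
/- Let H : 𝔸 → ℝ be a continuous surjection such that every fiber H⁻¹(t) is an essential annular continuum, H⁻¹(s) ≺ H⁻¹(t) whenever s < t, and H⁻¹(I) is compact for every compact interval I ⊂ ℝ. Then for each ε > 0 and each t ∈ ℝ there exists an open neighborhood I_t of t in ℝ such that for every closed interval I ⊂ I_t ∖ {t} one has uw(H⁻¹(I)) < ε. -/
/- STATEMENT 4: For a continuous surjection `H : 𝔸 → ℝ` whose fibers are
ordered essential annular continua (with compact preimages of compact
intervals), every `t ∈ ℝ` has a neighborhood `I_t` such that every closed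
interval `I ⊆ I_t ∖ {t}` satisfies `uw(H⁻¹(I)) < ε`. -/

noncomputable section
open Set Metric Filter Topology Function

theorem isPreconnected_ball_circle (x : 𝕊) (r : ℝ) : IsPreconnected (ball x r) := by
  obtain ⟨c, rfl⟩ := QuotientAddGroup.mk_surjective x
  have h : ball (c : 𝕊) r = (fun y : ℝ => (y : 𝕊)) '' ball c r := by
    ext u
    simp only [mem_ball, mem_image]
    constructor
    · intro hu
      obtain ⟨m, hm, hmr⟩ := QuotientAddGroup.exists_norm_mk_lt (u - (c : 𝕊)) (sub_pos.2 hu)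
      refine ⟨c + m, ?_, ?_⟩
      · rw [dist_eq_norm] at hmr ⊢
        simpa using hmr
      · rw [AddCircle.coe_add]
        exact (congrArg (fun v => (c : 𝕊) + v) hm).trans (add_sub_cancel _ _)
    · rintro ⟨y, hy, rfl⟩
      rw [dist_eq_norm] at hy ⊢
      exact lt_of_le_of_lt
        (QuotientAddGroup.norm_mk_le_norm (S := AddSubgroup.zmultiples (1 : ℝ)) (m := y - c)) hy
  rw [show (QuotientAddGroup.mk c : 𝕊) = (c : 𝕊) from rfl, h]
  exact (convex_ball c r).isPreconnected.image _ (AddCircle.continuous_mk' 1).continuousOn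

theorem isPreconnected_ball_annulus (x : 𝔸) (r : ℝ) : IsPreconnected (ball x r) := by
  rw [← ball_prod_same]
  exact (isPreconnected_ball_circle _ _).prod (convex_ball _ _).isPreconnected

/-- Near a level of a proper function, every point slightly below that level is close both to
the level itself and to a point of a definite lower height. -/
theorem exists_near_level_and_lower {X : Type*} [PseudoMetricSpace X] {f : X → ℝ}
    (hf : Continuous f) (hcomp : ∀ a b : ℝ, IsCompact (f ⁻¹' Icc a b)) (t : ℝ) {η : ℝ}
    (hη : 0 < η) :
    ∃ δ > 0, ∀ x, t - δ < f x → f x < t →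
      ∃ z p, dist z x < η ∧ f z = t ∧ dist p x < η ∧ f p ≤ t - δ := by
  by_contra! hcon
  choose x hx hxt hbad using fun n : ℕ => hcon (1 / ((n : ℝ) + 1)) (by positivity)
  have hxmem : ∀ n, x n ∈ f ⁻¹' Icc (t - 1) t := fun n => by
    refine ⟨?_, (hxt n).le⟩
    have : 1 / ((n : ℝ) + 1) ≤ 1 := by
      rw [div_le_one (by positivity)]
      linarith [(Nat.cast_nonneg n : (0 : ℝ) ≤ n)]
    linarith [hx n]
  obtain ⟨z, -, φ, hφ, hlim⟩ := (hcomp _ _).tendsto_subseq hxmem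
  have hone : Tendsto (fun n => t - 1 / ((φ n : ℝ) + 1)) atTop (𝓝 t) := by
    simpa using
      (tendsto_one_div_add_atTop_nhds_zero_nat.comp hφ.tendsto_atTop).const_sub t
  have hfz : f z = t := by
    refine tendsto_nhds_unique ((hf.tendsto z).comp hlim) ?_
    exact tendsto_of_tendsto_of_tendsto_of_le_of_le hone tendsto_const_nhds
      (fun n => (hx (φ n)).le) (fun n => (hxt (φ n)).le)
  have hclose : ∀ᶠ n in atTop, dist (x (φ n)) z < η / 2 :=
    hlim.eventually (ball_mem_nhds z (half_pos hη))
  obtain ⟨m, hm⟩ := hclose.exists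
  obtain ⟨n, hn, hnm⟩ := (hclose.and (hone.eventually (lt_mem_nhds (hxt (φ m))))).exists
  have h1 : dist z (x (φ n)) < η := by rw [dist_comm]; linarith
  have h2 : dist (x (φ m)) (x (φ n)) < η := by
    linarith [dist_triangle_right (x (φ m)) (x (φ n)) z]
  exact absurd (hbad (φ n) z (x (φ m)) h1 hfz h2) (not_lt.2 hnm.le)

/-- Under the hypotheses on the fibers, `H` tends to `±∞` at the corresponding ends. -/
theorem ends_of_ordered_fibers {H : 𝔸 → ℝ} (hHc : Continuous H)
    (hHs : Function.Surjective H)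
    (hord : ∀ s t : ℝ, s < t → Prec (H ⁻¹' {s}) (H ⁻¹' {t}))
    (hcomp : ∀ a b : ℝ, IsCompact (H ⁻¹' Set.Icc a b)) (K : ℝ) :
    ∃ M : ℝ, (∀ q : 𝔸, q.2 < -M → H q < -K) ∧ (∀ q : 𝔸, M < q.2 → K < H q) := by
  wlog hK : 0 ≤ K generalizing K
  · obtain ⟨M, h1, h2⟩ := this 0 le_rfl
    exact ⟨M, fun q hq => by linarith [h1 q hq], fun q hq => by linarith [h2 q hq]⟩
  obtain ⟨M, hM⟩ := (hcomp (-K) K).isBounded.subset_closedBall (0 : 𝔸)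
  have hin : ∀ q : 𝔸, -K ≤ H q → H q ≤ K → |q.2| ≤ M := fun q h1 h2 => by
    have := hM (show q ∈ H ⁻¹' Icc (-K) K from ⟨h1, h2⟩)
    rw [mem_closedBall, dist_zero_right] at this
    exact (norm_snd_le q).trans this
  have hconst : ∀ S : Set ℝ, Convex ℝ S → (∀ y ∈ S, M < |y|) → (∃ q : 𝔸, q.2 ∈ S ∧ H q < -K) →
      ∀ q : 𝔸, q.2 ∈ S → H q < -K := by
    rintro S hS hSM ⟨p, hp, hpK⟩ q hq
    by_contra! hqK
    have hpre : IsPreconnected ((univ : Set 𝕊) ×ˢ S) :=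
      isPreconnected_univ.prod hS.isPreconnected
    obtain ⟨r, hr, hrK⟩ := (hpre.image H hHc.continuousOn).Icc_subset
      (mem_image_of_mem H (show p ∈ (univ : Set 𝕊) ×ˢ S from ⟨trivial, hp⟩))
      (mem_image_of_mem H (show q ∈ (univ : Set 𝕊) ×ˢ S from ⟨trivial, hq⟩))
      (⟨hpK.le, hqK⟩ : -K ∈ Icc (H p) (H q))
    exact absurd (hin r hrK.ge (by linarith)) (not_le.2 (hSM _ hr.2))
  have hbelow : ∀ q : 𝔸, q.2 < -M → H q < -K := by
    refine hconst (Iio (-M)) (convex_Iio _) (fun y hy => ?_) ?_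
    · exact lt_abs.2 (Or.inr (by linarith [mem_Iio.1 hy]))
    obtain ⟨p, hp⟩ := hHs (-K - 1)
    obtain ⟨-, hub⟩ := hord (-K - 1) (-K) (by linarith) (show p ∈ H ⁻¹' {-K - 1} from hp)
    obtain ⟨y, ⟨q, hq, rfl⟩, hqM⟩ := not_bddBelow_iff.1 hub (-M)
    refine ⟨q, hqM, ?_⟩
    by_contra! hqK
    have hpm : p ∈ connectedComponentIn (H ⁻¹' {-K})ᶜ p :=
      mem_connectedComponentIn (by simp [hp])
    obtain ⟨r, hr, hrK⟩ := (isPreconnected_connectedComponentIn.image H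
      hHc.continuousOn).Icc_subset (mem_image_of_mem H hpm) (mem_image_of_mem H hq)
      (⟨by rw [hp]; linarith, hqK⟩ : -K ∈ Icc (H p) (H q))
    exact connectedComponentIn_subset _ _ hr hrK
  refine ⟨M, hbelow, fun q hq => ?_⟩
  by_contra! hqK
  have hqK' : H q < -K := by
    by_contra! h
    exact absurd (hin q h hqK) (not_le.2 (lt_abs.2 (Or.inl hq)))
  have habove : ∀ r : 𝔸, M < r.2 → H r < -K :=
    hconst (Ioi M) (convex_Ioi _) (fun y hy => lt_abs.2 (Or.inl hy)) ⟨q, hq, hqK'⟩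
  have hcpt : IsCompact ((univ : Set 𝕊) ×ˢ Icc (-M) M) := isCompact_univ.prod isCompact_Icc
  obtain ⟨B, hB⟩ := (hcpt.image hHc).bddAbove
  obtain ⟨r, hr⟩ := hHs (max K B + 1)
  have hrK : -K ≤ H r := by rw [hr]; linarith [le_max_left K B]
  have hmem : r ∈ (univ : Set 𝕊) ×ˢ Icc (-M) M := by
    refine ⟨trivial, ?_, ?_⟩
    · by_contra! h
      exact absurd (hbelow r h) (not_lt.2 hrK)
    · by_contra! h
      exact absurd (habove r h) (not_lt.2 hrK)
  linarith [hB (mem_image_of_mem H hmem), le_max_right K B]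

/-- An essential continuum in `H⁻¹[a,b]` meets every connected set joining `{H < a}` to
`{H > b}`. -/
theorem essential_meets_crossing {H : 𝔸 → ℝ} (hHc : Continuous H)
    (hHs : Function.Surjective H)
    (hfib : ∀ t : ℝ, IsEssentialAnnularContinuum (H ⁻¹' {t}))
    (hord : ∀ s t : ℝ, s < t → Prec (H ⁻¹' {s}) (H ⁻¹' {t}))
    (hcomp : ∀ a b : ℝ, IsCompact (H ⁻¹' Set.Icc a b)) {a b : ℝ} {C : Set 𝔸}
    (hC : IsEssentialContinuum C) (hCab : C ⊆ H ⁻¹' Icc a b) {S : Set 𝔸}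
    (hS : IsPreconnected S) {p z : 𝔸} (hpS : p ∈ S) (hzS : z ∈ S) (hp : H p < a)
    (hz : b < H z) : (S ∩ C).Nonempty := by
  by_contra hempty
  have hSC : S ⊆ Cᶜ := fun q hq hqC => hempty ⟨q, hq, hqC⟩
  have hcoind : IsCoinducing H :=
    ((isProperMap_iff_isCompact_preimage.2 ⟨hHc, fun K hK => by
      obtain ⟨R, hR⟩ := hK.isBounded.subset_closedBall 0
      rw [Real.closedBall_eq_Icc] at hR
      exact (hcomp _ _).of_isClosed_subset (hK.isClosed.preimage hHc)
        (preimage_mono hR)⟩).isClosedMap.isQuotientMap hHc hHs).isCoinducing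
  have hfc : ∀ t : ℝ, IsConnected (H ⁻¹' {t}) := fun t => (hfib t).2.1
  have hlow : H ⁻¹' Iic (H p) ⊆ connectedComponentIn Cᶜ p :=
    (hcoind.isConnected_preimage_of_isClosed hfc isClosed_Iic
      isConnected_Iic).isPreconnected.subset_connectedComponentIn (mem_preimage.2 self_mem_Iic)
      fun q hq hqC => by linarith [(hCab hqC).1, mem_Iic.1 (mem_preimage.1 hq)]
  have hhigh : H ⁻¹' Ici (H z) ⊆ connectedComponentIn Cᶜ z :=
    (hcoind.isConnected_preimage_of_isClosed hfc isClosed_Ici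
      isConnected_Ici).isPreconnected.subset_connectedComponentIn (mem_preimage.2 self_mem_Ici)
      fun q hq hqC => by linarith [(hCab hqC).2, mem_Ici.1 (mem_preimage.1 hq)]
  have heq : connectedComponentIn Cᶜ p = connectedComponentIn Cᶜ z :=
    connectedComponentIn_eq (hS.subset_connectedComponentIn hpS hSC hzS)
  have hbelow : UnbBelow (connectedComponentIn Cᶜ p) := by
    obtain ⟨M, hM, -⟩ := ends_of_ordered_fibers hHc hHs hord hcomp (-H p)
    refine not_bddBelow_iff.2 fun y => ?_
    refine ⟨min y (-M) - 1, ⟨((0 : 𝕊), min y (-M) - 1), hlow ?_, rfl⟩, ?_⟩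
    · have := hM ((0 : 𝕊), min y (-M) - 1) (by dsimp only; linarith [min_le_right y (-M)])
      rw [neg_neg] at this
      exact this.le
    · linarith [min_le_left y (-M)]
  have habove : UnbAbove (connectedComponentIn Cᶜ p) := by
    rw [heq]
    obtain ⟨M, -, hM⟩ := ends_of_ordered_fibers hHc hHs hord hcomp (H z)
    refine not_bddAbove_iff.2 fun y => ?_
    refine ⟨max y M + 1, ⟨((0 : 𝕊), max y M + 1), hhigh ?_, rfl⟩, ?_⟩
    · exact (hM ((0 : 𝕊), max y M + 1) (by dsimp only; linarith [le_max_right y M])).le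
    · linarith [le_max_left y M]
  obtain ⟨-, -, U, V, -, -, -, -, hU, -, hV, hall⟩ := hC
  have hunb : ¬ Bornology.IsBounded (connectedComponentIn Cᶜ p) := fun h =>
    habove h.image_snd.bddAbove
  rcases hall _ ⟨p, hSC hpS, rfl⟩ hunb with h | h
  · exact hU (h ▸ hbelow)
  · exact hV (h ▸ habove)

theorem small_upper_width_near_fiber
    (H : 𝔸 → ℝ) (hHc : Continuous H) (hHs : Function.Surjective H)
    (hfib : ∀ t : ℝ, IsEssentialAnnularContinuum (H ⁻¹' {t}))
    (hord : ∀ s t : ℝ, s < t → Prec (H ⁻¹' {s}) (H ⁻¹' {t}))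
    (hcomp : ∀ a b : ℝ, IsCompact (H ⁻¹' Set.Icc a b)) :
    ∀ ε > (0:ℝ), ∀ t : ℝ, ∃ U : Set ℝ, IsOpen U ∧ t ∈ U ∧
      ∀ a b : ℝ, a ≤ b → Set.Icc a b ⊆ U \ {t} →
        uw (H ⁻¹' Set.Icc a b) < ε := by
  intro ε hε t
  obtain ⟨δ₁, hδ₁, h₁⟩ := exists_near_level_and_lower hHc hcomp t
    (show 0 < ε / 4 by positivity)
  obtain ⟨δ₂, hδ₂, h₂⟩ := exists_near_level_and_lower (f := fun q => -H q) hHc.neg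
    (fun a b => by
      have h : (fun q => -H q) ⁻¹' Icc a b = H ⁻¹' Icc (-b) (-a) := by
        rw [← neg_Icc]
        rfl
      rw [h]
      exact hcomp _ _) (-t)
    (show 0 < ε / 4 by positivity)
  refine ⟨Ioo (t - δ₁) (t + δ₂), isOpen_Ioo, ⟨by linarith, by linarith⟩, fun a b hab hI => ?_⟩
  have ha := hI (left_mem_Icc.2 hab)
  have hb := hI (right_mem_Icc.2 hab)
  have hcross : ∀ x, H x ∈ Icc a b → ∃ z p, dist z x < ε / 4 ∧ dist p x < ε / 4 ∧
      H p < a ∧ b < H z := by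
    rintro x ⟨hax, hxb⟩
    rcases lt_or_ge b t with hbt | htb
    · obtain ⟨z, p, hzx, hzt, hpx, hp⟩ := h₁ x (by linarith [ha.1.1]) (by linarith)
      exact ⟨z, p, hzx, hpx, by linarith [ha.1.1], by linarith⟩
    · have hta : t < a := by
        by_contra! hat
        exact (hI ⟨hat, htb⟩).2 rfl
      obtain ⟨z, p, hzx, hzt, hpx, hp⟩ := h₂ x (by linarith [hb.1.2]) (by linarith)
      exact ⟨p, z, hpx, hzx, by linarith, by linarith [hb.1.2]⟩
  have hnear : ∀ C₁ C₂ : Set 𝔸, C₁ ⊆ H ⁻¹' Icc a b → IsEssentialContinuum C₂ →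
      C₂ ⊆ H ⁻¹' Icc a b → ∀ x ∈ C₁, ∃ y ∈ C₂, dist x y ≤ ε / 4 := by
    intro C₁ C₂ hC₁ hE hC₂ x hx
    obtain ⟨z, p, hz, hp, hpa, hbz⟩ := hcross x (hC₁ hx)
    obtain ⟨y, hy, hyC⟩ := essential_meets_crossing hHc hHs hfib hord hcomp hE hC₂
      (isPreconnected_ball_annulus x (ε / 4)) hp hz hpa hbz
    exact ⟨y, hyC, by rw [dist_comm]; exact (mem_ball.1 hy).le⟩
  refine lt_of_le_of_lt (Real.sSup_le ?_ (show 0 ≤ ε / 4 by positivity)) (by linarith)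
  rintro r ⟨C₁, C₂, hE₁, hE₂, hC₁, hC₂, rfl⟩
  exact hausdorffDist_le_of_mem_dist (by positivity) (hnear C₁ C₂ hC₁ hE₂ hC₂)
    (hnear C₂ C₁ hC₂ hE₁ hC₁)
end
end
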